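/- Let R be a Hecke operator on V, set n = dim_K V, assume the quantum integers [k]_q = 1 + q + ⋯ + q^{k−1} are nonzero in K for every integer k ≥ 1, and suppose R is an even Hecke operator of rank equal to n, i.e. λ_n = 1 and λ_k = 0 for all k > n. Then e_k = C(n² + k − 1, k) for all k ≥ 0, i.e. P_E(t) = (1 − t)^{−n²}. (Corollary 3.3, assertion about E) -/

import Mathlib

open TensorProduct

/-- The Yang–Baxter equation for an operator `R` on `V ⊗ V`, stated on `(V ⊗ V) ⊗ V`:
`(R ⊗ 1)(1 ⊗ R)(R ⊗ 1) = (1 ⊗ R)(R ⊗ 1)(1 ⊗ R)`, where `1 ⊗ R` is transported along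
the associator. -/
def YangBaxter (K : Type*) [Field K] (V : Type*) [AddCommGroup V] [Module K V]
    (R : V ⊗[K] V →ₗ[K] V ⊗[K] V) : Prop :=
  let R₁ : (V ⊗[K] V) ⊗[K] V →ₗ[K] (V ⊗[K] V) ⊗[K] V := LinearMap.rTensor V R
  let R₂ : (V ⊗[K] V) ⊗[K] V →ₗ[K] (V ⊗[K] V) ⊗[K] V :=
    (TensorProduct.assoc K V V V).symm.toLinearMap ∘ₗ LinearMap.lTensor V R ∘ₗ
      (TensorProduct.assoc K V V V).toLinearMap
  R₁ ∘ₗ R₂ ∘ₗ R₁ = R₂ ∘ₗ R₁ ∘ₗ R₂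

/-- A Hecke operator on `V` for the parameter `q`: the Yang–Baxter equation together
with the Hecke equation `(R + 1)(R − q) = 0`. -/
def IsHecke (K : Type*) [Field K] (V : Type*) [AddCommGroup V] [Module K V]
    (q : K) (R : V ⊗[K] V →ₗ[K] V ⊗[K] V) : Prop :=
  YangBaxter K V R ∧ (R + LinearMap.id) ∘ₗ (R - q • LinearMap.id) = 0

/-- The multiplication map `V ⊗ V → T(V)` of the tensor algebra. -/
noncomputable def quadMul (K : Type*) [Field K] (V : Type*) [AddCommGroup V] [Module K V] :
    V ⊗[K] V →ₗ[K] TensorAlgebra K V :=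
  LinearMap.mul' K (TensorAlgebra K V) ∘ₗ
    TensorProduct.map (TensorAlgebra.ι K) (TensorAlgebra.ι K)

/-- The relation on `T(V)` identifying the image of `W ⊆ V ⊗ V` with zero; quotienting
by (the two-sided ideal generated by) it yields the quadratic algebra `T(V)/⟨W⟩`. -/
def quadRel (K : Type*) [Field K] (V : Type*) [AddCommGroup V] [Module K V]
    (W : Submodule K (V ⊗[K] V)) : TensorAlgebra K V → TensorAlgebra K V → Prop :=
  fun a b => b = 0 ∧ ∃ w ∈ W, a = quadMul K V w

/-- The dimension of the `n`-th homogeneous component of the quadratic algebra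
`T(V)/⟨W⟩`, realised as the image of the degree-`n` component of `T(V)` in the
quotient algebra. -/
noncomputable def quadDim (K : Type*) [Field K] (V : Type*) [AddCommGroup V] [Module K V]
    (W : Submodule K (V ⊗[K] V)) (n : ℕ) : ℕ :=
  Module.finrank K
    (Submodule.map (RingQuot.mkAlgHom K (quadRel K V W)).toLinearMap
      (LinearMap.range (TensorAlgebra.ι K (M := V)) ^ n))

/-- `λ_n`, the dimension of the `n`-th homogeneous component of `Λ = T(V)/⟨Im(R+1)⟩`. -/
noncomputable def lambdaDim (K : Type*) [Field K] (V : Type*) [AddCommGroup V] [Module K V]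
    (R : V ⊗[K] V →ₗ[K] V ⊗[K] V) (n : ℕ) : ℕ :=
  quadDim K V (LinearMap.range (R + LinearMap.id)) n

/-- `s_n`, the dimension of the `n`-th homogeneous component of `S = T(V)/⟨Im(R−q)⟩`. -/
noncomputable def sDim (K : Type*) [Field K] (V : Type*) [AddCommGroup V] [Module K V]
    (q : K) (R : V ⊗[K] V →ₗ[K] V ⊗[K] V) (n : ℕ) : ℕ :=
  quadDim K V (LinearMap.range (R - q • LinearMap.id)) n

section EBialgebra

open Module

variable (K : Type*) [Field K] (V : Type*) [AddCommGroup V] [Module K V]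
  [FiniteDimensional K V]

/-- The dual operator `R^*` on `V^* ⊗ V^*`, obtained from the transpose of `R` via the
canonical identification `V^* ⊗ V^* ≅ (V ⊗ V)^*`. -/
noncomputable def dualOp (R : V ⊗[K] V →ₗ[K] V ⊗[K] V) :
    (Dual K V ⊗[K] Dual K V) →ₗ[K] (Dual K V ⊗[K] Dual K V) :=
  (TensorProduct.dualDistribEquiv K V V).symm.toLinearMap ∘ₗ
    R.dualMap ∘ₗ (TensorProduct.dualDistribEquiv K V V).toLinearMap

/-- The operator `R̄ = θ(R^{*−1} ⊗ R)θ` on `(V^* ⊗ V) ⊗ (V^* ⊗ V)`, where `θ`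
interchanges the second and third tensor factors and `Rinv = R⁻¹`. -/
noncomputable def barOp (R Rinv : V ⊗[K] V →ₗ[K] V ⊗[K] V) :
    ((Dual K V ⊗[K] V) ⊗[K] (Dual K V ⊗[K] V)) →ₗ[K]
      ((Dual K V ⊗[K] V) ⊗[K] (Dual K V ⊗[K] V)) :=
  (TensorProduct.tensorTensorTensorComm K (Dual K V) V (Dual K V) V).symm.toLinearMap ∘ₗ
    TensorProduct.map (dualOp K V Rinv) R ∘ₗ
    (TensorProduct.tensorTensorTensorComm K (Dual K V) V (Dual K V) V).toLinearMap

/-- `e_n`, the dimension of the `n`-th homogeneous component of the bialgebra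
`E = T(V^* ⊗ V)/⟨Im(R̄ − 1)⟩`; here `Im(R̄ − 1)` is the subspace spanned by the
elements `y = R̄x − x`, i.e. those `y` with `R̄x = x + y` for some `x`. -/
noncomputable def eDim (R Rinv : V ⊗[K] V →ₗ[K] V ⊗[K] V) (n : ℕ) : ℕ :=
  quadDim K (Dual K V ⊗[K] V)
    (Submodule.span K {y | ∃ x, barOp K V R Rinv x = x + y}) n

end EBialgebra

namespace Hk
open Module

/-- Hecke family on `N` strands. -/
structure IsHF {K A : Type*} [Field K] [Ring A] [Algebra K A] (q : K) (N : ℕ) (T : ℕ → A) :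
    Prop where
  quad : ∀ i, i + 1 < N → T i * T i = (q - 1) • T i + q • (1 : A)
  braid : ∀ i, i + 2 < N → T i * T (i + 1) * T i = T (i + 1) * T i * T (i + 1)
  comm : ∀ i j, i + 1 < j → j + 1 < N → T i * T j = T j * T i
  zero : ∀ i, N ≤ i + 1 → T i = 0

/-- Relations of the Hecke algebra. -/
inductive HRel {K : Type*} [Field K] (q : K) (N : ℕ) : FreeAlgebra K ℕ → FreeAlgebra K ℕ → Prop
  | quad (i) (h : i + 1 < N) : HRel q N (FreeAlgebra.ι K i * FreeAlgebra.ι K i)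
      ((q - 1) • FreeAlgebra.ι K i + q • 1)
  | braid (i) (h : i + 2 < N) : HRel q N
      (FreeAlgebra.ι K i * FreeAlgebra.ι K (i + 1) * FreeAlgebra.ι K i)
      (FreeAlgebra.ι K (i + 1) * FreeAlgebra.ι K i * FreeAlgebra.ι K (i + 1))
  | comm (i j) (h : i + 1 < j) (h' : j + 1 < N) : HRel q N
      (FreeAlgebra.ι K i * FreeAlgebra.ι K j) (FreeAlgebra.ι K j * FreeAlgebra.ι K i)
  | zero (i) (h : N ≤ i + 1) : HRel q N (FreeAlgebra.ι K i) 0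

/-- The Hecke algebra. -/
def HA {K : Type*} [Field K] (q : K) (N : ℕ) : Type _ := RingQuot (HRel q N)

section
variable {K : Type*} [Field K] (q : K) (N : ℕ)

noncomputable instance : Ring (HA q N) := inferInstanceAs (Ring (RingQuot (HRel q N)))
noncomputable instance : Algebra K (HA q N) :=
  inferInstanceAs (Algebra K (RingQuot (HRel q N)))

/-- projection from the free algebra -/
noncomputable def HA.mk : FreeAlgebra K ℕ →ₐ[K] HA q N := RingQuot.mkAlgHom K (HRel q N)

/-- generators -/
noncomputable def HA.gen (i : ℕ) : HA q N := HA.mk q N (FreeAlgebra.ι K i)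

theorem HA.mk_surj : Function.Surjective (HA.mk q N) := RingQuot.mkAlgHom_surjective K _

theorem HA.mk_rel {x y} (h : HRel q N x y) : HA.mk q N x = HA.mk q N y :=
  RingQuot.mkAlgHom_rel K h

theorem HA.isHF : IsHF q N (HA.gen q N) where
  quad i h := by simpa [HA.gen] using HA.mk_rel q N (HRel.quad i h)
  braid i h := by simpa [HA.gen] using HA.mk_rel q N (HRel.braid i h)
  comm i j h h' := by simpa [HA.gen] using HA.mk_rel q N (HRel.comm i j h h')
  zero i h := by simpa [HA.gen] using HA.mk_rel q N (HRel.zero i h)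

variable {q N}

/-- universal property -/
noncomputable def HA.lift {A : Type*} [Ring A] [Algebra K A] {T : ℕ → A} (hT : IsHF q N T) :
    HA q N →ₐ[K] A :=
  RingQuot.liftAlgHom K ⟨FreeAlgebra.lift K T, by
    intro x y h
    cases h with
    | quad i h => simpa using hT.quad i h
    | braid i h => simpa using hT.braid i h
    | comm i j h h' => simpa using hT.comm i j h h'
    | zero i h => simpa using hT.zero i h⟩

theorem HA.lift_gen {A : Type*} [Ring A] [Algebra K A] {T : ℕ → A} (hT : IsHF q N T) (i : ℕ) :
    HA.lift hT (HA.gen q N i) = T i := by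
  have := RingQuot.liftAlgHom_mkAlgHom_apply (S := K) (s := HRel q N) (FreeAlgebra.lift K T) (by
    intro x y h
    cases h with
    | quad i h => simpa using hT.quad i h
    | braid i h => simpa using hT.braid i h
    | comm i j h h' => simpa using hT.comm i j h h'
    | zero i h => simpa using hT.zero i h) (FreeAlgebra.ι K i)
  exact this.trans (FreeAlgebra.lift_ι_apply _ _)

theorem HA.induction {p : HA q N → Prop} (h0 : ∀ c : K, p (algebraMap K _ c))
    (hg : ∀ i, p (HA.gen q N i)) (hm : ∀ a b, p a → p b → p (a * b))
    (ha : ∀ a b, p a → p b → p (a + b)) (x : HA q N) : p x := by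
  obtain ⟨y, rfl⟩ := HA.mk_surj q N x
  induction y using FreeAlgebra.induction with
  | grade0 r => simpa using h0 r
  | grade1 i => exact hg i
  | mul a b h1 h2 => rw [map_mul]; exact hm _ _ h1 h2
  | add a b h1 h2 => rw [map_add]; exact ha _ _ h1 h2

theorem HA.adjoin_gen : Algebra.adjoin K (Set.range (HA.gen q N)) = ⊤ := by
  rw [eq_top_iff]
  intro x _
  induction x using HA.induction with
  | h0 c => exact Subalgebra.algebraMap_mem _ c
  | hg i => exact Algebra.subset_adjoin ⟨i, rfl⟩
  | hm a b h1 h2 => exact mul_mem (h1 trivial) (h2 trivial)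
  | ha a b h1 h2 => exact add_mem (h1 trivial) (h2 trivial)
end

/-- the module attached to a representation -/
def Rep {K A M : Type*} [Field K] [Ring A] [Algebra K A] [AddCommGroup M] [Module K M]
    (_ρ : A →ₐ[K] Module.End K M) : Type _ := M

section
variable {K A M : Type*} [Field K] [Ring A] [Algebra K A] [AddCommGroup M] [Module K M]
    (ρ : A →ₐ[K] Module.End K M)
instance : AddCommGroup (Rep ρ) := inferInstanceAs (AddCommGroup M)
instance : Module K (Rep ρ) := inferInstanceAs (Module K M)
instance [Module.Finite K M] : Module.Finite K (Rep ρ) := inferInstanceAs (Module.Finite K M)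
noncomputable instance : Module A (Rep ρ) := Module.compHom M ρ.toRingHom
theorem Rep.smul_def (a : A) (x : Rep ρ) : a • x = (ρ a (show M from x) : M) := rfl
instance : IsScalarTower K A (Rep ρ) := ⟨fun k a x => by
  rw [Rep.smul_def, Rep.smul_def, map_smul]; rfl⟩
/-- identity equivalence -/
def Rep.e : Rep ρ ≃ₗ[K] M := LinearEquiv.refl K M
theorem Rep.e_smul (a : A) (x : Rep ρ) : Rep.e ρ (a • x) = ρ a (Rep.e ρ x) := rfl
end

/-- The module over the Hecke algebra of a Hecke family. -/
abbrev HM {K M : Type*} [Field K] {q : K} {N : ℕ} [AddCommGroup M] [Module K M]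
    {T : ℕ → Module.End K M} (hT : IsHF q N T) := Rep (HA.lift hT)

section
variable {K : Type*} [Field K] {q : K} {N : ℕ}
theorem HM.gen_smul {M : Type*} [AddCommGroup M] [Module K M]
    {T : ℕ → Module.End K M} (hT : IsHF q N T) (i : ℕ) (x : HM hT) :
    Rep.e _ (HA.gen q N i • x) = T i (Rep.e _ x) := by
  rw [Rep.e_smul, HA.lift_gen]

variable {X Y : Type*} [AddCommGroup X] [Module K X] [Module (HA q N) X]
  [IsScalarTower K (HA q N) X] [AddCommGroup Y] [Module K Y] [Module (HA q N) Y]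
  [IsScalarTower K (HA q N) Y]

/-- upgrade a linear map commuting with generators -/
def mkHom (f : X →ₗ[K] Y) (hf : ∀ i x, f (HA.gen q N i • x) = HA.gen q N i • f x) :
    X →ₗ[HA q N] Y where
  toFun := f
  map_add' := f.map_add
  map_smul' a x := by
    induction a using HA.induction generalizing x with
    | h0 c => simp [algebraMap_smul]
    | hg i => exact hf i x
    | hm a b h1 h2 => simp only [mul_smul, h1, h2, RingHom.id_apply] at *
    | ha a b h1 h2 => simp only [add_smul, map_add, h1, h2, RingHom.id_apply] at *

@[simp] theorem mkHom_apply (f : X →ₗ[K] Y) (hf) (x : X) :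
    mkHom (q := q) (N := N) f hf x = f x := rfl

/-- A module over the Hecke algebra provides a Hecke family. -/
noncomputable def famOf (q : K) (N : ℕ) (X : Type*) [AddCommGroup X] [Module K X]
    [Module (HA q N) X] [IsScalarTower K (HA q N) X] (i : ℕ) : Module.End K X :=
  Algebra.lsmul K K X (HA.gen q N i)

end
end Hk

namespace Hk
set_option linter.unusedSectionVars false
open Module
universe u

section pairing
variable {K : Type*} (A : Type*) [Field K] [Ring A] [Algebra K A]

variable (K) in
/-- dimension of the space of homomorphisms -/
noncomputable def pair (X Y : Type*) [AddCommGroup X] [Module A X]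
    [AddCommGroup Y] [Module K Y] [Module A Y] [IsScalarTower K A Y] : ℕ :=
  finrank K (X →ₗ[A] Y)

section
variable (X Y Z : Type*) [AddCommGroup X] [Module K X] [Module A X] [IsScalarTower K A X]
  [AddCommGroup Y] [Module K Y] [Module A Y] [IsScalarTower K A Y]
  [AddCommGroup Z] [Module K Z] [Module A Z] [IsScalarTower K A Z]

instance finHom [Module.Finite K X] [Module.Finite K Y] : Module.Finite K (X →ₗ[A] Y) := by
  let φ : (X →ₗ[A] Y) →ₗ[K] (X →ₗ[K] Y) :=
    { toFun := fun f => f.restrictScalars K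
      map_add' := fun _ _ => rfl
      map_smul' := fun _ _ => rfl }
  exact Module.Finite.of_injective φ (LinearMap.restrictScalars_injective K)

variable {X Y Z}
theorem pair_congr_left (e : X ≃ₗ[A] Y) : pair K A X Z = pair K A Y Z := by
  refine LinearEquiv.finrank_eq (R := K)
    { toFun := fun f => f ∘ₗ e.symm.toLinearMap
      invFun := fun f => f ∘ₗ e.toLinearMap
      map_add' := fun _ _ => rfl
      map_smul' := fun _ _ => rfl
      left_inv := fun f => by ext; simp
      right_inv := fun f => by ext; simp }

theorem pair_congr_right (e : X ≃ₗ[A] Y) : pair K A Z X = pair K A Z Y := by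
  have h : ∀ (k : K) (x : X), e (k • x) = k • e x := fun k x => by
    rw [← algebraMap_smul A k x, map_smul, algebraMap_smul]
  refine LinearEquiv.finrank_eq (R := K)
    { toFun := fun f => e.toLinearMap ∘ₗ f
      invFun := fun f => e.symm.toLinearMap ∘ₗ f
      map_add' := fun _ _ => by ext; simp
      map_smul' := fun k f => by ext x; simp [h]
      left_inv := fun f => by ext; simp
      right_inv := fun f => by ext; simp }

theorem pair_prod_left [Module.Finite K X] [Module.Finite K Y] [Module.Finite K Z] :
    pair K A (X × Y) Z = pair K A X Z + pair K A Y Z := by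
  unfold pair
  rw [← Module.finrank_prod]
  exact LinearEquiv.finrank_eq (R := K) (LinearMap.coprodEquiv K).symm

theorem pair_prod_right [Module.Finite K X] [Module.Finite K Y] [Module.Finite K Z] :
    pair K A Z (X × Y) = pair K A Z X + pair K A Z Y := by
  unfold pair
  rw [← Module.finrank_prod]
  exact LinearEquiv.finrank_eq (R := K) (LinearMap.prodEquiv K).symm

theorem pair_pi_left {ι : Type*} [Fintype ι] (X : ι → Type*) [∀ i, AddCommGroup (X i)]
    [∀ i, Module K (X i)] [∀ i, Module A (X i)] [∀ i, IsScalarTower K A (X i)]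
    [∀ i, Module.Finite K (X i)] [Module.Finite K Z] :
    pair K A (∀ i, X i) Z = ∑ i, pair K A (X i) Z := by
  classical
  unfold pair
  rw [← Module.finrank_pi_fintype]
  exact LinearEquiv.finrank_eq (R := K) (LinearMap.lsum A X K).symm

theorem pair_pi_right {ι : Type*} [Fintype ι] (X : ι → Type*) [∀ i, AddCommGroup (X i)]
    [∀ i, Module K (X i)] [∀ i, Module A (X i)] [∀ i, IsScalarTower K A (X i)]
    [∀ i, Module.Finite K (X i)] [Module.Finite K Z] :
    pair K A Z (∀ i, X i) = ∑ i, pair K A Z (X i) := by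
  classical
  unfold pair
  rw [← Module.finrank_pi_fintype]
  exact LinearEquiv.finrank_eq (R := K)
    { toFun := fun f i => LinearMap.proj i ∘ₗ f
      invFun := fun f => LinearMap.pi f
      map_add' := fun _ _ => rfl
      map_smul' := fun _ _ => rfl
      left_inv := fun f => rfl
      right_inv := fun f => rfl }

theorem pair_eq_zero_iff [Module.Finite K X] [Module.Finite K Y] :
    pair K A X Y = 0 ↔ ∀ f : X →ₗ[A] Y, f = 0 := by
  unfold pair
  rw [Module.finrank_zero_iff]
  exact ⟨fun h f => Subsingleton.elim _ _, fun h => ⟨fun a b => by rw [h a, h b]⟩⟩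

theorem finrank_congr (e : X ≃ₗ[A] Y) : finrank K X = finrank K Y :=
  LinearEquiv.finrank_eq (e.restrictScalars K)

end

section semisimple
variable [IsSemisimpleRing A]

/-- splitting off the kernel and the image -/
theorem split_hom {X Y : Type u} [AddCommGroup X] [Module A X] [AddCommGroup Y] [Module A Y]
    (f : X →ₗ[A] Y) :
    ∃ C : Submodule A Y, Nonempty (X ≃ₗ[A] (LinearMap.ker f × LinearMap.range f)) ∧
      Nonempty (Y ≃ₗ[A] (C × LinearMap.range f)) := by
  obtain ⟨D, hD⟩ := exists_isCompl (LinearMap.ker f)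
  obtain ⟨C, hC⟩ := exists_isCompl (LinearMap.range f)
  refine ⟨C, ⟨?_⟩, ⟨?_⟩⟩
  · have e1 := (Submodule.prodEquivOfIsCompl _ _ hD).symm
    have e2 : D ≃ₗ[A] LinearMap.range f :=
      (Submodule.quotientEquivOfIsCompl _ _ hD).symm.trans f.quotKerEquivRange
    exact e1.trans (LinearEquiv.prodCongr (LinearEquiv.refl _ _) e2)
  · exact (Submodule.prodEquivOfIsCompl _ _ hC.symm).symm

/-- cancellation of common summands -/
theorem cancel (n : ℕ) : ∀ (X Y : Type u) [AddCommGroup X] [Module K X] [Module A X]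
    [IsScalarTower K A X] [AddCommGroup Y] [Module K Y] [Module A Y] [IsScalarTower K A Y]
    [Module.Finite K X] [Module.Finite K Y], finrank K X = n →
    ∃ (X' : Type u) (Y' : Type u) (Z : Type u)
      (_ : AddCommGroup X') (_ : Module K X') (_ : Module A X') (_ : IsScalarTower K A X')
      (_ : AddCommGroup Y') (_ : Module K Y') (_ : Module A Y') (_ : IsScalarTower K A Y')
      (_ : AddCommGroup Z) (_ : Module K Z) (_ : Module A Z) (_ : IsScalarTower K A Z)
      (_ : Module.Finite K X') (_ : Module.Finite K Y') (_ : Module.Finite K Z),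
      Nonempty (X ≃ₗ[A] X' × Z) ∧ Nonempty (Y ≃ₗ[A] Y' × Z) ∧ pair K A X' Y' = 0 := by
  induction n using Nat.strong_induction_on with
  | _ n ih =>
  intro X Y _ _ _ _ _ _ _ _ _ _ hn
  by_cases h : ∀ f : X →ₗ[A] Y, f = 0
  · refine ⟨X, Y, PUnit, inferInstance, inferInstance, inferInstance, inferInstance, inferInstance,
      inferInstance, inferInstance, inferInstance, inferInstance, inferInstance, inferInstance,
      ⟨fun _ _ _ => rfl⟩, inferInstance, inferInstance, inferInstance, ⟨?_⟩, ⟨?_⟩,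
      (pair_eq_zero_iff A).2 h⟩
    · exact (LinearEquiv.prodUnique).symm
    · exact (LinearEquiv.prodUnique).symm
  · push Not at h
    obtain ⟨f, hf⟩ := h
    obtain ⟨C, ⟨e1⟩, ⟨e2⟩⟩ := split_hom A f
    have : Module.Finite K (LinearMap.ker f) :=
      Module.Finite.of_injective ((LinearMap.ker f).subtype.restrictScalars K)
        Subtype.val_injective
    have : Module.Finite K C :=
      Module.Finite.of_injective (C.subtype.restrictScalars K) Subtype.val_injective
    have : Module.Finite K (LinearMap.range f) :=
      Module.Finite.of_injective ((LinearMap.range f).subtype.restrictScalars K)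
        Subtype.val_injective
    have hd := finrank_congr (K := K) A e1
    rw [Module.finrank_prod] at hd
    have hpos : 0 < finrank K (LinearMap.range f) := by
      rw [Module.finrank_pos_iff, Submodule.nontrivial_iff_ne_bot]
      intro h0; exact hf (LinearMap.range_eq_bot.1 h0)
    obtain ⟨X', Y', Z, _, _, _, _, _, _, _, _, _, _, _, _, _, _, _, ⟨a⟩, ⟨b⟩, hp⟩ :=
      ih (finrank K (LinearMap.ker f)) (by omega) (LinearMap.ker f) C rfl
    refine ⟨X', Y', Z × LinearMap.range f, inferInstance, inferInstance, inferInstance,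
      inferInstance, inferInstance,
      inferInstance, inferInstance, inferInstance, inferInstance, inferInstance, inferInstance,
      inferInstance, inferInstance, inferInstance, inferInstance, ⟨?_⟩, ⟨?_⟩, hp⟩
    · exact (e1.trans (LinearEquiv.prodCongr a (LinearEquiv.refl _ _))).trans
        (LinearEquiv.prodAssoc A X' Z _)
    · exact (e2.trans (LinearEquiv.prodCongr b (LinearEquiv.refl _ _))).trans
        (LinearEquiv.prodAssoc A Y' Z _)

section
variable {X Y M : Type u} [AddCommGroup X] [Module K X] [Module A X] [IsScalarTower K A X]
  [AddCommGroup Y] [Module K Y] [Module A Y] [IsScalarTower K A Y]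
  [AddCommGroup M] [Module K M] [Module A M] [IsScalarTower K A M]
  [Module.Finite K X] [Module.Finite K Y] [Module.Finite K M]

theorem pair_symm_zero (h : pair K A X Y = 0) : pair K A Y X = 0 := by
  rw [pair_eq_zero_iff] at h ⊢
  intro f
  obtain ⟨C, ⟨e1⟩, ⟨e2⟩⟩ := split_hom A f
  let g : X →ₗ[A] Y := e1.symm.toLinearMap ∘ₗ LinearMap.inr A _ _ ∘ₗ LinearMap.snd A _ _ ∘ₗ
    e2.toLinearMap
  have hg : g = 0 := h g
  rw [← LinearMap.range_eq_bot, eq_bot_iff]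
  intro x hx
  have : g (e2.symm (0, ⟨x, hx⟩)) = 0 := by rw [hg]; rfl
  simp only [g, LinearMap.comp_apply, LinearEquiv.coe_coe, LinearEquiv.apply_symm_apply,
    LinearEquiv.map_eq_zero_iff, LinearMap.snd_apply, LinearMap.inr_apply, Prod.mk_eq_zero] at this
  simpa using congrArg Subtype.val this.2

theorem finrank_zero_of_pair (h : pair K A X X = 0) : finrank K X = 0 := by
  rw [pair_eq_zero_iff] at h
  have := h LinearMap.id
  have hs : Subsingleton X := ⟨fun a b => by
    have ha := LinearMap.congr_fun this a
    have hb := LinearMap.congr_fun this b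
    simp only [LinearMap.id_apply, LinearMap.zero_apply] at ha hb
    rw [ha, hb]⟩
  exact Module.finrank_zero_of_subsingleton

/-- the norm argument -/
theorem norm_arg (h : pair K A X X + pair K A Y Y ≤ pair K A X Y + pair K A Y X + 1) :
    Nonempty (X ≃ₗ[A] Y) ∨
    ∃ (S : Type u) (_ : AddCommGroup S) (_ : Module K S) (_ : Module A S) (_ : IsScalarTower K A S)
      (_ : Module.Finite K S), pair K A S S = 1 ∧
      (Nonempty (X ≃ₗ[A] S × Y) ∨ Nonempty (Y ≃ₗ[A] S × X)) := by
  obtain ⟨X', Y', Z, _, _, _, _, _, _, _, _, _, _, _, _, _, _, _, ⟨a⟩, ⟨b⟩, hp⟩ :=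
    cancel (K := K) A _ X Y rfl
  have hp' := pair_symm_zero (K := K) A hp
  have h1 : pair K A X X = pair K A X' X' + pair K A X' Z + (pair K A Z X' + pair K A Z Z) := by
    rw [pair_congr_left A a, pair_congr_right A a, pair_prod_left, pair_prod_right,
      pair_prod_right]
  have h2 : pair K A Y Y = pair K A Y' Y' + pair K A Y' Z + (pair K A Z Y' + pair K A Z Z) := by
    rw [pair_congr_left A b, pair_congr_right A b, pair_prod_left, pair_prod_right,
      pair_prod_right]
  have h3 : pair K A X Y = pair K A X' Y' + pair K A X' Z + (pair K A Z Y' + pair K A Z Z) := by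
    rw [pair_congr_left A a, pair_congr_right A b, pair_prod_left, pair_prod_right,
      pair_prod_right]
  have h4 : pair K A Y X = pair K A Y' X' + pair K A Y' Z + (pair K A Z X' + pair K A Z Z) := by
    rw [pair_congr_left A b, pair_congr_right A a, pair_prod_left, pair_prod_right,
      pair_prod_right]
  have h5 : pair K A X' X' + pair K A Y' Y' ≤ 1 := by omega
  by_cases hx : pair K A X' X' = 0
  · have hx0 := finrank_zero_of_pair (K := K) A hx
    have : Subsingleton X' := Module.finrank_zero_iff.1 hx0
    letI : Unique X' := ⟨⟨0⟩, fun _ => Subsingleton.elim _ _⟩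
    let eX : X ≃ₗ[A] Z := a.trans (LinearEquiv.uniqueProd (M₂ := X'))
    by_cases hy : pair K A Y' Y' = 0
    · have hy0 := finrank_zero_of_pair (K := K) A hy
      have : Subsingleton Y' := Module.finrank_zero_iff.1 hy0
      letI : Unique Y' := ⟨⟨0⟩, fun _ => Subsingleton.elim _ _⟩
      left
      exact ⟨eX.trans (b.trans (LinearEquiv.uniqueProd (M₂ := Y'))).symm⟩
    · right
      exact ⟨Y', inferInstance, inferInstance, inferInstance, inferInstance, inferInstance,
        by omega, Or.inr ⟨b.trans (LinearEquiv.prodCongr (LinearEquiv.refl _ _) eX.symm)⟩⟩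
  · have hy : pair K A Y' Y' = 0 := by omega
    have hy0 := finrank_zero_of_pair (K := K) A hy
    have : Subsingleton Y' := Module.finrank_zero_iff.1 hy0
    letI : Unique Y' := ⟨⟨0⟩, fun _ => Subsingleton.elim _ _⟩
    let eY : Y ≃ₗ[A] Z := b.trans (LinearEquiv.uniqueProd (M₂ := Y'))
    right
    exact ⟨X', inferInstance, inferInstance, inferInstance, inferInstance, inferInstance,
        by omega, Or.inl ⟨a.trans (LinearEquiv.prodCongr (LinearEquiv.refl _ _) eY.symm)⟩⟩

theorem inj_of_pair_one (h : pair K A X X = 1) (f : X →ₗ[A] Y) (hf : f ≠ 0) :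
    ∃ C : Type u, ∃ (_ : AddCommGroup C) (_ : Module K C) (_ : Module A C)
      (_ : IsScalarTower K A C) (_ : Module.Finite K C), Nonempty (Y ≃ₗ[A] X × C) := by
  obtain ⟨C, ⟨e1⟩, ⟨e2⟩⟩ := split_hom A f
  have : Module.Finite K (LinearMap.ker f) :=
    Module.Finite.of_injective ((LinearMap.ker f).subtype.restrictScalars K)
      Subtype.val_injective
  have : Module.Finite K C :=
    Module.Finite.of_injective (C.subtype.restrictScalars K) Subtype.val_injective
  have : Module.Finite K (LinearMap.range f) :=
    Module.Finite.of_injective ((LinearMap.range f).subtype.restrictScalars K)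
      Subtype.val_injective
  have h1 : pair K A X X = pair K A (LinearMap.ker f) (LinearMap.ker f) +
      pair K A (LinearMap.ker f) (LinearMap.range f) +
      (pair K A (LinearMap.range f) (LinearMap.ker f) +
        pair K A (LinearMap.range f) (LinearMap.range f)) := by
    rw [pair_congr_left A e1, pair_congr_right A e1, pair_prod_left, pair_prod_right,
      pair_prod_right]
  have h2 : pair K A (LinearMap.range f) (LinearMap.range f) ≠ 0 := by
    intro h0
    have := finrank_zero_of_pair (K := K) A h0
    have : Subsingleton (LinearMap.range f) := Module.finrank_zero_iff.1 this
    exact hf (LinearMap.range_eq_bot.1 (Submodule.subsingleton_iff_eq_bot.1 this))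
  have h3 : pair K A (LinearMap.ker f) (LinearMap.ker f) = 0 := by omega
  have := finrank_zero_of_pair (K := K) A h3
  have : Subsingleton (LinearMap.ker f) := Module.finrank_zero_iff.1 this
  letI : Unique (LinearMap.ker f) := ⟨⟨0⟩, fun _ => Subsingleton.elim _ _⟩
  let e3 : X ≃ₗ[A] LinearMap.range f := e1.trans (LinearEquiv.uniqueProd)
  exact ⟨C, inferInstance, inferInstance, inferInstance, inferInstance, inferInstance,
    ⟨(e2.trans (LinearEquiv.prodComm A _ _)).trans
      (LinearEquiv.prodCongr e3.symm (LinearEquiv.refl _ _))⟩⟩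

end

theorem pair_ne_zero_of_common {S X Y : Type u}
    [AddCommGroup S] [Module K S] [Module A S] [IsScalarTower K A S]
    [AddCommGroup X] [Module K X] [Module A X] [IsScalarTower K A X]
    [AddCommGroup Y] [Module K Y] [Module A Y] [IsScalarTower K A Y]
    [Module.Finite K S] [Module.Finite K X] [Module.Finite K Y]
    (hS : pair K A S S = 1) (h1 : pair K A S X ≠ 0) (h2 : pair K A S Y ≠ 0) :
    pair K A X Y ≠ 0 := by
  rw [ne_eq, pair_eq_zero_iff] at h1 h2
  push Not at h1 h2
  obtain ⟨f, hf⟩ := h1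
  obtain ⟨g, hg⟩ := h2
  obtain ⟨C, _, _, _, _, _, ⟨a⟩⟩ := inj_of_pair_one (K := K) A hS f hf
  obtain ⟨D, _, _, _, _, _, ⟨b⟩⟩ := inj_of_pair_one (K := K) A hS g hg
  rw [pair_congr_left A a, pair_congr_right A b, pair_prod_left, pair_prod_right]
  omega

theorem mult_bound {S : Type u} [AddCommGroup S] [Module K S] [Module A S] [IsScalarTower K A S]
    [Module.Finite K S] (hS : pair K A S S = 1) (n : ℕ) :
    ∀ (M : Type u) [AddCommGroup M] [Module K M] [Module A M] [IsScalarTower K A M]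
      [Module.Finite K M], finrank K M = n → pair K A S M * finrank K S ≤ n := by
  induction n using Nat.strong_induction_on with
  | _ n ih =>
  intro M _ _ _ _ _ hn
  by_cases h : pair K A S M = 0
  · simp [h]
  · rw [pair_eq_zero_iff] at h
    push Not at h
    obtain ⟨f, hf⟩ := h
    obtain ⟨C, _, _, _, _, _, ⟨a⟩⟩ := inj_of_pair_one (K := K) A hS f hf
    have hd := finrank_congr (K := K) A a
    rw [Module.finrank_prod] at hd
    have hpos : finrank K S ≠ 0 := by
      intro h0
      have : Subsingleton S := Module.finrank_zero_iff.1 h0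
      exact hf (LinearMap.ext fun x => by rw [Subsingleton.elim x 0]; simp)
    have := ih (finrank K C) (by omega) C rfl
    rw [pair_congr_right A a, pair_prod_right, hS, add_mul]
    omega
end semisimple
end pairing
end Hk

namespace Hk
open Module
set_option linter.unusedSectionVars false
set_option linter.unusedSimpArgs false

section words
variable {N n : ℕ}

/-- letter of a word, as a natural number -/
def ltr (w : Fin N → Fin n) (i : ℕ) : ℕ := if h : i < N then (w ⟨i, h⟩ : ℕ) else 0

/-- swap positions `i`, `i+1` -/
def sw (w : Fin N → Fin n) (i : ℕ) : Fin N → Fin n :=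
  if h : i + 1 < N then w ∘ Equiv.swap ⟨i, by omega⟩ ⟨i + 1, h⟩ else w

theorem word_ext {w w' : Fin N → Fin n} (h : ∀ i, ltr w i = ltr w' i) : w = w' := by
  funext i
  have := h i
  simp only [ltr, i.2, dif_pos] at this
  exact Fin.ext this

theorem ltr_sw (w : Fin N → Fin n) (i j : ℕ) (h : i + 1 < N) :
    ltr (sw w i) j = if j = i then ltr w (i + 1) else if j = i + 1 then ltr w i else ltr w j := by
  unfold ltr sw
  rw [dif_pos h]
  by_cases hj : j < N
  · rw [dif_pos hj]
    simp only [Function.comp_apply, Equiv.swap_apply_def, Fin.mk.injEq]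
    split_ifs <;> first | rfl | omega
  · rw [dif_neg hj]
    split_ifs <;> omega

theorem ltr_sw_left (w : Fin N → Fin n) (i : ℕ) (h : i + 1 < N) :
    ltr (sw w i) i = ltr w (i + 1) := by rw [ltr_sw w i i h]; simp
theorem ltr_sw_right (w : Fin N → Fin n) (i : ℕ) (h : i + 1 < N) :
    ltr (sw w i) (i + 1) = ltr w i := by rw [ltr_sw w i _ h]; simp
theorem ltr_sw_of_ne (w : Fin N → Fin n) (i j : ℕ) (h1 : j ≠ i) (h2 : j ≠ i + 1) :
    ltr (sw w i) j = ltr w j := by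
  by_cases h : i + 1 < N
  · rw [ltr_sw w i _ h]; simp [h1, h2]
  · simp [sw, h]

theorem sw_sw (w : Fin N → Fin n) (i : ℕ) : sw (sw w i) i = w := by
  by_cases h : i + 1 < N
  · apply word_ext; intro j
    simp only [ltr_sw _ _ _ h]
    split_ifs <;> first | rfl | omega | (congr 1; omega)
  · simp [sw, h]

theorem sw_comm (w : Fin N → Fin n) (i j : ℕ) (hij : i + 1 < j) :
    sw (sw w i) j = sw (sw w j) i := by
  by_cases h : j + 1 < N
  · have h' : i + 1 < N := by omega
    apply word_ext; intro k
    simp only [ltr_sw _ _ _ h, ltr_sw _ _ _ h']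
    split_ifs <;> first | rfl | omega
  · simp [sw, h]

theorem sw_braid (w : Fin N → Fin n) (i : ℕ) (h : i + 2 < N) :
    sw (sw (sw w i) (i + 1)) i = sw (sw (sw w (i + 1)) i) (i + 1) := by
  have h' : i + 1 < N := by omega
  have hq3 : i + 1 + 1 < N := by omega
  apply word_ext; intro k
  simp only [ltr_sw _ _ _ hq3, ltr_sw _ _ _ h']
  split_ifs <;> first | rfl | omega

theorem sw_eq_self (w : Fin N → Fin n) (i : ℕ) (h : ltr w i = ltr w (i + 1)) : sw w i = w := by
  by_cases h' : i + 1 < N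
  · apply word_ext; intro k
    simp only [ltr_sw _ _ _ h']
    split_ifs with h1 h2
    · subst h1; exact h.symm
    · subst h2; exact h
    · rfl
  · simp [sw, h']

/-- measure -/
def ms (w : Fin N → Fin n) : ℕ := ∑ i ∈ Finset.range N, (N - i) * ltr w i

/-- descent -/
def desc (w : Fin N → Fin n) (i : ℕ) : Prop := i + 1 < N ∧ ltr w (i + 1) < ltr w i

theorem ms_sw (w : Fin N → Fin n) (i : ℕ) (h : desc w i) : ms (sw w i) < ms w := by
  obtain ⟨h1, h2⟩ := h
  have key : ∀ v : Fin N → Fin n, ms v = (N - i) * ltr v i + (N - (i + 1)) * ltr v (i + 1) +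
      ∑ k ∈ ((Finset.range N).erase i).erase (i + 1), (N - k) * ltr v k := by
    intro v
    unfold ms
    rw [← Finset.add_sum_erase _ _ (show i ∈ Finset.range N by simp; omega),
      ← Finset.add_sum_erase _ _ (show i + 1 ∈ (Finset.range N).erase i by simp; omega), add_assoc]
  rw [key, key w, ltr_sw_left _ _ h1, ltr_sw_right _ _ h1]
  have : ∑ k ∈ ((Finset.range N).erase i).erase (i + 1), (N - k) * ltr (sw w i) k =
      ∑ k ∈ ((Finset.range N).erase i).erase (i + 1), (N - k) * ltr w k := by
    apply Finset.sum_congr rfl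
    intro k hk
    simp only [Finset.mem_erase] at hk
    rw [ltr_sw_of_ne _ _ _ hk.2.1 hk.1]
  rw [this]
  obtain ⟨d, hd⟩ : ∃ d, N - i = d + 1 := ⟨N - (i + 1), by omega⟩
  have hd' : N - (i + 1) = d := by omega
  rw [hd, hd']
  nlinarith

theorem ltr_mono_of_no_desc (w : Fin N → Fin n) (h : ∀ i, ¬ desc w i) :
    Monotone w := by
  intro i j hij
  have : ∀ k, ∀ (hk : i.1 + k < N), w i ≤ w ⟨i.1 + k, hk⟩ := by
    intro k
    induction k with
    | zero => intro _; exact le_refl _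
    | succ k ih =>
      intro hk
      refine (ih (by omega)).trans ?_
      have := h (i.1 + k)
      unfold desc at this
      push Not at this
      have := this hk
      simp only [ltr, dif_pos (show i.1 + k < N by omega), dif_pos (show i.1 + k + 1 < N from hk)] at this
      exact this
  have h2 := this (j.1 - i.1) (by have := Fin.le_def.1 hij; omega)
  have e : (⟨i.1 + (j.1 - i.1), by have := Fin.le_def.1 hij; omega⟩ : Fin N) = j :=
    Fin.ext (by have := Fin.le_def.1 hij; simp; omega)
  rwa [e] at h2

/-- content of a word -/
def content (w : Fin N → Fin n) : Fin n → ℤ := fun a => ((Finset.univ.filter (fun i => w i = a)).card : ℤ)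

theorem content_comp (w : Fin N → Fin n) (e : Equiv.Perm (Fin N)) :
    content (w ∘ e) = content w := by
  funext a
  unfold content
  congr 1
  apply Finset.card_bij (fun i _ => e i)
  · intro i hi; simpa using hi
  · intro i _ j _ h; exact e.injective h
  · intro j hj; exact ⟨e.symm j, by simpa using hj, by simp⟩

theorem content_sw (w : Fin N → Fin n) (i : ℕ) : content (sw w i) = content w := by
  unfold sw
  split_ifs with h
  · exact content_comp _ _
  · rfl
end words

section U
variable {N n : ℕ} (p : (Fin N → Fin n) → Prop) (hp : ∀ w i, p w → p (sw w i))

/-- swap on a swap-closed set of words -/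
def swp (w : {w // p w}) (i : ℕ) : {w // p w} := ⟨sw w.1 i, hp _ _ w.2⟩

/-- the standard operators -/
noncomputable def uT {L : Type*} [Field L] (q : L) (i : ℕ) : Module.End L ({w // p w} → L) where
  toFun f w := if i + 1 < N then
    (if ltr w.1 i = ltr w.1 (i + 1) then q * f w
     else if ltr w.1 i < ltr w.1 (i + 1) then q * f (swp p hp w i)
     else f (swp p hp w i) + (q - 1) * f w) else 0
  map_add' f g := by
    funext w; simp only [Pi.add_apply]; split_ifs <;> ring
  map_smul' c f := by
    funext w; simp only [Pi.smul_apply, smul_eq_mul, RingHom.id_apply]; split_ifs <;> ring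

theorem uT_apply {L : Type*} [Field L] (q : L) (i : ℕ) (f : {w // p w} → L) (w : {w // p w}) :
  uT p hp q i f w = if i + 1 < N then
    (if ltr w.1 i = ltr w.1 (i + 1) then q * f w
     else if ltr w.1 i < ltr w.1 (i + 1) then q * f (swp p hp w i)
     else f (swp p hp w i) + (q - 1) * f w) else 0 := rfl

theorem swp_swp (w : {w // p w}) (i : ℕ) : swp p hp (swp p hp w i) i = w :=
  Subtype.ext (sw_sw _ _)
theorem swp_comm (w : {w // p w}) (i j : ℕ) (h : i + 1 < j) :
    swp p hp (swp p hp w i) j = swp p hp (swp p hp w j) i := Subtype.ext (sw_comm _ _ _ h)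
theorem swp_braid (w : {w // p w}) (i : ℕ) (h : i + 2 < N) :
    swp p hp (swp p hp (swp p hp w i) (i + 1)) i =
      swp p hp (swp p hp (swp p hp w (i + 1)) i) (i + 1) := Subtype.ext (sw_braid _ _ h)
theorem swp_self (w : {w // p w}) (i : ℕ) (h : ltr w.1 i = ltr w.1 (i + 1)) :
    swp p hp w i = w := Subtype.ext (sw_eq_self _ _ h)
theorem ltr_swp (w : {w // p w}) (i j : ℕ) (h : i + 1 < N) :
    ltr (swp p hp w i).1 j =
      if j = i then ltr w.1 (i + 1) else if j = i + 1 then ltr w.1 i else ltr w.1 j :=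
  ltr_sw _ _ _ h

theorem uT_isHF {L : Type*} [Field L] (q : L) : IsHF q N (uT p hp q) where
  quad i h := by
    refine LinearMap.ext fun f => funext fun w => ?_
    simp only [Module.End.mul_apply, LinearMap.add_apply, LinearMap.smul_apply, Pi.add_apply,
      Pi.smul_apply, smul_eq_mul, Module.End.one_apply, uT_apply, h, if_true, swp_swp,
      ltr_swp p hp _ _ _ h]
    rcases lt_trichotomy (ltr w.1 i) (ltr w.1 (i + 1)) with h1 | h1 | h1
    · simp [h1, h1.ne, h1.ne', h1.not_gt]; ring
    · simp [h1]; ring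
    · simp [h1, h1.ne, h1.ne', h1.not_gt]; ring
  braid i h := by
    have h1 : i + 1 < N := by omega
    have h2 : i + 1 + 1 < N := by omega
    refine LinearMap.ext fun f => funext fun w => ?_
    have hb := swp_braid p hp w i h
    simp only [Module.End.mul_apply, uT_apply, h1, h2, if_true, swp_swp,
      ltr_swp p hp _ _ _ h1, ltr_swp p hp _ _ _ h2]
    have e1 : i ≠ i + 1 + 1 := by omega
    have e2 : i + 1 + 1 ≠ i := by omega
    have e3 : i ≠ i + 1 := by omega
    have e4 : i + 1 + 1 ≠ i + 1 := by omega
    simp only [e1, e2, e3, e4, if_false, if_true, Nat.succ_ne_self, hb]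
    have hs1 := fun x => congrArg f (swp_self p hp w i x)
    have hs2 := fun x => congrArg f (swp_self p hp w (i + 1) x)
    have hs3 := fun x => congrArg f (swp_self p hp (swp p hp w i) (i + 1) x)
    have hs4 := fun x => congrArg f (swp_self p hp (swp p hp w (i + 1)) i x)
    have hs5 := fun x => congrArg f (swp_self p hp (swp p hp (swp p hp w (i + 1)) i) (i + 1) x)
    have hs6 := fun x => congrArg f (swp_self p hp (swp p hp (swp p hp w i) (i + 1)) i x)
    rw [hb] at hs6
    simp only [ltr_swp p hp _ _ _ h1, ltr_swp p hp _ _ _ h2, e1, e2, e3, e4, if_false, if_true,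
      Nat.succ_ne_self] at hs3 hs4 hs5 hs6
    generalize f (swp p hp (swp p hp (swp p hp w (i + 1)) i) (i + 1)) = F3 at *
    generalize f (swp p hp (swp p hp w (i + 1)) i) = F21 at *
    generalize f (swp p hp (swp p hp w i) (i + 1)) = F12 at *
    generalize f (swp p hp w (i + 1)) = F2 at *
    generalize f (swp p hp w i) = F1 at *
    generalize f w = F0 at *
    generalize ltr w.1 i = a at *
    generalize ltr w.1 (i + 1) = b at *
    generalize ltr w.1 (i + 1 + 1) = c at *
    clear hb
    rcases lt_trichotomy a b with x | x | x
    · rcases lt_trichotomy b c with y | y | y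
      · have z := x.trans y
        simp only [x, y, z, x.ne, y.ne, z.ne, if_true, if_false]
      · have := hs2 y
        have := hs6 y
        subst y
        simp only [x, x.ne, x.ne', x.not_gt, if_true, if_false]

      · rcases lt_trichotomy a c with z | z | z
        · simp only [x, y, z, x.ne, x.ne', x.not_gt, y.ne, y.ne', y.not_gt, z.ne, z.ne', z.not_gt,
            if_true, if_false]; ring
        · have := hs3 z
          have := hs4 z
          subst z
          simp only [x, x.ne, x.ne', x.not_gt, if_true, if_false]
          subst_vars; ring
        · simp only [x, y, z, x.ne, x.ne', x.not_gt, y.ne, y.ne', y.not_gt, z.ne, z.ne', z.not_gt,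
            if_true, if_false]; ring
    · have := hs1 x
      have := hs5 x
      subst x
      rcases lt_trichotomy a c with y | y | y
      · simp only [y, y.ne, y.ne', y.not_gt, if_true, if_false]
      · simp only [y, if_true]
      · simp only [y, y.ne, y.ne', y.not_gt, if_true, if_false]; subst_vars; ring
    · rcases lt_trichotomy b c with y | y | y
      · rcases lt_trichotomy a c with z | z | z
        · simp only [x, y, z, x.ne, x.ne', x.not_gt, y.ne, y.ne', y.not_gt, z.ne, z.ne', z.not_gt,
            if_true, if_false]; ring
        · have := hs3 z
          have := hs4 z
          subst z
          simp only [x, x.ne, x.ne', x.not_gt, if_true, if_false]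
          subst_vars; ring
        · simp only [x, y, z, x.ne, x.ne', x.not_gt, y.ne, y.ne', y.not_gt, z.ne, z.ne', z.not_gt,
            if_true, if_false]; ring
      · have := hs2 y
        have := hs6 y
        subst y
        simp only [x, x.ne, x.ne', x.not_gt, if_true, if_false]
        subst_vars; ring
      · have z := y.trans x
        simp only [x, y, z, x.ne, x.ne', x.not_gt, y.ne, y.ne', y.not_gt, z.ne, z.ne', z.not_gt,
            if_true, if_false]; ring
  comm i j h h' := by
    have h1 : i + 1 < N := by omega
    refine LinearMap.ext fun f => funext fun w => ?_
    have hb := swp_comm p hp w i j h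
    simp only [Module.End.mul_apply, uT_apply, h1, h', if_true,
      ltr_swp p hp _ _ _ h1, ltr_swp p hp _ _ _ h']
    have e1 : j ≠ i := by omega
    have e2 : j ≠ i + 1 := by omega
    have e3 : j + 1 ≠ i := by omega
    have e4 : j + 1 ≠ i + 1 := by omega
    have e5 : i + 1 ≠ j := by omega
    simp only [e1, e2, e3, e4, e5, e1.symm, e3.symm, e4.symm, if_false, if_true, hb]
    split_ifs <;> ring
  zero i h := by
    refine LinearMap.ext fun f => funext fun w => ?_
    simp [uT_apply, show ¬ i + 1 < N by omega]
end U
end Hk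

namespace Hk
open Module
set_option linter.unusedSectionVars false
set_option linter.unusedSimpArgs false

section beta
variable {K : Type*} [Field K] {q : K} {N n : ℕ} {M : Type*} [AddCommGroup M] [Module K M]
  {T : ℕ → Module.End K M}

open Classical in
/-- canonical vectors generated from `v` -/
noncomputable def beta (T : ℕ → Module.End K M) (v : M) (w : Fin N → Fin n) : M :=
  if h : ∃ i, desc w i then T (Nat.find h) (beta T v (sw w (Nat.find h))) else v
termination_by ms w
decreasing_by exact ms_sw _ _ (Nat.find_spec h)

theorem beta_no (v : M) (w : Fin N → Fin n) (h : ∀ i, ¬ desc w i) : beta T v w = v := by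
  rw [beta, dif_neg (by push Not; exact h)]

theorem beta_ex (v : M) (w : Fin N → Fin n) (h : ∃ i, desc w i) :
    ∃ j, desc w j ∧ beta T v w = T j (beta T v (sw w j)) := by
  classical
  refine ⟨Nat.find h, Nat.find_spec h, ?_⟩
  conv_lhs => rw [beta, dif_pos h]

theorem beta_main (hT : IsHF q N T) (p : (Fin N → Fin n) → Prop)
    (hp : ∀ w i, p w → p (sw w i)) (w0 : Fin N → Fin n)
    (hw0 : ∀ w, p w → (∀ i, ¬ desc w i) → w = w0) (v : M)
    (hv : ∀ i, i + 1 < N → ltr w0 i = ltr w0 (i + 1) → T i v = q • v) (m : ℕ) :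
    ∀ w, ms w = m → p w → (∀ i, desc w i → beta T v w = T i (beta T v (sw w i))) ∧
      (∀ i, i + 1 < N → ltr w i = ltr w (i + 1) → T i (beta T v w) = q • beta T v w) := by
  have hbr : ∀ i, i + 2 < N → ∀ x, T i (T (i + 1) (T i x)) = T (i + 1) (T i (T (i + 1) x)) :=
    fun i h x => LinearMap.congr_fun (hT.braid i h) x
  have hco : ∀ i j, i + 1 < j → j + 1 < N → ∀ x, T i (T j x) = T j (T i x) :=
    fun i j h h' x => LinearMap.congr_fun (hT.comm i j h h') x
  induction m using Nat.strong_induction_on with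
  | _ m ih =>
  intro w hm hpw
  have IH : ∀ j, desc w j → (∀ i, desc (sw w j) i →
      beta T v (sw w j) = T i (beta T v (sw (sw w j) i))) ∧
      (∀ i, i + 1 < N → ltr (sw w j) i = ltr (sw w j) (i + 1) →
        T i (beta T v (sw w j)) = q • beta T v (sw w j)) := fun j hj =>
    ih (ms (sw w j)) (hm ▸ ms_sw w j hj) _ rfl (hp _ _ hpw)
  have IH2 : ∀ j, desc w j → ∀ k, desc (sw w j) k → (∀ i, desc (sw (sw w j) k) i →
      beta T v (sw (sw w j) k) = T i (beta T v (sw (sw (sw w j) k) i))) ∧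
      (∀ i, i + 1 < N → ltr (sw (sw w j) k) i = ltr (sw (sw w j) k) (i + 1) →
        T i (beta T v (sw (sw w j) k)) = q • beta T v (sw (sw w j) k)) := fun j hj k hk =>
    ih (ms (sw (sw w j) k)) (hm ▸ (ms_sw _ k hk).trans (ms_sw w j hj)) _ rfl (hp _ _ (hp _ _ hpw))
  have ex : ∀ i j, i < j → desc w i → desc w j →
      T i (beta T v (sw w i)) = T j (beta T v (sw w j)) := by
    intro i j hij hi hj
    have hi1 := hi.1
    have hj1 := hj.1
    rcases Nat.lt_or_ge (i + 1) j with h | h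
    · have h1 : desc (sw w i) j := ⟨hj.1, by
        rw [ltr_sw_of_ne _ _ _ (by omega) (by omega), ltr_sw_of_ne _ _ _ (by omega) (by omega)]
        exact hj.2⟩
      have h2 : desc (sw w j) i := ⟨hi.1, by
        rw [ltr_sw_of_ne _ _ _ (by omega) (by omega), ltr_sw_of_ne _ _ _ (by omega) (by omega)]
        exact hi.2⟩
      rw [(IH i hi).1 j h1, (IH j hj).1 i h2, sw_comm _ _ _ h, hco i j h hj1]
    · obtain rfl : j = i + 1 := by omega
      have a1 := hi.2
      have a2 := hj.2
      have h1 : desc (sw w i) (i + 1) := ⟨hj.1, by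
        rw [ltr_sw _ _ _ hi1, ltr_sw _ _ _ hi1]; split_ifs <;> omega⟩
      have h2 : desc (sw w (i + 1)) i := ⟨hi.1, by
        rw [ltr_sw _ _ _ hj1, ltr_sw _ _ _ hj1]; split_ifs <;> omega⟩
      have h3 : desc (sw (sw w i) (i + 1)) i := ⟨hi.1, by
        simp only [ltr_sw _ _ _ hj1, ltr_sw _ _ _ hi1]; split_ifs <;> omega⟩
      have h4 : desc (sw (sw w (i + 1)) i) (i + 1) := ⟨hj.1, by
        simp only [ltr_sw _ _ _ hj1, ltr_sw _ _ _ hi1]; split_ifs <;> omega⟩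
      rw [(IH i hi).1 _ h1, (IH _ hj).1 i h2, (IH2 _ hi _ h1).1 _ h3, (IH2 _ hj _ h2).1 _ h4,
        sw_braid _ _ hj1, hbr i hj1]
  have ha : ∀ i, desc w i → beta T v w = T i (beta T v (sw w i)) := by
    intro i hi
    obtain ⟨j, hj, e⟩ := beta_ex (T := T) v w ⟨i, hi⟩
    rw [e]
    rcases lt_trichotomy i j with h | h | h
    · exact (ex i j h hi hj).symm
    · rw [h]
    · exact ex j i h hj hi
  refine ⟨ha, ?_⟩
  intro i hi he
  by_cases hd : ∃ j, desc w j
  · obtain ⟨j, hj⟩ := hd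
    have hj1 := hj.1
    have hj2 := hj.2
    rcases Nat.lt_or_ge (i + 1) j with h | h
    · rw [ha j hj, hco i j h hj1, (IH j hj).2 i hi, map_smul]
      rw [ltr_sw_of_ne _ _ _ (by omega) (by omega), ltr_sw_of_ne _ _ _ (by omega) (by omega), he]
    rcases Nat.lt_or_ge (j + 1) i with h' | h'
    · rw [ha j hj, ← hco j i h' hi, (IH j hj).2 i hi, map_smul]
      rw [ltr_sw_of_ne _ _ _ (by omega) (by omega), ltr_sw_of_ne _ _ _ (by omega) (by omega), he]
    have hne : j ≠ i := by rintro rfl; omega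
    rcases (show j = i + 1 ∨ i = j + 1 by omega) with rfl | rfl
    · have h1 : desc (sw w (i + 1)) i := ⟨hi, by
        simp only [ltr_sw _ _ _ hj1]; split_ifs <;> omega⟩
      rw [ha _ hj, (IH _ hj).1 _ h1, hbr i hj1, (IH2 _ hj _ h1).2 (i + 1) hj1, map_smul, map_smul]
      simp only [ltr_sw _ _ _ hj1, ltr_sw _ _ _ hi]; split_ifs <;> omega
    · have h1 : desc (sw w j) (j + 1) := ⟨hi, by
        simp only [ltr_sw _ _ _ hj1]; split_ifs <;> omega⟩
      rw [ha _ hj, (IH _ hj).1 _ h1, ← hbr j hi, (IH2 _ hj _ h1).2 j hj1, map_smul, map_smul]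
      simp only [ltr_sw _ _ _ hj1, ltr_sw _ _ _ hi]; split_ifs <;> omega
  · push Not at hd
    rw [beta_no _ _ hd]
    obtain rfl := hw0 w hpw hd
    exact hv i hi he
end beta

section inv
variable {K : Type*} [Field K] {q : K} {N n : ℕ}

/-- vectors invariant under the parabolic of `w0` -/
def inv (q : K) (N : ℕ) (w0 : Fin N → Fin n) (X : Type*) [AddCommGroup X] [Module K X]
    [Module (HA q N) X] [IsScalarTower K (HA q N) X] : Submodule K X where
  carrier := {v | ∀ i, i + 1 < N → ltr w0 i = ltr w0 (i + 1) → HA.gen q N i • v = q • v}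
  add_mem' ha hb i h1 h2 := by rw [smul_add, smul_add, ha i h1 h2, hb i h1 h2]
  zero_mem' i h1 h2 := by simp
  smul_mem' c x hx i h1 h2 := by
    rw [smul_comm (M := HA q N) (N := K), hx i h1 h2, smul_comm]

theorem famOf_isHF (X : Type*) [AddCommGroup X] [Module K X]
    [Module (HA q N) X] [IsScalarTower K (HA q N) X] : IsHF q N (famOf q N X) := by
  have h := HA.isHF q N
  constructor
  · intro i hi; simp only [famOf, ← map_mul, h.quad i hi]; simp
  · intro i hi; simp only [famOf, ← map_mul, h.braid i hi]
  · intro i j hi hj; simp only [famOf, ← map_mul, h.comm i j hi hj]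
  · intro i hi; simp only [famOf, h.zero i hi]; simp

variable (p : (Fin N → Fin n) → Prop) (hp : ∀ w i, p w → p (sw w i))

/-- permutation-like module over the Hecke algebra -/
abbrev UM (q : K) := HM (uT_isHF p hp q)

open Classical in
/-- basis vector -/
noncomputable def ue (q : K) (w : {w // p w}) : UM p hp q :=
  (Rep.e _).symm (Pi.single w 1)

theorem ue_asc (w : {w // p w}) (i : ℕ) (hi : i + 1 < N) (h : ltr w.1 i < ltr w.1 (i + 1)) :
    HA.gen q N i • ue p hp q w = ue p hp q (swp p hp w i) := by
  classical
  apply (Rep.e _).injective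
  rw [HM.gen_smul]
  unfold ue
  rw [LinearEquiv.apply_symm_apply, LinearEquiv.apply_symm_apply]
  funext u
  rw [uT_apply, if_pos hi]
  by_cases h1 : u = swp p hp w i
  · subst h1
    have hne : swp p hp w i ≠ w := by
      intro e
      have := congrArg (fun x => ltr x.1 i) e
      simp only [ltr_swp p hp _ _ _ hi, if_true] at this
      omega
    simp only [swp_swp, Pi.single_eq_same, ltr_swp p hp _ _ _ hi, if_true,
      Nat.succ_ne_self, if_false, h.ne', h.not_gt]
    rw [Pi.single_eq_of_ne hne]; simp
  · rw [Pi.single_eq_of_ne h1]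
    have h2 : swp p hp u i ≠ w := by
      rintro rfl; exact h1 (swp_swp p hp u i).symm
    rw [Pi.single_eq_of_ne h2]
    by_cases h3 : u = w
    · subst h3; simp [h, h.ne]
    · rw [Pi.single_eq_of_ne h3]; simp

theorem exists_minimal_word (p : (Fin N → Fin n) → Prop)
    (hp : ∀ w i, p w → p (sw w i)) (w0 : {w // p w}) : ∃ w : {w // p w}, ∀ i, ¬ desc w.1 i := by
  obtain ⟨w, hw⟩ : ∃ w : {w // p w}, ∀ u : {w // p w}, ms w.1 ≤ ms u.1 := by
    have : Nonempty {w // p w} := ⟨w0⟩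
    exact ⟨Function.argmin (fun w : {w // p w} => ms w.1), fun u =>
      Function.argmin_le (fun w : {w // p w} => ms w.1) u⟩
  refine ⟨w, fun i hi => ?_⟩
  have := hw (swp p hp w i)
  have := ms_sw _ _ hi
  simp only [swp] at *
  omega

theorem ue_eq (w : {w // p w}) (i : ℕ) (hi : i + 1 < N) (h : ltr w.1 i = ltr w.1 (i + 1)) :
    HA.gen q N i • ue p hp q w = q • ue p hp q w := by
  classical
  apply (Rep.e _).injective
  rw [HM.gen_smul, map_smul]
  unfold ue
  rw [LinearEquiv.apply_symm_apply]
  funext u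
  rw [uT_apply, if_pos hi]
  have hsw := swp_self p hp w i h
  by_cases h1 : u = w
  · subst h1
    simp [h]
  · have h2 : swp p hp u i ≠ w := by
      intro e
      apply h1
      have := swp_swp p hp u i
      rw [e, hsw] at this
      exact this.symm
    simp [Pi.single_eq_of_ne h1, Pi.single_eq_of_ne h2]

variable {X : Type*} [AddCommGroup X] [Module K X] [Module (HA q N) X]
  [IsScalarTower K (HA q N) X]

theorem hom_det (w0 : {w // p w}) (hw0 : ∀ w, p w → (∀ i, ¬ desc w i) → w = w0.1)
    (f : UM p hp q →ₗ[HA q N] X) (hf : f (ue p hp q w0) = 0) : f = 0 := by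
  classical
  have key : ∀ m, ∀ w : {w // p w}, ms w.1 = m → f (ue p hp q w) = 0 := by
    intro m
    induction m using Nat.strong_induction_on with
    | _ m ih =>
    intro w hw
    by_cases hd : ∃ i, desc w.1 i
    · obtain ⟨i, hi⟩ := hd
      have h := ih _ (hw ▸ ms_sw _ _ hi) (swp p hp w i) rfl
      have h2 := ue_asc (q := q) p hp (swp p hp w i) i hi.1 (by
        simp only [ltr_swp p hp _ _ _ hi.1, if_true, Nat.succ_ne_self, if_false]; exact hi.2)
      rw [swp_swp] at h2
      rw [← h2, map_smul, h, smul_zero]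
    · push Not at hd
      have : w = w0 := Subtype.ext (hw0 _ w.2 hd)
      rw [this, hf]
  apply LinearMap.ext
  intro x
  have hx : x = ∑ w, (Rep.e _ x) w • ue p hp q w := by
    apply (Rep.e _).injective
    rw [map_sum]
    simp only [map_smul, ue, LinearEquiv.apply_symm_apply]
    funext u
    simp [Finset.sum_apply, Pi.single_apply]
  have hK : ∀ (c : K) (y : UM p hp q), f (c • y) = c • f y := fun c y => by
    rw [← algebraMap_smul (HA q N), map_smul, algebraMap_smul]
  rw [hx, map_sum]
  simp [hK, key _ _ rfl]

theorem hom_exists (w0 : {w // p w}) (hw0 : ∀ w, p w → (∀ i, ¬ desc w i) → w = w0.1)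
    (v : X) (hv : v ∈ inv q N w0.1 X) :
    ∃ f : UM p hp q →ₗ[HA q N] X, f (ue p hp q w0) = v := by
  classical
  let T := famOf q N X
  have hT : IsHF q N T := famOf_isHF X
  have main := fun w hw => beta_main hT p hp w0.1 hw0 v (fun i h1 h2 => hv i h1 h2) _ w rfl hw
  have hTg : ∀ i x, HA.gen q N i • x = T i x := fun i x => rfl
  let F : UM p hp q →ₗ[K] X :=
    (Fintype.linearCombination K (fun w : {w // p w} => beta T v w.1)) ∘ₗ (Rep.e _).toLinearMap
  have hF : ∀ x, F x = ∑ w : {w // p w}, (Rep.e _ x) w • beta T v w.1 := fun x => rfl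
  refine ⟨mkHom F ?_, ?_⟩
  · intro i x
    by_cases hi : i + 1 < N
    swap
    · rw [(HA.isHF q N).zero i (by omega)]; simp
    rw [hF, hF, HM.gen_smul, hTg, map_sum]
    generalize Rep.e _ x = f
    let A : {w // p w} → K := fun w => if ltr w.1 i = ltr w.1 (i + 1) then 0 else
      if ltr w.1 i < ltr w.1 (i + 1) then 1 else q
    let B : {w // p w} → K := fun w => if ltr w.1 i = ltr w.1 (i + 1) then q else
      if ltr w.1 i < ltr w.1 (i + 1) then 0 else q - 1
    have h1 : ∀ w : {w // p w}, T i (beta T v w.1) =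
        A w • beta T v (swp p hp w i).1 + B w • beta T v w.1 := by
      intro w
      rcases lt_trichotomy (ltr w.1 i) (ltr w.1 (i + 1)) with h | h | h
      · simp only [A, B, h.ne, h, if_true, if_false, one_smul, zero_smul, add_zero]
        have := (main (swp p hp w i).1 (swp p hp w i).2).1 i ⟨hi, by
          simp only [ltr_swp p hp _ _ _ hi, if_true, Nat.succ_ne_self, if_false]; exact h⟩
        rw [this]
        congr 2
        exact (sw_sw _ _).symm
      · simp only [A, B, h, if_true, zero_smul, zero_add]
        exact (main w.1 w.2).2 i hi h
      · simp only [A, B, h.ne', h.not_gt, if_false]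
        have := (main w.1 w.2).1 i ⟨hi, h⟩
        have q2 := LinearMap.congr_fun (hT.quad i hi) (beta T v (sw w.1 i))
        simp only [Module.End.mul_apply, LinearMap.add_apply, LinearMap.smul_apply,
          Module.End.one_apply] at q2
        rw [← this] at q2
        rw [q2, add_comm]; rfl
    have h2 : ∀ w : {w // p w}, uT p hp q i f w =
        A (swp p hp w i) * f (swp p hp w i) + B w * f w := by
      intro w
      rw [uT_apply, if_pos hi]
      rcases lt_trichotomy (ltr w.1 i) (ltr w.1 (i + 1)) with h | h | h
      · simp [A, B, ltr_swp p hp _ _ _ hi, h, h.ne, h.ne', h.not_gt]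
      · simp [A, B, ltr_swp p hp _ _ _ hi, h]
      · simp [A, B, ltr_swp p hp _ _ _ hi, h, h.ne, h.ne', h.not_gt]
    simp only [h2, map_smul, h1, smul_add, add_smul, Finset.sum_add_distrib, smul_smul]
    congr 1
    · let e : Equiv.Perm {w // p w} := ⟨fun w => swp p hp w i, fun w => swp p hp w i,
        fun w => swp_swp p hp w i, fun w => swp_swp p hp w i⟩
      rw [← Equiv.sum_comp e]
      apply Finset.sum_congr rfl
      intro w _
      simp only [e, Equiv.coe_fn_mk, swp_swp]
      rw [mul_comm]
    · apply Finset.sum_congr rfl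
      intro w _
      rw [mul_comm]
  · rw [mkHom_apply, hF]
    simp only [ue, LinearEquiv.apply_symm_apply]
    rw [Finset.sum_eq_single w0]
    · rw [Pi.single_eq_same, one_smul]
      by_cases hd : ∃ i, desc w0.1 i
      · exfalso
        obtain ⟨w, hw⟩ := exists_minimal_word p hp w0
        have := hw0 w.1 w.2 hw
        obtain ⟨i, hi⟩ := hd
        exact hw i (this ▸ hi)
      · push Not at hd
        exact beta_no _ _ hd
    · intro w _ hw
      rw [Pi.single_eq_of_ne hw, zero_smul]
    · simp

theorem pair_UM (w0 : {w // p w}) (hw0 : ∀ w, p w → (∀ i, ¬ desc w i) → w = w0.1) :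
    pair K (HA q N) (UM p hp q) X = finrank K (inv q N w0.1 X) := by
  unfold pair
  let F : (UM p hp q →ₗ[HA q N] X) →ₗ[K] inv q N w0.1 X :=
    { toFun := fun f => ⟨f (ue p hp q w0), by
        intro i hi he
        have hK : ∀ (c : K) (y : UM p hp q), f (c • y) = c • f y := fun c y => by
          rw [← algebraMap_smul (HA q N), map_smul, algebraMap_smul]
        rw [← map_smul, ue_eq p hp w0 i hi he, hK]⟩
      map_add' := fun f g => rfl
      map_smul' := fun c f => rfl }
  refine LinearEquiv.finrank_eq (LinearEquiv.ofBijective F ⟨?_, ?_⟩)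
  · rw [← LinearMap.ker_eq_bot, LinearMap.ker_eq_bot']
    intro f hf
    exact hom_det p hp w0 hw0 f (congrArg Subtype.val hf)
  · rintro ⟨v, hv⟩
    obtain ⟨f, hf⟩ := hom_exists p hp w0 hw0 v hv
    exact ⟨f, Subtype.ext hf⟩
end inv
end Hk

namespace Hk
open Module
set_option linter.unusedSectionVars false
set_option linter.unusedSimpArgs false

section structureHA
variable {K : Type*} [Field K] (q : K) (N : ℕ)

/-- the subalgebra generated by the first generators -/
noncomputable def Am (m : ℕ) : Subalgebra K (HA q N) :=
  Algebra.adjoin K {x | ∃ i, i < m ∧ x = HA.gen q N i}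

/-- the subspace that turns out to be the next subalgebra -/
noncomputable def Bm (m : ℕ) : Submodule K (HA q N) :=
  Subalgebra.toSubmodule (Am q N m) ⊔
    Subalgebra.toSubmodule (Am q N m) * Submodule.span K {HA.gen q N m} *
      Subalgebra.toSubmodule (Am q N m)

variable {q N}

theorem gen_mem_Am {i m : ℕ} (h : i < m) : HA.gen q N i ∈ Am q N m :=
  Algebra.subset_adjoin ⟨i, h, rfl⟩

theorem Am_mono {m m' : ℕ} (h : m ≤ m') : Am q N m ≤ Am q N m' := by
  apply Algebra.adjoin_mono
  rintro x ⟨i, hi, rfl⟩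
  exact ⟨i, by omega, rfl⟩

theorem gen_comm_lt (i j : ℕ) (h : i + 1 < j) : Commute (HA.gen q N i) (HA.gen q N j) := by
  by_cases hj : j + 1 < N
  · exact (HA.isHF q N).comm i j h hj
  · rw [(HA.isHF q N).zero j (by omega)]; exact Commute.zero_right _

theorem Am_comm {m j : ℕ} (h : m < j) {a : HA q N} (ha : a ∈ Am q N m) :
    a * HA.gen q N j = HA.gen q N j * a := by
  induction ha using Algebra.adjoin_induction with
  | mem x hx =>
    obtain ⟨i, hi, rfl⟩ := hx
    exact gen_comm_lt i j (by omega)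
  | algebraMap r => exact Algebra.commutes r _
  | add x y _ _ hx hy => rw [add_mul, mul_add, hx, hy]
  | mul x y _ _ hx hy => rw [mul_assoc, hy, ← mul_assoc, hx, mul_assoc]

theorem mem_Bm_triple {m : ℕ} {a c : HA q N} (ha : a ∈ Am q N m) (hc : c ∈ Am q N m) :
    a * HA.gen q N m * c ∈ Bm q N m :=
  Submodule.mem_sup_right (Submodule.mul_mem_mul (Submodule.mul_mem_mul ha
    (Submodule.mem_span_singleton_self _)) hc)

theorem Bm_induction {m : ℕ} {p : HA q N → Prop} (h1 : ∀ a ∈ Am q N m, p a)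
    (h2 : ∀ a ∈ Am q N m, ∀ c ∈ Am q N m, p (a * HA.gen q N m * c))
    (h3 : ∀ x y, p x → p y → p (x + y)) {x : HA q N} (hx : x ∈ Bm q N m) : p x := by
  obtain ⟨y, hy, z, hz, rfl⟩ := Submodule.mem_sup.1 hx
  refine h3 _ _ (h1 y hy) ?_
  clear hx
  induction hz using Submodule.mul_induction_on' with
  | mem_mul_mem u hu c hc =>
    induction hu using Submodule.mul_induction_on' with
    | mem_mul_mem a ha t ht =>
      obtain ⟨k, rfl⟩ := Submodule.mem_span_singleton.1 ht
      have := h2 (k • a) ((Am q N m).smul_mem ha k) c hc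
      simpa using this
    | add u _ v _ hu hv => rw [add_mul]; exact h3 _ _ hu hv
  | add u _ v _ hu hv => exact h3 _ _ hu hv

theorem Am_succ_le (m : ℕ) : ∀ x ∈ Am q N (m + 1), x ∈ Bm q N m := by
  induction m with
  | zero =>
    suffices h : ∀ x ∈ Am q N 1, ∀ b ∈ Bm q N 0, x * b ∈ Bm q N 0 by
      intro x hx
      simpa using h x hx 1 (Submodule.mem_sup_left (one_mem (Am q N 0)))
    intro x hx
    have hA0 : ∀ a ∈ Am q N 0, ∃ k : K, a = algebraMap K _ k := by
      intro a ha
      have : Am q N 0 = ⊥ := by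
        unfold Am
        rw [show {x | ∃ i, i < 0 ∧ x = HA.gen q N i} = ∅ by ext; simp]
        exact Algebra.adjoin_empty _ _
      rw [this] at ha
      obtain ⟨k, hk⟩ := Algebra.mem_bot.1 ha
      exact ⟨k, hk.symm⟩
    have h1 : HA.gen q N 0 ∈ Bm q N 0 := by
      simpa using mem_Bm_triple (one_mem (Am q N 0)) (one_mem (Am q N 0))
    have h0 : (1 : HA q N) ∈ Bm q N 0 := Submodule.mem_sup_left (one_mem (Am q N 0))
    have h2 : HA.gen q N 0 * HA.gen q N 0 ∈ Bm q N 0 := by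
      by_cases h : 0 + 1 < N
      · rw [(HA.isHF q N).quad 0 h]
        exact add_mem (Submodule.smul_mem _ _ h1) (Submodule.smul_mem _ _ h0)
      · rw [(HA.isHF q N).zero 0 (by omega)]; simp
    induction hx using Algebra.adjoin_induction with
    | mem x hx =>
      obtain ⟨i, hi, rfl⟩ := hx
      obtain rfl : i = 0 := by omega
      intro b hb
      refine Bm_induction (p := fun b => _ * b ∈ _) ?_ ?_ ?_ hb
      · intro a ha
        obtain ⟨k, rfl⟩ := hA0 a ha
        rw [← Algebra.commutes, ← Algebra.smul_def]
        exact Submodule.smul_mem _ _ h1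
      · intro a ha c hc
        obtain ⟨k, rfl⟩ := hA0 a ha
        obtain ⟨l, rfl⟩ := hA0 c hc
        rw [← Algebra.commutes l, ← Algebra.smul_def k, ← Algebra.smul_def l, mul_smul_comm,
          mul_smul_comm]
        exact Submodule.smul_mem _ _ (Submodule.smul_mem _ _ h2)
      · intro x y hx hy
        rw [mul_add]; exact add_mem hx hy
    | algebraMap r => intro b hb; rw [← Algebra.smul_def]; exact Submodule.smul_mem _ _ hb
    | add x y _ _ hx hy => intro b hb; rw [add_mul]; exact add_mem (hx b hb) (hy b hb)
    | mul x y _ _ hx hy => intro b hb; rw [mul_assoc]; exact hx _ (hy b hb)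
  | succ m ih =>
    suffices h : ∀ x ∈ Am q N (m + 1 + 1), ∀ b ∈ Bm q N (m + 1), x * b ∈ Bm q N (m + 1) by
      intro x hx
      simpa using h x hx 1 (Submodule.mem_sup_left (one_mem (Am q N (m + 1))))
    intro x hx
    induction hx using Algebra.adjoin_induction with
    | mem x hx =>
      obtain ⟨i, hi, rfl⟩ := hx
      rcases Nat.lt_or_ge i (m + 1) with h | h
      · intro b hb
        refine Bm_induction (p := fun b => _ * b ∈ _) ?_ ?_ ?_ hb
        · intro a ha
          exact Submodule.mem_sup_left ((Am q N (m + 1)).mul_mem (gen_mem_Am h) ha)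
        · intro a ha c hc
          rw [← mul_assoc, ← mul_assoc]
          exact mem_Bm_triple (mul_mem (gen_mem_Am h) ha) hc
        · intro x y hx hy
          rw [mul_add]; exact add_mem hx hy
      · obtain rfl : i = m + 1 := by omega
        intro b hb
        refine Bm_induction (p := fun b => _ * b ∈ _) ?_ ?_ ?_ hb
        · intro a ha
          simpa using mem_Bm_triple (one_mem (Am q N (m + 1))) ha
        · intro a ha c hc
          by_cases hN : m + 1 + 1 < N
          swap
          · rw [(HA.isHF q N).zero (m + 1) (by omega)]; simp
          have ha' := ih a ha
          refine Bm_induction (p := fun a => _ * (a * _ * c) ∈ _) ?_ ?_ ?_ ha'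
          · intro a ha
            have e : HA.gen q N (m + 1) * (a * HA.gen q N (m + 1) * c) =
                (q - 1) • (a * HA.gen q N (m + 1) * c) + q • (a * c) := by
              rw [← mul_assoc, ← mul_assoc, ← Am_comm (by omega) ha, mul_assoc a,
                (HA.isHF q N).quad _ hN]
              simp only [mul_add, add_mul, mul_smul_comm, smul_mul_assoc, mul_one]
            rw [e]
            have ha2 := Am_mono (q := q) (N := N) (show m ≤ m + 1 by omega) ha
            exact add_mem (Submodule.smul_mem _ _ (mem_Bm_triple ha2 hc))
              (Submodule.smul_mem _ _ (Submodule.mem_sup_left ((Am q N (m + 1)).mul_mem ha2 hc)))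
          · intro u hu v hv
            have e : HA.gen q N (m + 1) * (u * HA.gen q N m * v * HA.gen q N (m + 1) * c) =
                (u * HA.gen q N m) * HA.gen q N (m + 1) * (HA.gen q N m * v * c) := by
              have b := (HA.isHF q N).braid m hN
              have c1 := Am_comm (j := m + 1) (by omega) hu
              have c2 := Am_comm (j := m + 1) (by omega) hv
              calc _ = (HA.gen q N (m + 1) * u) * HA.gen q N m * (v * HA.gen q N (m + 1)) * c := by
                    simp only [mul_assoc]
                _ = u * (HA.gen q N (m + 1) * HA.gen q N m * HA.gen q N (m + 1)) * v * c := by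
                    rw [← c1, c2]; simp only [mul_assoc]
                _ = _ := by rw [← b]; simp only [mul_assoc]
            rw [e]
            have hu2 := Am_mono (q := q) (N := N) (show m ≤ m + 1 by omega) hu
            have hv2 := Am_mono (q := q) (N := N) (show m ≤ m + 1 by omega) hv
            exact mem_Bm_triple (mul_mem hu2 (gen_mem_Am (by omega)))
              (mul_mem (mul_mem (gen_mem_Am (by omega)) hv2) hc)
          · intro x y hx hy
            rw [add_mul, add_mul, mul_add]; exact add_mem hx hy
        · intro x y hx hy
          rw [mul_add]; exact add_mem hx hy
    | algebraMap r => intro b hb; rw [← Algebra.smul_def]; exact Submodule.smul_mem _ _ hb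
    | add x y _ _ hx hy => intro b hb; rw [add_mul]; exact add_mem (hx b hb) (hy b hb)
    | mul x y _ _ hx hy => intro b hb; rw [mul_assoc]; exact hx _ (hy b hb)

theorem Am_top : Am q N N = ⊤ := by
  rw [eq_top_iff, ← HA.adjoin_gen]
  apply Algebra.adjoin_le
  rintro _ ⟨i, rfl⟩
  by_cases h : i < N
  · exact gen_mem_Am h
  · rw [(HA.isHF q N).zero i (by omega)]; exact zero_mem _

theorem Am_fg (m : ℕ) : (Subalgebra.toSubmodule (Am q N m)).FG := by
  induction m with
  | zero =>
    have : Am q N 0 = ⊥ := by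
      unfold Am
      rw [show {x | ∃ i, i < 0 ∧ x = HA.gen q N i} = ∅ by ext; simp]
      exact Algebra.adjoin_empty _ _
    rw [this]
    exact ⟨{1}, by rw [Algebra.toSubmodule_bot, Finset.coe_singleton, Submodule.one_eq_span]⟩
  | succ m ih =>
    have h : (Bm q N m).FG := ih.sup ((ih.mul (Submodule.fg_span_singleton _)).mul ih)
    exact Submodule.FG.of_le h (Am_succ_le m)

instance HA_finite : Module.Finite K (HA q N) := by
  have := Am_fg (q := q) (N := N) N
  rw [Am_top] at this
  exact ⟨by simpa using this⟩
end structureHA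
end Hk

namespace Hk
open Module
set_option linter.unusedSectionVars false
set_option linter.unusedSimpArgs false

section psi
variable {L : Type*} [Field L]

/-- diagonal coefficient of a generator -/
def gg (q : L) (a b : ℕ) : L := if a = b then q else if b < a then q - 1 else 0

/-- transfer sums -/
def ph {n : ℕ} (q : L) (x : Fin n → L) : ℕ → Fin n → L
  | 0, c => x c
  | r + 1, c => x c * ∑ c', gg q c.1 c'.1 * ph q x r c'

open PowerSeries in
/-- q-derivation -/
noncomputable def qD (q : L) (P : PowerSeries L) : PowerSeries L :=
  PowerSeries.mk fun k => (∑ i ∈ Finset.range k, q ^ i) * coeff k P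

open PowerSeries in
theorem qD_rescale (q : L) (P : PowerSeries L) :
    rescale q P = C (q - 1) * qD q P + P := by
  ext k
  simp only [coeff_rescale, qD, map_add, coeff_C_mul, coeff_mk]
  have := geom_sum_mul q k
  linear_combination (-coeff k P) * this

open PowerSeries in
theorem qD_mul (q x : L) (P : PowerSeries L) :
    qD q ((1 - C x * X) * P) = (1 - C (q * x) * X) * qD q P - C x * X * P := by
  ext k
  cases k with
  | zero => simp [qD, coeff_mk, sub_mul, mul_assoc]
  | succ k =>
    have h : ∀ y : L, ∀ Q : PowerSeries L, coeff (k + 1) (C y * X * Q) = y * coeff k Q := by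
      intro y Q; rw [mul_assoc, coeff_C_mul, mul_comm X, coeff_succ_mul_X]
    simp only [qD, coeff_mk, sub_mul, one_mul, map_sub, h]
    rw [geom_sum_succ]
    ring

open PowerSeries in
theorem psi_series {n : ℕ} (q : L) (x : Fin n → L) (j : ℕ) (hj : j ≤ n) :
    X * (∑ c ∈ Finset.univ.filter (fun c : Fin n => c.1 < j), PowerSeries.mk fun r => ph q x r c) *
      rescale q (∏ c ∈ Finset.univ.filter (fun c : Fin n => c.1 < j), (1 - C (x c) * X)) =
    - qD q (∏ c ∈ Finset.univ.filter (fun c : Fin n => c.1 < j), (1 - C (x c) * X)) := by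
  induction j with
  | zero => simp [qD]; ext k; cases k <;> simp [coeff_one]
  | succ j ih =>
    specialize ih (by omega)
    have hs : Finset.univ.filter (fun c : Fin n => c.1 < j + 1) =
        insert (⟨j, by omega⟩ : Fin n) (Finset.univ.filter (fun c : Fin n => c.1 < j)) := by
      ext c; simp [Fin.ext_iff]; omega
    rw [hs, Finset.sum_insert (by simp), Finset.prod_insert (by simp)]
    set S := ∑ c ∈ Finset.univ.filter (fun c : Fin n => c.1 < j), PowerSeries.mk fun r => ph q x r c
      with hS
    set P := ∏ c ∈ Finset.univ.filter (fun c : Fin n => c.1 < j), (1 - C (x c) * X)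
    set F : PowerSeries L := PowerSeries.mk fun r => ph q x r ⟨j, by omega⟩ with hF
    set y := x ⟨j, by omega⟩ with hy
    have hrel : (1 - C (q * y) * X) * F = C y * (1 + C (q - 1) * X * S) := by
      ext k
      cases k with
      | zero => simp [hF, ph, sub_mul, mul_add, mul_assoc, hy]
      | succ k =>
        have h : ∀ y : L, ∀ Q : PowerSeries L, coeff (k + 1) (C y * X * Q) = y * coeff k Q := by
          intro y Q; rw [mul_assoc, coeff_C_mul, mul_comm X, coeff_succ_mul_X]
        simp only [sub_mul, one_mul, map_sub, map_add, h, coeff_C_mul, mul_add]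
        rw [hF, hS]
        simp only [map_sum, coeff_mk, ph, ← hy]
        have : ∑ c', gg q j c'.1 * ph q x k c' = q * ph q x k ⟨j, by omega⟩ +
            (q - 1) * ∑ c ∈ Finset.univ.filter (fun c : Fin n => c.1 < j), ph q x k c := by
          rw [← Finset.add_sum_erase _ _ (Finset.mem_univ (⟨j, by omega⟩ : Fin n)),
            Finset.mul_sum, Finset.sum_filter]
          congr 1
          · simp [gg]
          · rw [← Finset.add_sum_erase (a := (⟨j, by omega⟩ : Fin n)) _ (fun c => if c.1 < j then _ else _)
              (Finset.mem_univ _)]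
            simp only [lt_irrefl, if_false, zero_add]
            apply Finset.sum_congr rfl
            intro c hc
            have : j ≠ c.1 := by
              intro h; simp [Fin.ext_iff] at hc; omega
            simp only [gg, this, if_false]
            split_ifs <;> simp
        rw [this]
        simp [coeff_one]
        ring
    rw [qD_mul]
    have e : rescale q ((1 - C y * X) * P) = (1 - C (q * y) * X) * rescale q P := by
      rw [map_mul]
      congr 1
      have hC : rescale q (C y) = C y := by
        ext k; cases k <;> simp [coeff_rescale, coeff_C]
      rw [map_sub, map_one, map_mul, hC, rescale_X, map_mul]
      ring
    rw [e]
    have h1 := qD_rescale q P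
    linear_combination (1 - C (q * y) * X) * ih + (X * rescale q P) * hrel +
      (C y * X) * h1 + (C y * X * C (q-1)) * ih

theorem poly_split [IsAlgClosed L] (N : ℕ) : ∀ P : Polynomial L, P.natDegree ≤ N → P.coeff 0 = 1 →
    ∃ x : Fin N → L, P = ∏ c, (1 - Polynomial.C (x c) * Polynomial.X) := by
  induction N with
  | zero =>
    intro P h1 h2
    refine ⟨fun _ => 0, ?_⟩
    rw [Polynomial.eq_C_of_natDegree_le_zero h1, h2]; simp
  | succ N ih =>
    intro P h1 h2
    by_cases hd : P.natDegree = 0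
    · refine ⟨fun _ => 0, ?_⟩
      rw [Polynomial.eq_C_of_natDegree_eq_zero hd, h2]; simp
    · obtain ⟨r, hr⟩ := IsAlgClosed.exists_root P (by
        intro h; exact hd (Polynomial.natDegree_eq_of_degree_eq_some h))
      have hr0 : r ≠ 0 := by
        rintro rfl
        rw [Polynomial.IsRoot, ← Polynomial.coeff_zero_eq_eval_zero, h2] at hr
        exact one_ne_zero hr
      obtain ⟨Q, hQ⟩ := Polynomial.dvd_iff_isRoot.2 hr
      have hP0 : P ≠ 0 := by rintro rfl; simp at h2
      have hQ0 : Q ≠ 0 := by rintro rfl; simp at hQ; exact hP0 hQ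
      have hdeg : P.natDegree = 1 + Q.natDegree := by
        rw [hQ, Polynomial.natDegree_mul (Polynomial.X_sub_C_ne_zero r) hQ0,
          Polynomial.natDegree_X_sub_C]
      have hc0 : (-r) * Q.coeff 0 = 1 := by
        rw [← h2, hQ, Polynomial.mul_coeff_zero]; simp
      obtain ⟨x, hx⟩ := ih (Polynomial.C (-r) * Q) (by
          refine (Polynomial.natDegree_C_mul_le _ _).trans ?_; omega) (by simpa using hc0)
      refine ⟨Fin.cons r⁻¹ x, ?_⟩
      rw [Fin.prod_univ_succ]
      simp only [Fin.cons_zero, Fin.cons_succ]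
      rw [← hx, hQ]
      have : Polynomial.C r⁻¹ * Polynomial.C r = (1 : Polynomial L) := by
        rw [← Polynomial.C_mul, inv_mul_cancel₀ hr0, Polynomial.C_1]
      rw [Polynomial.C_neg]
      linear_combination (-Polynomial.X * Q) * this

theorem exists_x [IsAlgClosed L] (q : L) (hq : ∀ k : ℕ, 1 ≤ k → (∑ i ∈ Finset.range k, q ^ i) ≠ 0)
    (N : ℕ) : ∃ x : Fin N → L, ∀ r, r < N → ∑ c, ph q x r c = if r = 0 then 1 else 0 := by
  let p : ℕ → L := fun k => ∏ i ∈ Finset.range k, (- q ^ i / (∑ j ∈ Finset.range (i + 1), q ^ j))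
  have hp0 : p 0 = 1 := by simp [p]
  have hp : ∀ k, (∑ j ∈ Finset.range (k + 1), q ^ j) * p (k + 1) = - q ^ k * p k := by
    intro k
    have := hq (k + 1) (by omega)
    simp only [p]
    rw [Finset.prod_range_succ]
    field_simp
  let P : Polynomial L := ∑ k ∈ Finset.range (N + 1), Polynomial.monomial k (p k)
  have hPc : ∀ k, k ≤ N → P.coeff k = p k := by
    intro k hk
    simp only [P, Polynomial.finsetSum_coeff, Polynomial.coeff_monomial]
    rw [Finset.sum_ite_eq' ]
    simp; omega
  obtain ⟨x, hx⟩ := poly_split N P (by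
    apply Polynomial.natDegree_sum_le_of_forall_le
    intro i hi
    refine (Polynomial.natDegree_monomial_le _).trans ?_
    simp at hi; omega) (by rw [hPc 0 (by omega), hp0])
  refine ⟨x, ?_⟩
  have key := psi_series q x N le_rfl
  have hf : Finset.univ.filter (fun c : Fin N => c.1 < N) = Finset.univ := by
    ext c; simp
  rw [hf] at key
  set S : PowerSeries L := ∑ c, PowerSeries.mk fun r => ph q x r c with hS
  have hPP : (P : PowerSeries L) = ∏ c, (1 - PowerSeries.C (x c) * PowerSeries.X) := by
    rw [hx, ← Polynomial.coeToPowerSeries.ringHom_apply, map_prod]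
    simp
  rw [← hPP] at key
  have hd : (PowerSeries.X : PowerSeries L) ^ N ∣ (S - 1) * PowerSeries.rescale q (P : PowerSeries L) := by
    rw [PowerSeries.X_pow_dvd_iff]
    intro k hk
    have h1 := congrArg (PowerSeries.coeff (k + 1)) key
    rw [mul_assoc, mul_comm PowerSeries.X, PowerSeries.coeff_succ_mul_X] at h1
    rw [sub_mul, one_mul, map_sub, h1]
    simp only [qD, map_neg, PowerSeries.coeff_mk, PowerSeries.coeff_rescale, Polynomial.coeff_coe]
    rw [hPc _ (by omega), hPc _ (by omega), hp]
    ring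
  have hu : IsUnit (PowerSeries.rescale q (P : PowerSeries L)) := by
    rw [PowerSeries.isUnit_iff_constantCoeff, ← PowerSeries.coeff_zero_eq_constantCoeff_apply,
      PowerSeries.coeff_rescale, Polynomial.coeff_coe, hPc 0 (by omega), hp0]
    simp
  rw [hu.dvd_mul_right, PowerSeries.X_pow_dvd_iff] at hd
  intro r hr
  have := hd r hr
  rw [map_sub, hS, map_sum, sub_eq_zero] at this
  simpa [PowerSeries.coeff_one] using this

/-- edge factor -/
def GG (q : L) (b : Prop) [Decidable b] (a c : ℕ) : L := if b then gg q a c else 1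

open Classical in
/-- transfer along a set of edges -/
noncomputable def PH {n : ℕ} (q : L) (x : Fin n → L) : ℕ → (ℕ → Prop) → Fin n → L
  | 0, _, c => x c
  | m + 1, b, c => x c * ∑ c', GG q (b 0) c.1 c'.1 * PH q x m (fun i => b (i + 1)) c'

open Classical in
theorem PH_sum {n : ℕ} (q : L) (x : Fin n → L) (m : ℕ) : ∀ (b : ℕ → Prop) (c : Fin n),
    PH q x m b c = ∑ w : Fin m → Fin n, x c * (∏ i, x (w i)) *
      ∏ i : Fin m, GG q (b i) ((Fin.cons c w : Fin (m + 1) → Fin n) i.castSucc).1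
        ((Fin.cons c w : Fin (m + 1) → Fin n) i.succ).1 := by
  induction m with
  | zero => intro b c; simp [PH]
  | succ m ih =>
    intro b c
    rw [PH]
    simp only [ih]
    rw [← (Fin.consEquiv (fun _ => Fin n)).sum_comp, Fintype.sum_prod_type, Finset.mul_sum]
    apply Finset.sum_congr rfl
    intro c' _
    rw [Finset.mul_sum, Finset.mul_sum]
    apply Finset.sum_congr rfl
    intro w _
    rw [Fin.prod_univ_succ, Fin.prod_univ_succ]
    simp [Fin.consEquiv]
    ring

theorem PH_zero {n : ℕ} (q : L) (x : Fin n → L) (N : ℕ)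
    (hx : ∀ r, r < N → ∑ c, ph q x r c = if r = 0 then 1 else 0) (m : ℕ) (hm : m < N) :
    ∀ b : ℕ → Prop, ∃ s : L, ∃ r, r ≤ m ∧ (∀ c, PH q x m b c = s * ph q x r c) ∧
      ((∃ i, i < m ∧ b i) → s = 0 ∨ 1 ≤ r) := by
  classical
  induction m with
  | zero => intro b; exact ⟨1, 0, le_rfl, fun c => by simp [PH, ph], by simp⟩
  | succ m ih =>
    intro b
    obtain ⟨s, r, hr, h1, h2⟩ := ih (by omega) (fun i => b (i + 1))
    by_cases hb : b 0
    · refine ⟨s, r + 1, by omega, ?_, fun _ => Or.inr (by omega)⟩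
      intro c
      simp only [PH, ph, GG, hb, if_true, h1, Finset.mul_sum]
      apply Finset.sum_congr rfl
      intro _ _; ring
    · refine ⟨s * if r = 0 then 1 else 0, 0, by omega, ?_, ?_⟩
      · intro c
        simp only [PH, ph, GG, hb, if_false, h1, one_mul, ← Finset.mul_sum, hx r (by omega)]
        ring
      · rintro ⟨i, hi, hbi⟩
        left
        cases i with
        | zero => exact absurd hbi hb
        | succ i =>
          rcases h2 ⟨i, by omega, hbi⟩ with h | h
          · rw [h, zero_mul]
          · rw [if_neg (by omega), mul_zero]

theorem PH_total {n : ℕ} (q : L) (x : Fin n → L) (N : ℕ)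
    (hx : ∀ r, r < N → ∑ c, ph q x r c = if r = 0 then 1 else 0) (m : ℕ) (hm : m < N)
    (b : ℕ → Prop) (hb : ∃ i, i < m ∧ b i) : ∑ c, PH q x m b c = 0 := by
  obtain ⟨s, r, hr, h1, h2⟩ := PH_zero q x N hx m hm b
  simp only [h1, ← Finset.mul_sum]
  rcases h2 hb with h | h
  · rw [h, zero_mul]
  · rw [hx r (by omega), if_neg (by omega), mul_zero]
end psi
end Hk

namespace Hk
open Module
set_option linter.unusedSectionVars false
set_option linter.unusedSimpArgs false

theorem IsHF.restrict {K L A : Type*} [Field K] [Field L] [Algebra K L] [Ring A] [Algebra K A]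
    [Algebra L A] [IsScalarTower K L A] {q : K} {N : ℕ} {T : ℕ → A}
    (h : IsHF (algebraMap K L q) N T) : IsHF q N T where
  quad i hi := by
    rw [h.quad i hi, ← algebraMap_smul L (q - 1), ← algebraMap_smul L q, map_sub, map_one]
  braid := h.braid
  comm := h.comm
  zero := h.zero

section trace
variable {K L : Type*} [Field K] [Field L] [Algebra K L] (q : K) (N : ℕ) (x : Fin N → L)

/-- all words -/
abbrev Wd (N n : ℕ) := {w : Fin N → Fin n // (fun _ => True) w}

theorem hpTrue {N n : ℕ} : ∀ (w : Fin N → Fin n) (i : ℕ), (fun _ => True) w →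
    (fun _ : Fin N → Fin n => True) (sw w i) := fun _ _ _ => trivial

variable (L) in
/-- the operators over the large field -/
noncomputable abbrev TL (i : ℕ) : Module.End L (Wd N N → L) :=
  uT (fun _ : Fin N → Fin N => True) hpTrue (algebraMap K L q) i

variable (L) in
/-- representation over the large field -/
noncomputable def rhoL : HA q N →ₐ[K] Module.End L (Wd N N → L) :=
  HA.lift (IsHF.restrict (uT_isHF (fun _ : Fin N → Fin N => True) hpTrue (algebraMap K L q)))

theorem rhoL_gen (i : ℕ) : rhoL L q N (HA.gen q N i) = TL L q N i := HA.lift_gen _ _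

/-- diagonal operator -/
noncomputable def Dx : Module.End L (Wd N N → L) where
  toFun f w := (∏ i, x (w.1 i)) * f w
  map_add' f g := by funext w; simp [mul_add]
  map_smul' c f := by funext w; simp; ring

theorem Dx_apply (f : Wd N N → L) (w) : Dx N x f w = (∏ i, x (w.1 i)) * f w := rfl

theorem prod_sw {n : ℕ} (x : Fin n → L) (w : Fin N → Fin n) (i : ℕ) :
    ∏ j, x (sw w i j) = ∏ j, x (w j) := by
  unfold sw
  split_ifs with h
  · exact Equiv.prod_comp (Equiv.swap _ _) (fun j => x (w j))
  · rfl

theorem Dx_comm (z : HA q N) : rhoL L q N z * Dx N x = Dx N x * rhoL L q N z := by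
  induction z using HA.induction with
  | h0 c => rw [AlgHom.commutes]; exact Algebra.commutes _ _
  | hg i =>
    rw [rhoL_gen]
    refine LinearMap.ext fun f => funext fun w => ?_
    simp only [Module.End.mul_apply, Dx_apply, uT_apply]
    have := prod_sw N x w.1 i
    simp only [swp, this]
    split_ifs <;> ring
  | hm a b ha hb => rw [map_mul, mul_assoc, hb, ← mul_assoc, ha, mul_assoc]
  | ha a b ha hb => rw [map_add, add_mul, mul_add, ha, hb]

/-- weighted trace -/
noncomputable def trx (z : HA q N) : L := LinearMap.trace L _ (rhoL L q N z * Dx N x)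

theorem trx_add (a b : HA q N) : trx q N x (a + b) = trx q N x a + trx q N x b := by
  simp [trx, add_mul]

theorem trx_smul (c : K) (b : HA q N) : trx q N x (c • b) = algebraMap K L c * trx q N x b := by
  unfold trx
  rw [map_smul, ← algebraMap_smul L c, smul_mul_assoc, map_smul, smul_eq_mul]

theorem trx_comm (a b : HA q N) : trx q N x (a * b) = trx q N x (b * a) := by
  unfold trx
  rw [map_mul (rhoL L q N), map_mul (rhoL L q N), mul_assoc, LinearMap.trace_mul_comm, mul_assoc (rhoL L q N b),
    ← Dx_comm, mul_assoc]

theorem trx_nilp (z : HA q N) (h : IsNilpotent z) : trx q N x z = 0 := by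
  unfold trx
  have h1 : IsNilpotent (rhoL L q N z * Dx N x) :=
    Commute.isNilpotent_mul_right (Dx_comm q N x z) (h.map (rhoL L q N))
  have := LinearMap.isNilpotent_trace_of_isNilpotent h1
  exact this.eq_zero

theorem trx_eq (z : HA q N) : trx q N x z =
    ∑ w : Wd N N, (∏ i, x (w.1 i)) * rhoL L q N z (Pi.single w 1) w := by
  classical
  unfold trx
  rw [LinearMap.trace_eq_matrix_trace L (Pi.basisFun L (Wd N N)), Matrix.trace]
  apply Finset.sum_congr rfl
  intro w _
  rw [Matrix.diag_apply, LinearMap.toMatrix_apply, Dx_comm]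
  simp only [Pi.basisFun_apply, Pi.basisFun_repr, Module.End.mul_apply, Dx_apply]

/-- ordered products -/
noncomputable def pT (D : List ℕ) : HA q N := (D.map (HA.gen q N)).prod

theorem pT_supp (D : List ℕ) (d : ℕ) (hD : ∀ e ∈ D, d < e) (w : Wd N N) (u : Wd N N)
    (hu : rhoL L q N (pT q N D) (Pi.single w 1) u ≠ 0) : ∀ j, j ≤ d → ltr u.1 j = ltr w.1 j := by
  classical
  induction D generalizing u with
  | nil =>
    simp only [pT, List.map_nil, List.prod_nil, map_one, Module.End.one_apply, Pi.single_apply] at hu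
    split_ifs at hu with h
    · subst h; intros; rfl
    · exact absurd rfl hu
  | cons e D ih =>
    have he := hD e (by simp)
    have ih' := ih (fun e' he' => hD e' (by simp [he']))
    simp only [pT, List.map_cons, List.prod_cons, map_mul, Module.End.mul_apply, rhoL_gen] at hu
    set f := rhoL L q N (pT q N D) (Pi.single w 1) with hf
    have hu2 : uT (fun _ : Fin N → Fin N => True) hpTrue (algebraMap K L q) e f u ≠ 0 := hu
    rw [uT_apply] at hu2
    intro j hj
    have hor : f u ≠ 0 ∨ f (swp _ hpTrue u e) ≠ 0 := by
      by_contra hcon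
      push Not at hcon
      apply hu2
      rw [hcon.1, hcon.2]; simp
    rcases hor with h | h
    · exact ih' u h j hj
    · rw [← ih' _ h j hj]
      exact (ltr_sw_of_ne _ _ _ (by omega) (by omega)).symm

theorem pT_diag (D : List ℕ) (hD : D.Pairwise (· < ·)) (hN : ∀ e ∈ D, e + 1 < N) (w : Wd N N) :
    rhoL L q N (pT q N D) (Pi.single w 1) w =
      (D.map fun d => gg (algebraMap K L q) (ltr w.1 d) (ltr w.1 (d + 1))).prod := by
  classical
  induction D with
  | nil => simp [pT]
  | cons e D ih =>
    rw [List.pairwise_cons] at hD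
    have ih' := ih hD.2 (fun e' he' => hN e' (by simp [he']))
    have he := hN e (by simp)
    simp only [pT, List.map_cons, List.prod_cons, map_mul, Module.End.mul_apply, rhoL_gen]
    have hs := pT_supp (L := L) q N D e hD.1 w
    rw [← ih']
    change uT (fun _ : Fin N → Fin N => True) hpTrue (algebraMap K L q) e
      (rhoL L q N (pT q N D) (Pi.single w 1)) w = _
    set f := rhoL L q N (pT q N D) (Pi.single w 1) with hf
    rw [uT_apply, if_pos he]
    have h0 : ltr w.1 e ≠ ltr w.1 (e + 1) → f (swp _ hpTrue w e) = 0 := by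
      intro hne
      by_contra hcon
      have := hs _ hcon e le_rfl
      simp only [ltr_swp _ hpTrue _ _ _ he, if_true] at this
      exact hne this.symm
    unfold gg
    rcases lt_trichotomy (ltr w.1 e) (ltr w.1 (e + 1)) with h | h | h
    · simp [h, h.ne, h.not_gt, h0 h.ne]
    · simp [h]
    · simp [h, h.ne', h.not_gt, h0 h.ne']

theorem trx_pT (hx : ∀ r, r < N → ∑ c, ph (algebraMap K L q) x r c = if r = 0 then 1 else 0)
    (D : List ℕ) (hD : D.Pairwise (· < ·)) (hN : ∀ e ∈ D, e + 1 < N) (hne : D ≠ []) :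
    trx q N x (pT q N D) = 0 := by
  classical
  rw [trx_eq]
  simp only [pT_diag q N D hD hN]
  obtain ⟨d, hd⟩ := List.exists_mem_of_ne_nil D hne
  obtain ⟨m, rfl⟩ : ∃ m, N = m + 1 := ⟨N - 1, by have := hN d hd; omega⟩
  have h := PH_total (algebraMap K L q) x (m + 1) hx m (by omega) (fun i => i ∈ D)
    ⟨d, by have := hN d hd; omega, hd⟩
  simp only [PH_sum] at h
  rw [← h, ← (Equiv.subtypeUnivEquiv (fun _ => trivial) :
    Wd (m + 1) (m + 1) ≃ (Fin (m + 1) → Fin (m + 1))).symm.sum_comp,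
    ← (Fin.consEquiv (fun _ => Fin (m + 1))).sum_comp, Fintype.sum_prod_type]
  apply Finset.sum_congr rfl
  intro c _
  apply Finset.sum_congr rfl
  intro w _
  simp only [Fin.consEquiv, Equiv.coe_fn_mk, Equiv.subtypeUnivEquiv_symm_apply,
    Fin.prod_univ_succ (fun i => x ((Fin.cons c w : Fin (m + 1) → Fin (m + 1)) i)),
    Fin.cons_zero, Fin.cons_succ]
  congr 1
  have hnd : D.Nodup := hD.imp (fun h => h.ne)
  rw [← List.prod_toFinset _ hnd]
  set u : Fin (m + 1) → Fin (m + 1) := Fin.cons c w with hu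
  have e1 : ∀ i : Fin m, GG (algebraMap K L q) (i.1 ∈ D) (u i.castSucc).1 (w i).1 =
      (fun d => if d ∈ D then gg (algebraMap K L q) (ltr u d) (ltr u (d + 1)) else 1) i.1 := by
    intro i
    have h1 : i.1 < m + 1 := by omega
    have h2 : i.1 + 1 < m + 1 := by omega
    simp only [GG, ltr, h1, h2, dif_pos]
    rfl
  refine Eq.trans ?_ (Finset.prod_congr rfl (g := fun i : Fin m => (fun d => if d ∈ D then
    gg (algebraMap K L q) (ltr u d) (ltr u (d + 1)) else 1) i.1) (fun i _ => (by
    refine Eq.trans ?_ (e1 i); congr))).symm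
  rw [Fin.prod_univ_eq_prod_range
    (fun d => if d ∈ D then gg (algebraMap K L q) (ltr u d) (ltr u (d + 1)) else 1) m,
    ← Finset.prod_filter]
  apply Finset.prod_congr _ (fun _ _ => rfl)
  ext d
  simp only [List.mem_toFinset, Finset.mem_filter, Finset.mem_range]
  exact ⟨fun h => ⟨by have := hN d h; omega, h⟩, fun h => h.2⟩

theorem trx_one (hx : ∀ r, r < N → ∑ c, ph (algebraMap K L q) x r c = if r = 0 then 1 else 0) :
    trx q N x (1 : HA q N) = 1 := by
  classical
  rw [trx_eq]
  simp only [map_one, Module.End.one_apply, Pi.single_eq_same, mul_one]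
  rw [← (Equiv.subtypeUnivEquiv (fun _ => trivial) :
    Wd N N ≃ (Fin N → Fin N)).symm.sum_comp]
  simp only [Equiv.subtypeUnivEquiv_symm_apply]
  have := (Finset.prod_univ_sum (fun _ : Fin N => (Finset.univ : Finset (Fin N))) (fun _ c => x c)).symm
  rw [Fintype.piFinset_univ] at this
  rw [this]
  rcases Nat.eq_zero_or_pos N with h | h
  · subst h; simp
  · have := hx 0 h
    simp only [ph, if_true] at this
    simp [this]

theorem trx_C (hx : ∀ r, r < N → ∑ c, ph (algebraMap K L q) x r c = if r = 0 then 1 else 0)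
    (m : ℕ) : ∀ b ∈ Am q N m, ∀ D : List ℕ, D.Pairwise (· < ·) → (∀ e ∈ D, e + 1 < N) →
      (∀ e ∈ D, m ≤ e) → D ≠ [] → trx q N x (b * pT q N D) = 0 := by
  induction m with
  | zero =>
    intro b hb D h1 h2 h3 h4
    have : Am q N 0 = ⊥ := by
      unfold Am
      rw [show {x | ∃ i, i < 0 ∧ x = HA.gen q N i} = ∅ by ext; simp]
      exact Algebra.adjoin_empty _ _
    rw [this] at hb
    obtain ⟨k, rfl⟩ := Algebra.mem_bot.1 hb
    rw [← Algebra.smul_def, trx_smul, trx_pT q N x hx D h1 h2 h4, mul_zero]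
  | succ m ih =>
    intro b hb D h1 h2 h3 h4
    have hb' := Am_succ_le m b hb
    refine Bm_induction (p := fun b => trx q N x (b * pT q N D) = 0) ?_ ?_ ?_ hb'
    · intro a ha
      exact ih a ha D h1 h2 (fun e he => by have := h3 e he; omega) h4
    · intro a ha c hc
      by_cases hm : m + 1 < N
      swap
      · rw [(HA.isHF q N).zero m (by omega)]
        simp only [mul_zero, zero_mul]
        have := trx_smul q N x 0 0
        simpa using this
      have hcD : c * pT q N D = pT q N D * c := by
        clear h1 h2 h4
        induction D with
        | nil => simp [pT]
        | cons e D ihD =>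
          have := ihD (fun e he => h3 e (by simp [he]))
          simp only [pT, List.map_cons, List.prod_cons] at this ⊢
          rw [← mul_assoc, Am_comm (by have := h3 e (by simp); omega) hc, mul_assoc, this, mul_assoc]
      rw [mul_assoc, hcD, ← mul_assoc, trx_comm]
      have := ih (c * a) (mul_mem hc ha) (m :: D)
        (List.pairwise_cons.2 ⟨fun e he => by have := h3 e he; omega, h1⟩)
        (by intro e he; rcases List.mem_cons.1 he with rfl | he; exacts [hm, h2 e he])
        (by intro e he; rcases List.mem_cons.1 he with rfl | he; exacts [le_rfl, by have := h3 e he; omega])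
        (by simp)
      simp only [pT, List.map_cons, List.prod_cons] at this ⊢
      simpa [mul_assoc] using this
    · intro u v hu hv
      rw [add_mul, trx_add, hu, hv, add_zero]


/-- content of the identity word -/
abbrev pid (N : ℕ) (w : Fin N → Fin N) : Prop := content w = content (id : Fin N → Fin N)

theorem hpid {N : ℕ} : ∀ (w : Fin N → Fin N) (i : ℕ), pid N w → pid N (sw w i) := fun w i h => by
  unfold pid; rw [content_sw]; exact h

/-- identity word -/
def wid (N : ℕ) : {w // pid N w} := ⟨id, rfl⟩

theorem ltr_wid {j : ℕ} (h : j < N) : ltr (wid N).1 j = j := by simp [ltr, wid, h]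

theorem content_surj {N n : ℕ} (w u : Fin N → Fin n) (hw : Monotone w) (hu : Monotone u)
    (h : content w = content u) : w = u := by
  have hc : ∀ a, (Finset.univ.filter (fun i => w i = a)).card =
      (Finset.univ.filter (fun i => u i = a)).card := by
    intro a
    have := congrFun h a
    unfold content at this
    exact_mod_cast this
  have hF : ∀ a, Nonempty ({i // w i = a} ≃ {i // u i = a}) := fun a => by
    rw [← Fintype.card_eq, Fintype.card_subtype, Fintype.card_subtype]; exact hc a
  let e := fun a => (hF a).some
  let σ : Equiv.Perm (Fin N) := (Equiv.sigmaFiberEquiv w).symm.trans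
    ((Equiv.sigmaCongrRight (fun a => (e a))).trans (Equiv.sigmaFiberEquiv u))
  have hσ : u ∘ σ = w := by
    funext i
    simp only [σ, Function.comp_apply, Equiv.trans_apply]
    exact ((e (w i)) ⟨i, rfl⟩).2
  have h1 := Tuple.unique_monotone (f := u) (σ := σ) (τ := 1) (by rw [hσ]; exact hw)
    (by simpa using hu)
  rw [hσ] at h1
  simpa using h1

theorem content_unique {N n : ℕ} (w u : Fin N → Fin n) (hw : ∀ i, ¬ desc w i)
    (hu : ∀ i, ¬ desc u i) (h : content w = content u) : w = u :=
  content_surj w u (ltr_mono_of_no_desc w hw) (ltr_mono_of_no_desc u hu) h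

theorem no_desc_of_mono {N n : ℕ} (w : Fin N → Fin n) (hw : Monotone w) : ∀ i, ¬ desc w i := by
  rintro i ⟨h1, h2⟩
  have : i < N := by omega
  simp only [ltr, this, h1, dif_pos] at h2
  have := hw (show (⟨i, this⟩ : Fin N) ≤ ⟨i + 1, h1⟩ by simp [Fin.le_def])
  exact absurd h2 (not_lt.2 this)

theorem wid_unique : ∀ w, pid N w → (∀ i, ¬ desc w i) → w = (wid N).1 := fun w hw hd =>
  content_unique _ _ hd (no_desc_of_mono _ (fun _ _ h => h)) hw

/-- canonical trace -/
noncomputable def tau (z : HA q N) : K :=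
  Rep.e _ (z • ue (pid N) hpid q (wid N)) (wid N)

theorem supp_stable {n : ℕ} (p : (Fin N → Fin n) → Prop) (hp : ∀ w i, p w → p (sw w i))
    (Q : {w // p w} → Prop) (m : ℕ) (hQ : ∀ i, i < m → i + 1 < N → ∀ w, Q (swp p hp w i) → Q w)
    (a : HA q N) (ha : a ∈ Am q N m) : ∀ f : UM p hp q, (∀ w, Rep.e _ f w ≠ 0 → Q w) →
      ∀ w, Rep.e _ (a • f) w ≠ 0 → Q w := by
  induction ha using Algebra.adjoin_induction with
  | mem x hx =>
    obtain ⟨i, hi, rfl⟩ := hx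
    intro f hf w hw
    rw [HM.gen_smul, uT_apply] at hw
    by_cases hN : i + 1 < N
    swap
    · simp [hN] at hw
    by_contra hcon
    have h1 : Rep.e _ f w = 0 := by
      by_contra h; exact hcon (hf w h)
    have h2 : Rep.e _ f (swp p hp w i) = 0 := by
      by_contra h; exact hcon (hQ i hi hN w (hf _ h))
    rw [h1, h2] at hw
    simp at hw
  | algebraMap r =>
    intro f hf w hw
    rw [algebraMap_smul, map_smul] at hw
    exact hf w (fun h => hw (by simp [h]))
  | add x y _ _ hx hy =>
    intro f hf w hw
    rw [add_smul, map_add] at hw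
    by_contra hcon
    have h1 : Rep.e _ (x • f) w = 0 := by
      by_contra h; exact hcon (hx f hf w h)
    have h2 : Rep.e _ (y • f) w = 0 := by
      by_contra h; exact hcon (hy f hf w h)
    apply hw
    rw [Pi.add_apply, h1, h2, add_zero]
  | mul x y _ _ hx hy =>
    intro f hf w hw
    rw [mul_smul] at hw
    exact hx _ (hy f hf) w hw

theorem tau_triple (m : ℕ) (a c : HA q N) (ha : a ∈ Am q N m) (hc : c ∈ Am q N m) :
    tau q N (a * HA.gen q N m * c) = 0 := by
  classical
  by_cases hm : m + 1 < N
  swap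
  · unfold tau
    rw [(HA.isHF q N).zero m (by omega)]; simp
  unfold tau
  rw [mul_smul, mul_smul]
  have h1 := supp_stable (q := q) N (pid N) hpid (fun w => (∀ j, j < N → m + 1 ≤ j → ltr w.1 j = j) ∧
    (∀ j, j < N → j ≤ m → ltr w.1 j ≤ m)) m (by
      intro i hi hN w ⟨g1, g2⟩
      constructor
      · intro j hj hj'
        have := g1 j hj hj'
        rwa [ltr_swp _ hpid _ _ _ hN, if_neg (by omega), if_neg (by omega)] at this
      · intro j hj hj'
        by_cases e1 : j = i
        · subst e1
          have := g2 (j + 1) hN (by omega)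
          rwa [ltr_swp _ hpid _ _ _ hN, if_neg (by omega), if_pos rfl] at this
        · by_cases e2 : j = i + 1
          · subst e2
            have := g2 i (by omega) (by omega)
            rwa [ltr_swp _ hpid _ _ _ hN, if_pos rfl] at this
          · have := g2 j hj hj'
            rwa [ltr_swp _ hpid _ _ _ hN, if_neg e1, if_neg e2] at this) c hc
    (ue (pid N) hpid q (wid N)) (by
      intro w hw
      have : w = wid N := by
        by_contra h
        apply hw
        unfold ue
        rw [LinearEquiv.apply_symm_apply, Pi.single_eq_of_ne h]
      subst this
      exact ⟨fun j hj _ => ltr_wid N hj, fun j hj h => by rw [ltr_wid N hj]; exact h⟩)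
  set f := c • ue (pid N) hpid q (wid N)
  have h2 := supp_stable (q := q) N (pid N) hpid (fun w => ltr w.1 (m + 1) ≠ m + 1) m (by
      intro i hi hN w h
      rwa [ltr_swp _ hpid _ _ _ hN, if_neg (by omega), if_neg (by omega)] at h) a ha
    (HA.gen q N m • f) (by
      intro w hw h
      rw [HM.gen_smul, uT_apply, if_pos hm] at hw
      have hor : Rep.e _ f w ≠ 0 ∨ Rep.e _ f (swp _ hpid w m) ≠ 0 := by
        by_contra hcon
        push Not at hcon
        apply hw
        rw [hcon.1, hcon.2]; simp
      have hz : Rep.e _ f (swp _ hpid w m) = 0 := by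
        by_contra hcon
        have := (h1 _ hcon).2 m (by omega) le_rfl
        rw [ltr_swp _ hpid _ _ _ hm, if_pos rfl, h] at this
        omega
      rcases hor with h3 | h3
      · have := (h1 _ h3).2 m (by omega) le_rfl
        rw [if_neg (by omega), if_pos (by omega), hz] at hw
        simp at hw
      · exact h3 hz)
  by_contra hcon
  exact h2 (wid N) hcon (ltr_wid N hm)

theorem tau_add (a b : HA q N) : tau q N (a + b) = tau q N a + tau q N b := by
  simp [tau, add_smul]

theorem trx_eq_tau (hx : ∀ r, r < N → ∑ c, ph (algebraMap K L q) x r c = if r = 0 then 1 else 0)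
    (m : ℕ) : ∀ z ∈ Am q N m, trx q N x z = algebraMap K L (tau q N z) := by
  induction m with
  | zero =>
    intro b hb
    have : Am q N 0 = ⊥ := by
      unfold Am
      rw [show {x | ∃ i, i < 0 ∧ x = HA.gen q N i} = ∅ by ext; simp]
      exact Algebra.adjoin_empty _ _
    rw [this] at hb
    obtain ⟨k, rfl⟩ := Algebra.mem_bot.1 hb
    rw [Algebra.algebraMap_eq_smul_one, trx_smul, trx_one q N x hx, mul_one]
    congr 1
    simp [tau, ue]
  | succ m ih =>
    intro b hb
    have hb' := Am_succ_le m b hb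
    refine Bm_induction (p := fun b => trx q N x b = algebraMap K L (tau q N b)) ih ?_ ?_ hb'
    · intro a ha c hc
      rw [tau_triple q N m a c ha hc, map_zero]
      by_cases hm : m + 1 < N
      · rw [trx_comm, ← mul_assoc]
        have := trx_C q N x hx m (c * a) (mul_mem hc ha) [m] (by simp) (by simpa using hm) (by simp)
          (by simp)
        simpa [pT] using this
      · rw [(HA.isHF q N).zero m (by omega)]
        have := trx_smul q N x 0 0
        simpa using this
    · intro u v hu hv
      rw [trx_add, tau_add, hu, hv, map_add]

end trace

theorem tau_nondeg {K : Type*} [Field K] (q : K) (hq0 : q ≠ 0) (N : ℕ) (z : HA q N)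
    (h : ∀ y, tau q N (y * z) = 0) : z = 0 := by
  classical
  have key : ∀ m, ∀ w : {w // pid N w}, ms w.1 = m → ∀ f : UM (pid N) hpid q,
      (∀ y : HA q N, Rep.e _ (y • f) (wid N) = 0) → Rep.e _ f w = 0 := by
    intro m
    induction m using Nat.strong_induction_on with
    | _ m ih =>
    intro w hw f hf
    by_cases hd : ∃ i, desc w.1 i
    · obtain ⟨i, hi⟩ := hd
      have := ih _ (hw ▸ ms_sw _ _ hi) (swp _ hpid w i) rfl (HA.gen q N i • f) (by
        intro y; rw [← mul_smul]; exact hf _)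
      rw [HM.gen_smul, uT_apply, if_pos hi.1] at this
      simp only [ltr_swp _ hpid _ _ _ hi.1, if_true, Nat.succ_ne_self, if_false, hi.2, hi.2.ne,
        swp_swp] at this
      exact (mul_eq_zero.1 this).resolve_left hq0
    · push Not at hd
      have : w = wid N := Subtype.ext (wid_unique N _ w.2 hd)
      subst this
      simpa using hf 1
  have h1 : z • ue (pid N) hpid q (wid N) = 0 := by
    apply (Rep.e _).injective
    rw [map_zero]
    funext w
    exact key _ w rfl _ (fun y => by rw [← mul_smul]; exact h y)
  obtain ⟨φ, hφ⟩ := hom_exists (q := q) (X := HA q N) (pid N) hpid (wid N) (wid_unique N) 1 (by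
    intro i hi he
    rw [ltr_wid N (by omega), ltr_wid N hi] at he
    omega)
  have := congrArg φ h1
  rw [map_smul, hφ, map_zero] at this
  simpa using this

theorem HA_semisimple {K : Type*} [Field K] (q : K) (hq0 : q ≠ 0)
    (hq : ∀ k : ℕ, 1 ≤ k → (∑ i ∈ Finset.range k, q ^ i) ≠ 0) (N : ℕ) :
    IsSemisimpleRing (HA q N) := by
  have hA : IsArtinianRing (HA q N) := IsArtinianRing.of_finite K _
  rw [IsArtinianRing.isSemisimpleRing_iff_jacobson, eq_bot_iff]
  intro z hz
  obtain ⟨x, hx⟩ := exists_x (algebraMap K (AlgebraicClosure K) q) (by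
    intro k hk h0
    apply hq k hk
    apply (algebraMap K (AlgebraicClosure K)).injective
    rw [map_sum, map_zero, ← h0]
    simp) N
  apply tau_nondeg q hq0
  intro y
  have h1 : IsNilpotent (y * z) := by
    have hn := IsArtinianRing.isNilpotent_jacobson_bot (R := HA q N)
    obtain ⟨k, hk⟩ := hn
    refine ⟨k, ?_⟩
    have hm : y * z ∈ Ideal.jacobson (⊥ : Ideal (HA q N)) := by
      apply Ideal.mul_mem_left
      rw [Ring.jacobson_eq_sInf_isMaximal] at hz
      simpa [Ideal.jacobson] using hz
    have := Ideal.pow_mem_pow hm k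
    rw [hk] at this
    simpa using this
  have h2 := trx_nilp q N x _ h1
  rw [trx_eq_tau q N x hx N _ (by rw [Am_top]; trivial)] at h2
  exact (map_eq_zero _).1 h2
end Hk

namespace Hk
open Finset

section sym
variable {A : Type*} [CommRing A] {n : ℕ}

/-- geometric series -/
noncomputable def geo (y : A) : PowerSeries A := PowerSeries.mk (fun l => y ^ l)

theorem geo_mul (y : A) : geo y * (1 - PowerSeries.C y * PowerSeries.X) = 1 := by
  ext k
  rw [mul_sub, mul_one, map_sub, ← mul_assoc, mul_comm (geo y), mul_assoc, PowerSeries.coeff_C_mul]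
  rcases k with _ | k
  · simp [geo]
  · rw [PowerSeries.coeff_succ_mul_X]
    simp [geo, pow_succ, mul_comm, PowerSeries.coeff_one]

/-- complete homogeneous polynomials, integer index -/
noncomputable def hh (y : Fin n → A) (k : ℤ) : A :=
  if k < 0 then 0 else PowerSeries.coeff k.toNat (∏ i, geo (y i))

theorem hh_neg (y : Fin n → A) (k : ℤ) (hk : k < 0) : hh y k = 0 := if_pos hk

theorem hh_nat (y : Fin n → A) (k : ℕ) : hh y k = PowerSeries.coeff k (∏ i, geo (y i)) := by
  unfold hh; rw [if_neg (by omega)]; simp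

theorem hh_zero (y : Fin n → A) : hh y 0 = 1 := by
  have := hh_nat y 0
  rw [Nat.cast_zero] at this
  rw [this, PowerSeries.coeff_zero_eq_constantCoeff, map_prod]
  apply Finset.prod_eq_one
  intro i _
  simp [geo]

theorem hh_map {B : Type*} [CommRing B] (f : A →+* B) (y : Fin n → A) (k : ℤ) :
    f (hh y k) = hh (fun i => f (y i)) k := by
  unfold hh
  split_ifs
  · simp
  · rw [← PowerSeries.coeff_map, map_prod]
    congr 2
    funext i
    ext l
    simp [geo]

/-- product over other variables, as polynomial -/
noncomputable def Ek (y : Fin n → A) (k : Fin n) : Polynomial A :=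
  ∏ i ∈ univ.erase k, (1 - Polynomial.C (y i) * Polynomial.X)

theorem Ek_deg (y : Fin n → A) (k : Fin n) : (Ek y k).natDegree < n := by
  have hn : 0 < n := k.pos
  refine lt_of_le_of_lt (Polynomial.natDegree_prod_le _ _) ?_
  refine lt_of_le_of_lt (Finset.sum_le_card_nsmul _ _ 1 ?_) ?_
  · intro i _
    refine (Polynomial.natDegree_sub_le _ _).trans ?_
    simp only [Polynomial.natDegree_one]
    exact max_le (by omega) ((Polynomial.natDegree_C_mul_le _ _).trans Polynomial.natDegree_X_le)
  · rw [Finset.card_erase_of_mem (mem_univ _)]; simp; omega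

theorem Ek_mul (y : Fin n → A) (k : Fin n) :
    ((Ek y k : Polynomial A) : PowerSeries A) * (∏ i, geo (y i)) = geo (y k) := by
  rw [← Finset.mul_prod_erase univ _ (mem_univ k)]
  have h : ((Ek y k : Polynomial A) : PowerSeries A) =
      ∏ i ∈ univ.erase k, (1 - PowerSeries.C (y i) * PowerSeries.X) := by
    unfold Ek
    have := map_prod (Polynomial.coeToPowerSeries.ringHom (R := A))
      (fun i => 1 - Polynomial.C (y i) * Polynomial.X) (univ.erase k)
    simp only [Polynomial.coeToPowerSeries.ringHom_apply, Polynomial.coe_sub, Polynomial.coe_one,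
      Polynomial.coe_mul, Polynomial.coe_C, Polynomial.coe_X] at this
    exact this
  rw [h, mul_left_comm, ← Finset.prod_mul_distrib]
  rw [Finset.prod_eq_one, mul_one]
  intro i _
  rw [mul_comm]; exact geo_mul _

theorem pow_eq (y : Fin n → A) (k : Fin n) (l : ℕ) :
    y k ^ l = ∑ j : Fin n, hh y ((l : ℤ) - j) * (Ek y k).coeff j := by
  have h := congrArg (PowerSeries.coeff l) (Ek_mul y k)
  rw [PowerSeries.coeff_mul] at h
  simp only [Polynomial.coeff_coe, geo, PowerSeries.coeff_mk] at h
  rw [← h, Finset.Nat.sum_antidiagonal_eq_sum_range_succ_mk,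
    Fin.sum_univ_eq_sum_range (fun j => hh y ((l : ℤ) - j) * (Ek y k).coeff j) n]
  have e1 : ∀ j, j ≤ l → (Ek y k).coeff j * PowerSeries.coeff (l - j) (∏ i, PowerSeries.mk
      fun l => y i ^ l) = hh y ((l : ℤ) - j) * (Ek y k).coeff j := by
    intro j hj
    rw [mul_comm, ← Nat.cast_sub hj, hh_nat]; rfl
  rw [Finset.sum_congr rfl (fun j hj => e1 j (by simpa [Nat.lt_succ_iff] using hj))]
  have e2 : ∀ M, n ≤ M → l.succ ≤ M → ∑ j ∈ range n, hh y ((l : ℤ) - j) * (Ek y k).coeff j =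
    ∑ j ∈ range l.succ, hh y ((l : ℤ) - j) * (Ek y k).coeff j := by
    intro M h1 h2
    rw [Finset.sum_subset (Finset.range_mono h1), Finset.sum_subset (Finset.range_mono h2)]
    · intro j _ hj
      rw [hh_neg, zero_mul]
      simp at hj; omega
    · intro j _ hj
      rw [Polynomial.coeff_eq_zero_of_natDegree_lt, mul_zero]
      have := Ek_deg y k
      simp at hj; omega
  exact (e2 (max n l.succ) (le_max_left _ _) (le_max_right _ _)).symm

/-- rho -/
def rho (n : ℕ) (j : Fin n) : ℕ := n - 1 - j

theorem rho_rev (j : Fin n) : rho n j = (Fin.rev j).1 := by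
  unfold rho; rw [Fin.val_rev]; omega

noncomputable def Hm (y : Fin n → A) (l : Fin n → ℕ) : Matrix (Fin n) (Fin n) A :=
  fun i j => hh y ((l i : ℤ) - rho n j)

noncomputable def alt (y : Fin n → A) (l : Fin n → ℕ) : Matrix (Fin n) (Fin n) A :=
  fun i k => y k ^ l i

theorem Hm_mul (y : Fin n → A) (l : Fin n → ℕ) :
    Hm y l * (Matrix.of fun j k => (Ek y k).coeff (rho n j)) = alt y l := by
  funext i k
  rw [Matrix.mul_apply]
  unfold Hm alt
  rw [pow_eq]
  simp only [Matrix.of_apply, rho_rev]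
  exact Fintype.sum_equiv Fin.revPerm _ _ (fun x => rfl)

theorem det_Hm_rho (y : Fin n → A) : (Hm y (rho n)).det = 1 := by
  rw [Matrix.det_of_isUpperTriangular]
  · apply Finset.prod_eq_one; intro i _; simp [Hm, hh_zero]
  · intro i j hij
    apply hh_neg
    unfold rho
    simp at hij
    omega

theorem det_Hm (y : Fin n → A) (l : Fin n → ℕ) :
    (Hm y l).det * (alt y (rho n)).det = (alt y l).det := by
  rw [← Hm_mul y (rho n), ← Hm_mul y l, Matrix.det_mul, Matrix.det_mul, det_Hm_rho, one_mul]

theorem det_alt_succ (y : Fin n → A) (l : Fin n → ℕ) :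
    (alt y (fun i => l i + 1)).det = (∏ i, y i) * (alt y l).det := by
  rw [← Matrix.det_mul_row]
  congr 1
  funext i k
  simp [alt, pow_succ, mul_comm]

theorem alt_det_eq (y : Fin n → A) (l : Fin n → ℕ) :
    (alt y l).det = ∑ σ : Equiv.Perm (Fin n), ((Equiv.Perm.sign σ : ℤ) : A) * ∏ k, y k ^ l (σ k) := by
  rw [Matrix.det_apply']
  rfl

theorem Hm_det_eq (y : Fin n → A) (l : Fin n → ℕ) :
    (Hm y l).det = ∑ σ : Equiv.Perm (Fin n), ((Equiv.Perm.sign σ : ℤ) : A) *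
      ∏ k, hh y ((l k : ℤ) - rho n (σ k)) := by
  rw [← Matrix.det_transpose, Matrix.det_apply']
  rfl

end sym

section mv
open MvPolynomial
variable {n : ℕ}

theorem rho_inj : Function.Injective (rho n) := by
  intro a b h
  rw [rho_rev, rho_rev] at h
  exact Fin.rev_injective (Fin.ext h)

theorem prod_X_pow (l : Fin n → ℕ) :
    ∏ k, (X k : MvPolynomial (Fin n) ℤ) ^ l k = monomial (Finsupp.equivFunOnFinite.symm l) 1 := by
  rw [MvPolynomial.monomial_eq, Finsupp.prod_fintype]
  · simp
  · simp

theorem alt_rho_ne : (alt (X : Fin n → MvPolynomial (Fin n) ℤ) (rho n)).det ≠ 0 := by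
  intro h
  have h2 := congrArg (coeff (Finsupp.equivFunOnFinite.symm (rho n))) h
  rw [alt_det_eq, coeff_sum] at h2
  rw [Finset.sum_eq_single 1] at h2
  · simp [prod_X_pow] at h2
  · intro σ _ hσ
    rw [prod_X_pow (fun k => rho n (σ k)), ← map_intCast (C : ℤ →+* MvPolynomial (Fin n) ℤ),
      coeff_C_mul, coeff_monomial, if_neg, mul_zero]
    intro h3
    apply hσ
    ext k
    have := DFunLike.congr_fun h3 k
    simp at this
    simp [rho_inj this]
  · simp

theorem det_Hm_succ {A : Type*} [CommRing A] (y : Fin n → A) (l : Fin n → ℕ) :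
    (Hm y (fun i => l i + 1)).det = (∏ i, y i) * (Hm y l).det := by
  have key : (Hm (X : Fin n → MvPolynomial (Fin n) ℤ) (fun i => l i + 1)).det =
      (∏ i, X i) * (Hm X l).det := by
    apply mul_right_cancel₀ alt_rho_ne
    rw [det_Hm, det_alt_succ, mul_assoc, det_Hm]
  have h := congrArg (eval₂Hom (Int.castRingHom A) y) key
  rw [map_mul, RingHom.map_det, RingHom.map_det, map_prod] at h
  convert h using 2
  · congr 1; funext i j
    have := hh_map (eval₂Hom (Int.castRingHom A) y) X
    simp only [RingHom.mapMatrix_apply, Matrix.map_apply, Hm, this]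
    simp
  · simp
  · congr 1; funext i j
    have := hh_map (eval₂Hom (Int.castRingHom A) y) X
    simp only [RingHom.mapMatrix_apply, Matrix.map_apply, Hm, this]
    simp

theorem det_Hm_add {A : Type*} [CommRing A] (y : Fin n → A) (l : Fin n → ℕ) (m : ℕ) :
    (Hm y (fun i => l i + m)).det = (∏ i, y i) ^ m * (Hm y l).det := by
  induction m with
  | zero => simp
  | succ m ih => rw [show (fun i => l i + (m + 1)) = fun i => (l i + m) + 1 from rfl,
      det_Hm_succ, ih, pow_succ]; ring

theorem det_Hm_base {A : Type*} [CommRing A] (y : Fin (n + 1) → A) (s : ℕ) :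
    (Hm y (fun i => rho (n + 1) i + if i = 0 then s else 0)).det = hh y s := by
  rw [Matrix.det_of_isUpperTriangular]
  · rw [Fin.prod_univ_succ]
    simp [Hm, hh_zero]
  · intro i j hij
    apply hh_neg
    simp at hij
    have : i ≠ 0 := by rintro rfl; simp at hij
    simp only [rho, if_neg this]
    omega

/-- count matrices -/
def CM {n0 n : ℕ} (μ : Fin n0 → ℤ) (ν : Fin n → ℤ) : Set (Fin n0 → Fin n → ℕ) :=
  {m | (∀ a, ∑ b, (m a b : ℤ) = μ a) ∧ ∀ b, ∑ a, (m a b : ℤ) = ν b}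

/-- compositions -/
noncomputable def Sk (n : ℕ) (k : ℤ) : Finset (Fin n → ℕ) :=
  if k < 0 then ∅ else Finset.piAntidiag univ k.toNat

theorem mem_Sk {k : ℤ} {c : Fin n → ℕ} : c ∈ Sk n k ↔ ∑ b, (c b : ℤ) = k := by
  rw [← Nat.cast_sum]
  unfold Sk
  split_ifs with h
  · simp only [Finset.notMem_empty, false_iff]
    intro h2
    omega
  · simp only [Finset.mem_piAntidiag, mem_univ, implies_true, and_true]
    constructor
    · intro h1; rw [h1]; omega
    · intro h1; rw [← h1, Int.toNat_natCast]

theorem hh_eq {A : Type*} [CommRing A] (y : Fin n → A) (k : ℤ) :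
    hh y k = ∑ c ∈ Sk n k, ∏ b, y b ^ c b := by
  unfold hh Sk
  split_ifs with h
  · simp
  · rw [PowerSeries.coeff_prod]
    refine Finset.sum_bij' (fun c _ => (c : Fin n → ℕ)) (fun c _ => Finsupp.equivFunOnFinite.symm c)
      ?_ ?_ ?_ ?_ ?_
    · intro c hc
      simp [Finset.mem_finsuppAntidiag] at hc ⊢
      exact hc
    · intro c hc
      simp [Finset.mem_finsuppAntidiag] at hc ⊢
      exact hc
    · intro c _; ext; simp
    · intro c _; ext; simp
    · intro c _; simp [geo]

theorem coeff_prod_hh (μ : Fin n → ℤ) (d : Fin n →₀ ℕ) :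
    coeff d (∏ a, hh (X : Fin n → MvPolynomial (Fin n) ℤ) (μ a)) =
      Nat.card (CM μ (fun b => (d b : ℤ))) := by
  classical
  simp only [hh_eq, Finset.prod_univ_sum]
  rw [coeff_sum]
  have e1 : ∀ m : Fin n → Fin n → ℕ, coeff d (∏ a, ∏ b, (X b : MvPolynomial (Fin n) ℤ) ^ m a b) =
      if (∀ b, ∑ a, (m a b : ℤ) = d b) then 1 else 0 := by
    intro m
    rw [Finset.prod_comm]
    simp only [Finset.prod_pow_eq_pow_sum]
    rw [prod_X_pow (fun b => ∑ a, m a b), coeff_monomial]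
    congr 1
    rw [eq_iff_iff, DFunLike.ext_iff]
    apply forall_congr'
    intro b
    rw [← Nat.cast_sum, Nat.cast_inj]
    rfl
  simp only [e1]
  rw [← Finset.sum_filter, Finset.sum_const, nsmul_eq_mul, mul_one, Nat.cast_inj]
  have : CM μ (fun b => (d b : ℤ)) = ((Fintype.piFinset (fun a => Sk n (μ a))).filter
    (fun m => ∀ b, ∑ a, (m a b : ℤ) = d b) : Finset _) := by
    ext m
    simp [CM, mem_Sk]
  rw [this]
  exact (Nat.card_eq_finsetCard _).symm

theorem CM_neg {n0 : ℕ} (μ : Fin n0 → ℤ) (ν : Fin n → ℤ) (b : Fin n) (h : ν b < 0) :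
    CM μ ν = ∅ := by
  rw [Set.eq_empty_iff_forall_notMem]
  rintro m ⟨_, h2⟩
  have : 0 ≤ ∑ a, (m a b : ℤ) := Finset.sum_nonneg (fun _ _ => by positivity)
  have := h2 b
  omega

/-- shifted weight -/
def sft (l : Fin n → ℕ) (σ : Equiv.Perm (Fin n)) : Fin n → ℤ := fun a => (l a : ℤ) - rho n (σ a)

theorem norm_le (l : Fin n → ℕ) :
    ∑ σ : Equiv.Perm (Fin n), ∑ τ : Equiv.Perm (Fin n), (Equiv.Perm.sign σ : ℤ) *
      (Equiv.Perm.sign τ : ℤ) * (Nat.card (CM (sft l σ) (sft l τ)) : ℤ) ≤ 1 := by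
  classical
  have h := congrArg (coeff (Finsupp.equivFunOnFinite.symm l))
    (det_Hm (X : Fin n → MvPolynomial (Fin n) ℤ) l)
  have h1 : ∀ (P : MvPolynomial (Fin n) ℤ), coeff (Finsupp.equivFunOnFinite.symm l)
      (P * (alt X (rho n)).det) = ∑ τ : Equiv.Perm (Fin n), (Equiv.Perm.sign τ : ℤ) *
        (if (fun a => rho n (τ a)) ≤ l then coeff (Finsupp.equivFunOnFinite.symm
          (fun a => l a - rho n (τ a))) P else 0) := by
    intro P
    rw [alt_det_eq, mul_comm, Finset.sum_mul, coeff_sum]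
    apply Finset.sum_congr rfl
    intro τ _
    rw [prod_X_pow (fun k => rho n (τ k)), ← map_intCast (C : ℤ →+* MvPolynomial (Fin n) ℤ),
      mul_assoc, coeff_C_mul, coeff_monomial_mul']
    simp only [one_mul]
    congr 1
    by_cases hc : (fun a => rho n (τ a)) ≤ l
    · rw [if_pos hc, if_pos (by intro a; exact hc a)]
      congr 1
      ext a; simp
    · rw [if_neg hc, if_neg (by intro h; exact hc (fun a => h a))]
  rw [h1, Hm_det_eq] at h
  have h2 : ∀ τ : Equiv.Perm (Fin n), (if (fun a => rho n (τ a)) ≤ l then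
      coeff (Finsupp.equivFunOnFinite.symm (fun a => l a - rho n (τ a)))
      (∑ σ : Equiv.Perm (Fin n), ((Equiv.Perm.sign σ : ℤ) : MvPolynomial (Fin n) ℤ) *
      ∏ k, hh X ((l k : ℤ) - rho n (σ k))) else 0) =
      ∑ σ : Equiv.Perm (Fin n), (Equiv.Perm.sign σ : ℤ) * (Nat.card (CM (sft l σ) (sft l τ)) : ℤ) := by
    intro τ
    split_ifs with hc
    · rw [coeff_sum]
      apply Finset.sum_congr rfl
      intro σ _
      rw [← map_intCast (C : ℤ →+* MvPolynomial (Fin n) ℤ), coeff_C_mul,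
        coeff_prod_hh (fun k => (l k : ℤ) - rho n (σ k))]
      congr 5
      funext b
      have := hc b
      simp [sft] at this ⊢
      omega
    · symm
      apply Finset.sum_eq_zero
      intro σ _
      obtain ⟨b, hb⟩ : ∃ b, l b < rho n (τ b) := by
        by_contra hcon; push Not at hcon; exact hc (fun b => hcon b)
      rw [CM_neg _ _ b (by unfold sft; omega)]
      simp
  simp only [h2] at h
  have h3 : coeff (Finsupp.equivFunOnFinite.symm l) (alt (X : Fin n → MvPolynomial (Fin n) ℤ) l).det
      ≤ 1 := by
    by_cases hl : Function.Injective l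
    · rw [alt_det_eq, coeff_sum, Finset.sum_eq_single 1]
      · simp [prod_X_pow]
      · intro σ _ hσ
        rw [prod_X_pow (fun k => l (σ k)), ← map_intCast (C : ℤ →+* MvPolynomial (Fin n) ℤ),
          coeff_C_mul, coeff_monomial, if_neg, mul_zero]
        intro h3
        apply hσ
        ext k
        have := DFunLike.congr_fun h3 k
        simp at this
        simp [hl this]
      · simp
    · simp only [Function.Injective, not_forall] at hl
      obtain ⟨i, j, h4, h5⟩ := hl
      rw [Matrix.det_zero_of_row_eq h5]
      · simp
      · funext k; simp [alt, h4]
  rw [← h] at h3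
  refine le_trans (le_of_eq ?_) h3
  rw [Finset.sum_comm]
  apply Finset.sum_congr rfl
  intro τ _
  rw [Finset.mul_sum]
  apply Finset.sum_congr rfl
  intro σ _
  ring
end mv
end Hk

namespace Hk
open Module Finset

section cnt
variable {N n0 n : ℕ}

theorem U_exists (μ : Fin n → ℤ) (h0 : ∀ a, 0 ≤ μ a) (hs : ∑ a, μ a = N) :
    ∃ w0 : Fin N → Fin n, (∀ i, ¬ desc w0 i) ∧ content w0 = μ := by
  classical
  have hc : Fintype.card (Σ a, Fin (μ a).toNat) = Fintype.card (Fin N) := by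
    rw [Fintype.card_sigma, Fintype.card_fin]
    simp only [Fintype.card_fin]
    zify
    rw [← hs]
    apply Finset.sum_congr rfl
    intro a _
    rw [Int.toNat_of_nonneg (h0 a)]
  obtain ⟨e⟩ := Fintype.card_eq.1 hc
  let w : Fin N → Fin n := fun i => (e.symm i).1
  have hw : content w = μ := by
    funext a
    unfold content
    rw [← Int.toNat_of_nonneg (h0 a), Nat.cast_inj, ← Fintype.card_subtype]
    conv_rhs => rw [← Fintype.card_fin (μ a).toNat]
    apply Fintype.card_congr
    exact (Equiv.subtypeEquiv e.symm (fun i => Iff.rfl)).trans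
      (Equiv.sigmaSubtype a)
  obtain ⟨w0, h1⟩ := exists_minimal_word (fun w => content w = μ)
    (fun w i h => (content_sw w i).trans h) ⟨w, hw⟩
  exact ⟨w0.1, h1, w0.2⟩

theorem content_nonneg (w : Fin N → Fin n) (a) : 0 ≤ content w a := by
  unfold content; positivity

theorem content_sum (w : Fin N → Fin n) : ∑ a, content w a = N := by
  unfold content
  rw [← Nat.cast_sum, Nat.cast_inj, ← Finset.card_eq_sum_card_fiberwise (s := univ)]
  · simp
  · intro x _; simp

/-- joint content -/
def cnt (w0 : Fin N → Fin n0) (w : Fin N → Fin n) : Fin n0 → Fin n → ℕ :=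
  fun a b => (univ.filter (fun i => w0 i = a ∧ w i = b)).card

theorem cnt_row (w0 : Fin N → Fin n0) (w : Fin N → Fin n) (a) :
    ∑ b, (cnt w0 w a b : ℤ) = content w0 a := by
  unfold content cnt
  rw [← Nat.cast_sum, Nat.cast_inj, Finset.card_eq_sum_card_fiberwise (f := w) (t := univ)]
  · simp only [Finset.filter_filter]
  · intro x _; simp

theorem cnt_col (w0 : Fin N → Fin n0) (w : Fin N → Fin n) (b) :
    ∑ a, (cnt w0 w a b : ℤ) = content w b := by
  unfold content cnt
  rw [← Nat.cast_sum, Nat.cast_inj, Finset.card_eq_sum_card_fiberwise (f := w0) (t := univ)]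
  · simp only [Finset.filter_filter, and_comm]
  · intro x _; simp

/-- combined word -/
def zz (w0 : Fin N → Fin n0) (w : Fin N → Fin n) : Fin N → Fin (n0 * n) :=
  fun i => finProdFinEquiv (w0 i, w i)

theorem content_zz (w0 : Fin N → Fin n0) (w : Fin N → Fin n) (a b) :
    content (zz w0 w) (finProdFinEquiv (a, b)) = cnt w0 w a b := by
  unfold content cnt zz
  simp only [EmbeddingLike.apply_eq_iff_eq, Prod.mk.injEq]

theorem zz_content_eq (w0 : Fin N → Fin n0) (w w' : Fin N → Fin n) (h : cnt w0 w = cnt w0 w') :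
    content (zz w0 w) = content (zz w0 w') := by
  funext c
  obtain ⟨⟨a, b⟩, rfl⟩ := finProdFinEquiv.surjective c
  rw [content_zz, content_zz, h]

theorem ltr_zz (w0 : Fin N → Fin n0) (w : Fin N → Fin n) (i : ℕ) :
    ltr (zz w0 w) i = ltr w i + n * ltr w0 i := by
  unfold ltr zz
  split_ifs with h
  · simp [finProdFinEquiv]
  · simp

theorem zz_no_desc (w0 : Fin N → Fin n0) (w : Fin N → Fin n) (h0 : ∀ i, ¬ desc w0 i)
    (h : ∀ i, ltr w0 i = ltr w0 (i + 1) → ¬ desc w i) (i : ℕ) : ¬ desc (zz w0 w) i := by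
  rintro ⟨h1, h2⟩
  rw [ltr_zz, ltr_zz] at h2
  rcases lt_trichotomy (ltr w0 i) (ltr w0 (i + 1)) with h3 | h3 | h3
  · have h4 : ltr w i < n := by
      unfold ltr; rw [dif_pos (by omega)]; exact Fin.isLt _
    have : n * (ltr w0 i + 1) ≤ n * ltr w0 (i + 1) := Nat.mul_le_mul_left _ h3
    rw [mul_add] at this
    omega
  · apply h i h3
    rw [h3] at h2
    exact ⟨h1, by omega⟩
  · exact h0 i ⟨h1, h3⟩

theorem cnt_sw (w0 : Fin N → Fin n0) (w : Fin N → Fin n) (i : ℕ) (h : ltr w0 i = ltr w0 (i + 1)) :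
    cnt w0 (sw w i) = cnt w0 w := by
  have h1 := sw_eq_self w0 i h
  unfold sw at h1 ⊢
  split_ifs with hi
  · rw [dif_pos hi] at h1
    funext a b
    unfold cnt
    conv_lhs => rw [← h1]
    apply Finset.card_bij (fun j _ => Equiv.swap (⟨i, by omega⟩ : Fin N) ⟨i + 1, hi⟩ j)
    · intro j hj; simpa using hj
    · intro j _ k _ h; exact (Equiv.injective _) h
    · intro j hj; exact ⟨Equiv.swap (⟨i, by omega⟩ : Fin N) ⟨i + 1, hi⟩ j, by simpa using hj, by simp⟩
  · rfl

variable {K : Type*} [Field K] {q : K} (p : (Fin N → Fin n) → Prop) (hp : ∀ w i, p w → p (sw w i))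

theorem inv_iff (w0 : Fin N → Fin n0) (f : UM p hp q) :
    f ∈ inv q N w0 (UM p hp q) ↔ ∀ i, i + 1 < N → ltr w0 i = ltr w0 (i + 1) →
      ∀ w, Rep.e _ f (swp p hp w i) = Rep.e _ f w := by
  have e1 : f ∈ inv q N w0 (UM p hp q) ↔ ∀ i, i + 1 < N → ltr w0 i = ltr w0 (i + 1) →
    HA.gen q N i • f = q • f := Iff.rfl
  rw [e1]
  refine forall_congr' fun i => forall_congr' fun hi => forall_congr' fun _ => ?_
  rw [← (Rep.e _).injective.eq_iff, HM.gen_smul, map_smul, funext_iff]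
  simp only [uT_apply, if_pos hi, Pi.smul_apply, smul_eq_mul]
  constructor
  · intro h w
    rcases lt_trichotomy (ltr w.1 i) (ltr w.1 (i + 1)) with h3 | h3 | h3
    · have := h (swp p hp w i)
      have e1 : ltr (swp p hp w i).1 i = ltr w.1 (i + 1) := ltr_sw_left _ _ hi
      have e2 : ltr (swp p hp w i).1 (i + 1) = ltr w.1 i := ltr_sw_right _ _ hi
      rw [e1, e2, if_neg (by omega), if_neg (by omega), swp_swp] at this
      linear_combination -this
    · rw [swp_self _ _ _ _ h3]
    · have := h w
      rw [if_neg (by omega), if_neg (by omega)] at this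
      linear_combination this
  · intro h w
    split_ifs
    · rfl
    · rw [h]
    · rw [h]; ring

theorem inv_const (w0 : Fin N → Fin n0) (h0 : ∀ i, ¬ desc w0 i) (f : UM p hp q)
    (hf : f ∈ inv q N w0 (UM p hp q)) (w w' : {w // p w}) (h : cnt w0 w.1 = cnt w0 w'.1) :
    Rep.e _ f w = Rep.e _ f w' := by
  rw [inv_iff] at hf
  have key : ∀ m, ∀ w : {w // p w}, ms w.1 = m → ∃ u : {w // p w}, Rep.e _ f w = Rep.e _ f u ∧
      cnt w0 u.1 = cnt w0 w.1 ∧ ∀ i, ltr w0 i = ltr w0 (i + 1) → ¬ desc u.1 i := by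
    intro m
    induction m using Nat.strong_induction_on with
    | _ m ih =>
    intro w hw
    by_cases hd : ∃ i, ltr w0 i = ltr w0 (i + 1) ∧ desc w.1 i
    · obtain ⟨i, h1, h2⟩ := hd
      obtain ⟨u, g1, g2, g3⟩ := ih _ (hw ▸ ms_sw _ _ h2) (swp p hp w i) rfl
      refine ⟨u, ?_, ?_, g3⟩
      · rw [← g1, hf i h2.1 h1]
      · rw [g2]; exact cnt_sw _ _ _ h1
    · push Not at hd
      exact ⟨w, rfl, rfl, hd⟩
  obtain ⟨u, g1, g2, g3⟩ := key _ w rfl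
  obtain ⟨u', g1', g2', g3'⟩ := key _ w' rfl
  rw [g1, g1']
  have : zz w0 u.1 = zz w0 u'.1 := content_unique _ _ (zz_no_desc _ _ h0 g3) (zz_no_desc _ _ h0 g3')
    (zz_content_eq _ _ _ (by rw [g2, g2', h]))
  have huu : u = u' := by
    apply Subtype.ext
    funext i
    have := congrFun this i
    simp [zz] at this
    exact this
  rw [huu]

theorem finrank_inv (w0 : Fin N → Fin n0) (h0 : ∀ i, ¬ desc w0 i) :
    finrank K (inv q N w0 (UM p hp q)) = Nat.card {m // ∃ w, p w ∧ cnt w0 w = m} := by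
  classical
  have hfin : Finite {m // ∃ w, p w ∧ cnt w0 w = m} := by
    apply Finite.of_surjective (fun w : {w // p w} => (⟨cnt w0 w.1, w.1, w.2, rfl⟩ :
      {m // ∃ w, p w ∧ cnt w0 w = m}))
    rintro ⟨m, w, hw, rfl⟩
    exact ⟨⟨w, hw⟩, rfl⟩
  have := Fintype.ofFinite {m // ∃ w, p w ∧ cnt w0 w = m}
  rw [Nat.card_eq_fintype_card, ← Module.finrank_fintype_fun_eq_card K]
  let F : ({m // ∃ w, p w ∧ cnt w0 w = m} → K) →ₗ[K] inv q N w0 (UM p hp q) :=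
    { toFun := fun g => ⟨(Rep.e _).symm (fun w => g ⟨cnt w0 w.1, w.1, w.2, rfl⟩), by
        rw [inv_iff]
        intro i hi h w
        rw [LinearEquiv.apply_symm_apply]
        congr 2
        exact cnt_sw _ _ _ h⟩
      map_add' := fun f g => rfl
      map_smul' := fun c f => rfl }
  symm
  refine LinearEquiv.finrank_eq (LinearEquiv.ofBijective F ⟨?_, ?_⟩)
  · rw [← LinearMap.ker_eq_bot, LinearMap.ker_eq_bot']
    intro g hg
    funext ⟨m, w, hw, hm⟩
    subst hm
    have h1 := congrArg (Rep.e _) (congrArg Subtype.val hg)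
    exact congrFun h1 ⟨w, hw⟩
  · rintro ⟨f, hf⟩
    refine ⟨fun m => Rep.e _ f ⟨m.2.choose, m.2.choose_spec.1⟩, ?_⟩
    apply Subtype.ext
    apply (Rep.e _).injective
    funext w
    have hex : ∃ w', p w' ∧ cnt w0 w' = cnt w0 w.1 := ⟨w.1, w.2, rfl⟩
    exact inv_const p hp w0 h0 f hf ⟨hex.choose, hex.choose_spec.1⟩ w hex.choose_spec.2

theorem content_hp (μ : Fin n → ℤ) (w : Fin N → Fin n) (i : ℕ) (h : content w = μ) :
  content (sw w i) = μ := (content_sw w i).trans h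

/-- weight module -/
abbrev U (q : K) (N : ℕ) (μ : Fin n → ℤ) := UM (fun w : Fin N → Fin n => content w = μ)
  (content_hp μ) q

theorem U_pair {X : Type*} [AddCommGroup X] [Module K X] [Module (HA q N) X]
    [IsScalarTower K (HA q N) X] (w0 : Fin N → Fin n) (h0 : ∀ i, ¬ desc w0 i) :
    pair K (HA q N) (U q N (content w0)) X = finrank K (inv q N w0 X) :=
  pair_UM (fun w : Fin N → Fin n => content w = content w0) (content_hp _) ⟨w0, rfl⟩ (fun w hw hd => content_unique _ _ hd h0 hw)

theorem U_fun_zero (μ : Fin n → ℤ) (h : ¬ ((∀ a, 0 ≤ μ a) ∧ ∑ a, μ a = N)) :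
    Subsingleton (U q N μ) := by
  have : IsEmpty {w : Fin N → Fin n // content w = μ} := ⟨by
    rintro ⟨w, rfl⟩
    exact h ⟨content_nonneg w, content_sum w⟩⟩
  exact (Rep.e (HA.lift (uT_isHF (fun w : Fin N → Fin n => content w = μ)
    (content_hp μ) q))).toEquiv.subsingleton

theorem U_zero {X : Type*} [AddCommGroup X] [Module K X] [Module (HA q N) X]
    [IsScalarTower K (HA q N) X] (μ : Fin n → ℤ) (h : ¬ ((∀ a, 0 ≤ μ a) ∧ ∑ a, μ a = N)) :
    pair K (HA q N) (U q N μ) X = 0 := by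
  have := U_fun_zero (q := q) μ h
  unfold pair
  have : Subsingleton (U q N μ →ₗ[HA q N] X) := ⟨fun f g => by
    ext x; rw [Subsingleton.elim x 0, map_zero, map_zero]⟩
  exact finrank_zero_of_subsingleton

theorem CM_sum (μ : Fin n0 → ℤ) (ν : Fin n → ℤ) (m) (hm : m ∈ CM μ ν) :
    (∀ a, 0 ≤ μ a) ∧ ∑ a, μ a = ∑ b, ν b := by
  obtain ⟨h1, h2⟩ := hm
  constructor
  · intro a; rw [← h1]; positivity
  · simp only [← h1, ← h2]; rw [Finset.sum_comm]

theorem exists_cnt (w0 : Fin N → Fin n0) (h0 : ∀ i, ¬ desc w0 i) (m : Fin n0 → Fin n → ℕ)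
    (hm : ∀ a, ∑ b, (m a b : ℤ) = content w0 a) : ∃ w : Fin N → Fin n, cnt w0 w = m := by
  obtain ⟨z, hz1, hz2⟩ := U_exists (N := N) (n := n0 * n)
    (fun c => (m (finProdFinEquiv.symm c).1 (finProdFinEquiv.symm c).2 : ℤ)) (fun _ => by positivity)
    (by
      rw [← finProdFinEquiv.sum_comp, Fintype.sum_prod_type]
      simp only [Equiv.symm_apply_apply, hm]
      exact content_sum w0)
  let u0 : Fin N → Fin n0 := fun i => (finProdFinEquiv.symm (z i)).1
  let u : Fin N → Fin n := fun i => (finProdFinEquiv.symm (z i)).2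
  have hzu : zz u0 u = z := by
    funext i; simp only [zz, u0, u, Prod.mk.eta, Equiv.apply_symm_apply]
  have hc : cnt u0 u = m := by
    funext a b
    have := content_zz u0 u a b
    rw [hzu, hz2] at this
    simpa using this.symm
  have : u0 = w0 := by
    apply content_unique _ _ _ h0
    · funext a
      rw [← cnt_row u0 u, hc, hm]
    · rintro i ⟨hi, hd⟩
      have hmono := ltr_mono_of_no_desc z hz1
      apply hz1 i
      refine ⟨hi, ?_⟩
      rw [← hzu, ltr_zz, ltr_zz]
      have h4 : ltr u (i + 1) < n := by
        unfold ltr; rw [dif_pos (by omega)]; exact Fin.isLt _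
      have : n * (ltr u0 (i + 1) + 1) ≤ n * ltr u0 i := Nat.mul_le_mul_left _ hd
      rw [mul_add] at this
      omega
  exact ⟨u, this ▸ hc⟩

theorem pair_U_U (μ : Fin n0 → ℤ) (ν : Fin n → ℤ) (hν : ∑ b, ν b = N) :
    pair K (HA q N) (U q N μ) (U q N ν) = Nat.card (CM μ ν) := by
  by_cases h : (∀ a, 0 ≤ μ a) ∧ ∑ a, μ a = N
  · obtain ⟨w0, h0, rfl⟩ := U_exists μ h.1 h.2
    rw [U_pair w0 h0, finrank_inv _ _ w0 h0]
    apply Nat.card_congr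
    apply Equiv.subtypeEquivRight
    intro m
    constructor
    · rintro ⟨w, rfl, rfl⟩
      exact ⟨cnt_row w0 w, cnt_col w0 w⟩
    · rintro ⟨h1, h2⟩
      obtain ⟨w, rfl⟩ := exists_cnt w0 h0 m h1
      exact ⟨w, by funext b; rw [← h2, cnt_col], rfl⟩
  · rw [U_zero μ h]
    have : CM μ ν = ∅ := by
      rw [Set.eq_empty_iff_forall_notMem]
      intro m hm
      have := CM_sum μ ν m hm
      exact h ⟨this.1, this.2.trans hν⟩
    rw [this]; simp


/-- direct sum of all weight modules -/
abbrev UA (q : K) (N n : ℕ) := ∀ ν : Sk n N, U q N (fun b => (ν.1 b : ℤ))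

theorem sum_CM (μ : Fin n0 → ℤ) (hμ : ∑ a, μ a = N) :
    ∑ ν : Sk n N, Nat.card (CM μ (fun b => (ν.1 b : ℤ))) = ∏ a, (Sk n (μ a)).card := by
  classical
  have hCM : ∀ ν : Fin n → ℤ, CM μ ν = ((Fintype.piFinset (fun a => Sk n (μ a))).filter
    (fun m => ∀ b, ∑ a, (m a b : ℤ) = ν b) : Finset _) := by
    intro ν
    ext m
    simp [CM, mem_Sk]
  rw [← Fintype.card_piFinset, Finset.card_eq_sum_card_fiberwise (t := Sk n N)
    (f := fun m b => ∑ a, m a b), ← Finset.sum_coe_sort (Sk n N)]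
  · apply Finset.sum_congr rfl
    rintro ⟨ν, hν⟩ _
    rw [hCM]
    refine (Nat.card_eq_finsetCard _).trans ?_
    congr 1
    ext m
    simp only [Finset.mem_filter, funext_iff, and_congr_right_iff]
    intro _
    apply forall_congr'
    intro b
    rw [← Nat.cast_sum, Nat.cast_inj]
  · intro m hm
    simp only [Finset.mem_coe, Fintype.mem_piFinset, mem_Sk] at hm ⊢
    push_cast
    rw [Finset.sum_comm]
    simp only [hm, hμ]

theorem pair_U_UA (μ : Fin n0 → ℤ) (hμ : ∑ a, μ a = N) :
    pair K (HA q N) (U q N μ) (UA q N n) = ∏ a, (Sk n (μ a)).card := by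
  rw [pair_pi_right, ← sum_CM μ hμ]
  apply Finset.sum_congr rfl
  intro ν _
  rw [pair_U_U]
  exact mem_Sk.1 ν.2

theorem card_Sk_hh (k : ℤ) : ((Sk n k).card : ℤ) = hh (fun _ : Fin n => (1 : ℤ)) k := by
  rw [hh_eq]; simp

theorem pair_UA_UA : pair K (HA q N) (UA q N n) (UA q N n) = (n ^ 2 + N - 1).choose N := by
  classical
  rw [pair_pi_left]
  have : ∀ μ : Sk n N, pair K (HA q N) (U q N (fun b => (μ.1 b : ℤ))) (UA q N n) =
      ∏ a, (Sk n (μ.1 a)).card := fun μ => pair_U_UA _ (mem_Sk.1 μ.2)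
  rw [Finset.sum_congr rfl (fun μ _ => this μ), Finset.sum_coe_sort (Sk n N)
    (fun μ => ∏ a, (Sk n (μ a)).card)]
  have h2 : (n ^ 2 + N - 1).choose N = (Sk (n * n) N).card := by
    unfold Sk
    rw [if_neg (by omega), Int.toNat_natCast]
    have h3 := Finset.card_finsuppAntidiag_nat_eq_choose (ι := Fin (n * n)) (s := univ) N
    simp only [Finset.card_univ, Fintype.card_fin] at h3
    rw [pow_two, ← h3]
    apply Finset.card_bij (fun (c : Fin (n * n) →₀ ℕ) _ => (c : Fin (n * n) → ℕ))
    · intro c hc; simpa [Finset.mem_finsuppAntidiag] using hc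
    · intro c _ d _ h; exact DFunLike.coe_injective h
    · intro c hc
      exact ⟨Finsupp.equivFunOnFinite.symm c, by simpa [Finset.mem_finsuppAntidiag] using hc, by
        ext; simp⟩
  rw [h2, Finset.card_eq_sum_card_fiberwise (t := Sk n N)
    (f := fun m a => ∑ b, m (finProdFinEquiv (a, b)))]
  · apply Finset.sum_congr rfl
    intro μ hμ
    rw [← Fintype.card_piFinset]
    apply Finset.card_bij (fun m _ c => m (finProdFinEquiv.symm c).1 (finProdFinEquiv.symm c).2)
    · intro m hm
      simp only [Fintype.mem_piFinset, mem_Sk, Finset.mem_filter] at hm hμ ⊢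
      constructor
      · rw [← finProdFinEquiv.sum_comp, Fintype.sum_prod_type]
        simp only [Equiv.symm_apply_apply, hm, hμ]
      · funext a
        simp only [Equiv.symm_apply_apply]
        exact_mod_cast hm a
    · intro m _ m' _ h
      funext a b
      have := congrFun h (finProdFinEquiv (a, b))
      simpa using this
    · intro m hm
      refine ⟨fun a b => m (finProdFinEquiv (a, b)), ?_, ?_⟩
      · simp only [Fintype.mem_piFinset, mem_Sk, Finset.mem_filter] at hm ⊢
        intro a
        rw [← hm.2, Nat.cast_sum]
      · funext c
        simp only [Prod.mk.eta, Equiv.apply_symm_apply]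
  · intro m hm
    simp only [Finset.mem_coe, mem_Sk] at hm ⊢
    rw [← finProdFinEquiv.sum_comp, Fintype.sum_prod_type] at hm
    push_cast
    exact hm
end cnt
end Hk

namespace Hk
open Module Finset
universe u

section fl
variable {K : Type u} [Field K] {q : K} {N n : ℕ}

theorem sign_sum (c : Equiv.Perm (Fin n) → ℤ) :
    ∑ σ : Equiv.Perm (Fin n), (Equiv.Perm.sign σ : ℤ) * c σ =
      ∑ σ : {σ : Equiv.Perm (Fin n) // Equiv.Perm.sign σ = 1}, c σ.1 -
      ∑ σ : {σ : Equiv.Perm (Fin n) // ¬ Equiv.Perm.sign σ = 1}, c σ.1 := by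
  rw [← Fintype.sum_subtype_add_sum_subtype (fun σ : Equiv.Perm (Fin n) => Equiv.Perm.sign σ = 1),
    sub_eq_add_neg, ← Finset.sum_neg_distrib]
  congr 1
  · apply Finset.sum_congr rfl; rintro ⟨σ, h⟩ _; simp [h]
  · apply Finset.sum_congr rfl
    rintro ⟨σ, h⟩ _
    have : Equiv.Perm.sign σ = -1 := (Int.units_eq_one_or _).resolve_left h
    simp [this]

/-- alternating pairing -/
noncomputable def Dl (q : K) (N : ℕ) (l : Fin n → ℕ) (M : Type u) [AddCommGroup M] [Module K M]
    [Module (HA q N) M] [IsScalarTower K (HA q N) M] : ℤ :=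
  ∑ σ : Equiv.Perm (Fin n), (Equiv.Perm.sign σ : ℤ) * (pair K (HA q N) (U q N (sft l σ)) M : ℤ)

theorem fl_main [IsSemisimpleRing (HA q N)] (l : Fin n → ℕ)
    (hl : ∀ σ, ∑ a, sft l σ a = N) :
    (∀ (M : Type u) [AddCommGroup M] [Module K M] [Module (HA q N) M]
      [IsScalarTower K (HA q N) M] [Module.Finite K M], Dl q N l M = 0) ∧
      ∑ σ : Equiv.Perm (Fin n), (Equiv.Perm.sign σ : ℤ) * (finrank K (U q N (sft l σ)) : ℤ) = 0 ∨
    ∃ (S : Type u) (_ : AddCommGroup S) (_ : Module K S) (_ : Module (HA q N) S)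
      (_ : IsScalarTower K (HA q N) S) (_ : Module.Finite K S) (ε : ℤ), (ε = 1 ∨ ε = -1) ∧
      pair K (HA q N) S S = 1 ∧
      (∀ (M : Type u) [AddCommGroup M] [Module K M] [Module (HA q N) M]
      [IsScalarTower K (HA q N) M] [Module.Finite K M], Dl q N l M = ε * pair K (HA q N) S M) ∧
      ∑ σ : Equiv.Perm (Fin n), (Equiv.Perm.sign σ : ℤ) * (finrank K (U q N (sft l σ)) : ℤ) =
        ε * finrank K S := by
  let X := ∀ σ : {σ : Equiv.Perm (Fin n) // Equiv.Perm.sign σ = 1}, U q N (sft l σ.1)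
  let Y := ∀ σ : {σ : Equiv.Perm (Fin n) // ¬ Equiv.Perm.sign σ = 1}, U q N (sft l σ.1)
  have hX : ∀ (M : Type u) [AddCommGroup M] [Module K M] [Module (HA q N) M]
      [IsScalarTower K (HA q N) M] [Module.Finite K M], Dl q N l M =
      (pair K (HA q N) X M : ℤ) - pair K (HA q N) Y M := by
    intro M _ _ _ _ _
    unfold Dl
    rw [sign_sum, pair_pi_left, pair_pi_left]
    push_cast
    rfl
  have hd : ∑ σ : Equiv.Perm (Fin n), (Equiv.Perm.sign σ : ℤ) * (finrank K (U q N (sft l σ)) : ℤ) =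
      (finrank K X : ℤ) - finrank K Y := by
    rw [sign_sum, Module.finrank_pi_fintype, Module.finrank_pi_fintype]
    push_cast
    rfl
  have hU : ∀ σ : Equiv.Perm (Fin n), (pair K (HA q N) (U q N (sft l σ)) X : ℤ) -
      pair K (HA q N) (U q N (sft l σ)) Y = ∑ τ : Equiv.Perm (Fin n), (Equiv.Perm.sign τ : ℤ) *
        (Nat.card (CM (sft l σ) (sft l τ)) : ℤ) := by
    intro σ
    rw [sign_sum, pair_pi_right, pair_pi_right]
    simp only [pair_U_U _ _ (hl _)]
    push_cast
    rfl
  have hn : (Dl q N l X : ℤ) - Dl q N l Y ≤ 1 := by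
    refine le_trans (le_of_eq ?_) (norm_le l)
    unfold Dl
    rw [← Finset.sum_sub_distrib]
    apply Finset.sum_congr rfl
    intro σ _
    rw [← mul_sub, hU, Finset.mul_sum]
    apply Finset.sum_congr rfl
    intro τ _
    ring
  rw [hX, hX] at hn
  rcases norm_arg (K := K) (HA q N) (X := X) (Y := Y) (by omega) with ⟨⟨e⟩⟩ |
    ⟨S, i1, i2, i3, i4, i5, hS, ⟨⟨e⟩⟩ | ⟨⟨e⟩⟩⟩
  · left
    refine ⟨?_, ?_⟩
    · intro M _ _ _ _ _
      rw [hX, pair_congr_left (K := K) (HA q N) (X := X) (Y := Y) (Z := M) e, sub_self]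
    · rw [hd, finrank_congr (K := K) (HA q N) (X := X) (Y := Y) e, sub_self]
  · right
    refine ⟨S, i1, i2, i3, i4, i5, 1, Or.inl rfl, hS, ?_, ?_⟩
    · intro M _ _ _ _ _
      rw [hX, pair_congr_left (K := K) (HA q N) (X := X) (Y := (S × Y)) (Z := M) e, pair_prod_left]
      push_cast; ring
    · rw [hd, finrank_congr (K := K) (HA q N) (X := X) (Y := (S × Y)) e, Module.finrank_prod]
      push_cast; ring
  · right
    refine ⟨S, i1, i2, i3, i4, i5, -1, Or.inr rfl, hS, ?_, ?_⟩
    · intro M _ _ _ _ _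
      rw [hX, pair_congr_left (K := K) (HA q N) (X := Y) (Y := (S × X)) (Z := M) e, pair_prod_left]
      push_cast; ring
    · rw [hd, finrank_congr (K := K) (HA q N) (X := Y) (Y := (S × X)) e, Module.finrank_prod]
      push_cast; ring

theorem sft_sum (l : Fin n → ℕ) (hl : ∑ a, (l a : ℤ) = N + ∑ a, (rho n a : ℤ)) (σ) :
    ∑ a, sft l σ a = N := by
  unfold sft
  rw [Finset.sum_sub_distrib, hl, Equiv.sum_comp σ (fun a => (rho n a : ℤ))]
  ring

theorem pair_U_one (M : Type u) [AddCommGroup M] [Module K M] [Module (HA q N) M]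
    [IsScalarTower K (HA q N) M] :
    pair K (HA q N) (U q N (fun _ : Fin N => (1 : ℤ))) M = finrank K M := by
  have hc : content (id : Fin N → Fin N) = fun _ => 1 := by
    funext a; unfold content; simp [Finset.filter_eq']
  have h0 : ∀ i, ¬ desc (id : Fin N → Fin N) i := no_desc_of_mono _ monotone_id
  rw [← hc, U_pair _ h0]
  have : inv q N (id : Fin N → Fin N) M = ⊤ := by
    rw [eq_top_iff]
    intro v _ i hi h
    simp [ltr, hi, show i < N by omega] at h
  rw [this, finrank_top]

theorem pair_U_congr {μ ν : Fin n → ℤ} (h : μ = ν) (M : Type u) [AddCommGroup M] [Module K M]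
    [Module (HA q N) M] [IsScalarTower K (HA q N) M] :
    pair K (HA q N) (U q N μ) M = pair K (HA q N) (U q N ν) M := by subst h; rfl

theorem exists_Dl (M : Type u) [AddCommGroup M] [Module K M] [Module (HA q N) M]
    [IsScalarTower K (HA q N) M] (hM : finrank K M ≠ 0) :
    ∃ l : Fin N → ℕ, ∑ a, (l a : ℤ) = N + ∑ a, (rho N a : ℤ) ∧ Dl q N l M ≠ 0 := by
  classical
  let s := (Sk N N).filter (fun μ => pair K (HA q N) (U q N (fun a => (μ a : ℤ))) M ≠ 0)
  have hs : s.Nonempty := by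
    refine ⟨fun _ => 1, ?_⟩
    simp only [s, Finset.mem_filter, mem_Sk]
    refine ⟨by simp, ?_⟩
    have := pair_U_one (q := q) (N := N) M
    push_cast
    rw [this]; exact hM
  obtain ⟨μ, hμ, hmax⟩ := Finset.exists_max_image s (fun μ => ∑ a, rho N a * μ a) hs
  simp only [s, Finset.mem_filter, mem_Sk] at hμ hmax
  have hl : ∑ a, ((μ a + rho N a : ℕ) : ℤ) = N + ∑ a, (rho N a : ℤ) := by
    push_cast; rw [Finset.sum_add_distrib, hμ.1]
  refine ⟨fun a => μ a + rho N a, hl, ?_⟩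
  unfold Dl
  rw [Finset.sum_eq_single 1]
  · have : sft (fun a => μ a + rho N a) 1 = fun a => (μ a : ℤ) := by
      funext a; simp [sft]
    rw [pair_U_congr this]
    simpa using hμ.2
  · intro σ _ hσ
    by_cases h : (∀ a, 0 ≤ sft (fun a => μ a + rho N a) σ a) ∧
      ∑ a, sft (fun a => μ a + rho N a) σ a = N
    · by_contra hne
      obtain ⟨h1, h2⟩ := h
      have e : (fun a => ((sft (fun a => μ a + rho N a) σ a).toNat : ℤ)) =
        sft (fun a => μ a + rho N a) σ := funext fun a => Int.toNat_of_nonneg (h1 a)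
      have h3 := hmax (fun a => (sft (fun a => μ a + rho N a) σ a).toNat) ⟨by
        rw [← h2]; exact Finset.sum_congr rfl (fun a _ => congrFun e a), by
        rw [pair_U_congr e]; intro h; rw [h] at hne; simp at hne⟩
      zify at h3
      have e2 : ∑ a, (rho N a : ℤ) * ((sft (fun a => μ a + rho N a) σ a).toNat : ℤ) =
        ∑ a, (rho N a : ℤ) * sft (fun a => μ a + rho N a) σ a :=
        Finset.sum_congr rfl (fun a _ => congrArg _ (congrFun e a))
      rw [e2] at h3
      have e3 : 0 < ∑ a, ((rho N a : ℤ) - rho N (σ a)) ^ 2 := by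
        obtain ⟨a, ha⟩ : ∃ a, σ a ≠ a := by
          by_contra hcon; push Not at hcon; exact hσ (Equiv.ext hcon)
        apply Finset.sum_pos' (fun _ _ => by positivity)
        refine ⟨a, mem_univ _, ?_⟩
        have : (rho N a : ℤ) - rho N (σ a) ≠ 0 := by
          intro h
          apply ha
          apply rho_inj
          omega
        positivity
      have e4 : ∑ a, (rho N (σ a) : ℤ) ^ 2 = ∑ a, (rho N a : ℤ) ^ 2 :=
        Equiv.sum_comp σ (fun a => (rho N a : ℤ) ^ 2)
      have e5 : ∑ a, ((rho N a : ℤ) - rho N (σ a)) ^ 2 = ∑ a, (rho N a : ℤ) ^ 2 -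
          2 * ∑ a, (rho N a : ℤ) * rho N (σ a) + ∑ a, (rho N (σ a) : ℤ) ^ 2 := by
        rw [Finset.mul_sum, ← Finset.sum_sub_distrib, ← Finset.sum_add_distrib]
        exact Finset.sum_congr rfl (fun a _ => by ring)
      have e6 : ∑ a, (rho N a : ℤ) * sft (fun a => μ a + rho N a) σ a =
          ∑ a, (rho N a : ℤ) * μ a + ∑ a, (rho N a : ℤ) ^ 2 - ∑ a, (rho N a : ℤ) * rho N (σ a) := by
        rw [← Finset.sum_add_distrib, ← Finset.sum_sub_distrib]
        exact Finset.sum_congr rfl (fun a _ => by simp only [sft]; push_cast; ring)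
      linarith
    · rw [U_zero _ h]; simp
  · simp

theorem F3 [IsSemisimpleRing (HA q N)] (X Y : Type u)
    [AddCommGroup X] [Module K X] [Module (HA q N) X] [IsScalarTower K (HA q N) X]
    [AddCommGroup Y] [Module K Y] [Module (HA q N) Y] [IsScalarTower K (HA q N) Y]
    [Module.Finite K X] [Module.Finite K Y]
    (h : ∀ μ : Fin N → ℤ, (∀ a, 0 ≤ μ a) → ∑ a, μ a = N →
      pair K (HA q N) (U q N μ) X = pair K (HA q N) (U q N μ) Y) :
    Nonempty (X ≃ₗ[HA q N] Y) := by
  obtain ⟨X', Y', Z, _, _, _, _, _, _, _, _, _, _, _, _, _, _, _, ⟨a⟩, ⟨b⟩, hp⟩ :=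
    cancel (K := K) (HA q N) _ X Y rfl
  have h1 : ∀ μ : Fin N → ℤ, pair K (HA q N) (U q N μ) X' = pair K (HA q N) (U q N μ) Y' := by
    intro μ
    by_cases hc : (∀ a, 0 ≤ μ a) ∧ ∑ a, μ a = N
    · have := h μ hc.1 hc.2
      rw [pair_congr_right (K := K) (HA q N) (X := X) (Y := X' × Z) a,
        pair_congr_right (K := K) (HA q N) (X := Y) (Y := Y' × Z) b, pair_prod_right, pair_prod_right]
        at this
      omega
    · rw [U_zero _ hc, U_zero _ hc]
  have h2 : finrank K X' = 0 := by
    by_contra hne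
    obtain ⟨l, hl, hD⟩ := exists_Dl (q := q) (N := N) X' hne
    have hD2 : Dl q N l X' = Dl q N l Y' := by
      unfold Dl; simp only [h1]
    rcases fl_main (q := q) l (sft_sum l hl) with ⟨h3, -⟩ | ⟨S, _, _, _, _, _, ε, hε, hS, h3, -⟩
    · exact hD (h3 X')
    · have hD3 := hD
      rw [hD2, h3] at hD3
      rw [h3] at hD
      refine pair_ne_zero_of_common (K := K) (HA q N) hS (X := X') (Y := Y') ?_ ?_ hp
      · intro h; rw [h] at hD; simp at hD
      · intro h; rw [h] at hD3; simp at hD3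
  have h3 : finrank K Y' = 0 := by
    rw [← pair_U_one (q := q) (N := N), ← h1, pair_U_one, h2]
  have hx : Subsingleton X' := finrank_zero_iff.1 h2
  have hy : Subsingleton Y' := finrank_zero_iff.1 h3
  have e : X' ≃ₗ[HA q N] Y' :=
    { toFun := fun _ => 0, invFun := fun _ => 0, map_add' := fun _ _ => by simp,
      map_smul' := fun _ _ => by simp, left_inv := fun _ => Subsingleton.elim _ _,
      right_inv := fun _ => Subsingleton.elim _ _ }
  exact ⟨a.trans ((LinearEquiv.prodCongr e (LinearEquiv.refl _ _)).trans b.symm)⟩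
end fl
end Hk

namespace Hk
open Module Finset
universe u

section tens
variable {K : Type u} [Field K] {q : K} {d : ℕ}

/-- action of `r` on two letters -/
def op2 (r : Fin d → Fin d → Fin d → Fin d → K) (g : Fin d → Fin d → K) (a b : Fin d) : K :=
  ∑ x, ∑ y, r a b x y * g x y

/-- abstract Hecke `R`-matrix in coordinates -/
structure IsR (q : K) (r : Fin d → Fin d → Fin d → Fin d → K) : Prop where
  quad : ∀ g a b, op2 r (op2 r g) a b = (q - 1) * op2 r g a b + q * g a b
  braid : ∀ (g : Fin d → Fin d → Fin d → K) a b c,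
    op2 r (fun a b => op2 r (fun b c => op2 r (fun a b => g a b c) a b) b c) a b =
    op2 r (fun b c => op2 r (fun a b => op2 r (fun b c => g a b c) b c) a b) b c

variable {N : ℕ}

/-- replace the letters at `i`, `i+1` -/
def up2 {κ : Type} (w : Fin N → κ) (i : ℕ) (h : i + 1 < N) (a b : κ) : Fin N → κ :=
  Function.update (Function.update w ⟨i, by omega⟩ a) ⟨i + 1, h⟩ b

theorem up2_apply {κ : Type} (w : Fin N → κ) (i : ℕ) (h : i + 1 < N) (a b : κ) (j : Fin N) :
    up2 w i h a b j = if j.1 = i then a else if j.1 = i + 1 then b else w j := by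
  simp only [up2, Function.update_apply, Fin.ext_iff]
  split_ifs <;> first | rfl | omega

/-- the operator at places `i`, `i+1` -/
def tT (r : Fin d → Fin d → Fin d → Fin d → K) (N : ℕ) (i : ℕ) :
    Module.End K ((Fin N → Fin d) → K) :=
  if h : i + 1 < N then
    { toFun := fun f w => op2 r (fun a b => f (up2 w i h a b)) (w ⟨i, by omega⟩) (w ⟨i + 1, h⟩)
      map_add' := fun f g => by
        funext w; simp only [op2, Pi.add_apply, mul_add, Finset.sum_add_distrib]
      map_smul' := fun c f => by
        funext w
        simp only [op2, Pi.smul_apply, smul_eq_mul, Finset.mul_sum, RingHom.id_apply]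
        exact Finset.sum_congr rfl fun x _ => Finset.sum_congr rfl fun y _ => by ring }
  else 0

theorem tT_apply (r : Fin d → Fin d → Fin d → Fin d → K) (i : ℕ) (h : i + 1 < N)
    (f : (Fin N → Fin d) → K) (w) : tT r N i f w =
      op2 r (fun a b => f (up2 w i h a b)) (w ⟨i, by omega⟩) (w ⟨i + 1, h⟩) := by
  unfold tT; rw [dif_pos h]; rfl

theorem tT_isHF {r : Fin d → Fin d → Fin d → Fin d → K} (hr : IsR q r) (N : ℕ) :
    IsHF q N (tT r N) where
  quad i h := by
    refine LinearMap.ext fun f => ?_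
    funext w
    simp only [Module.End.mul_apply, tT_apply _ _ h, LinearMap.add_apply, LinearMap.smul_apply,
      Pi.add_apply, Pi.smul_apply, smul_eq_mul, Module.End.one_apply]
    have := hr.quad (fun a b => f (up2 w i h a b)) (w ⟨i, by omega⟩) (w ⟨i + 1, h⟩)
    convert this using 2
    · funext a b
      congr 1
      · funext x y
        congr 1; funext j; simp only [up2_apply]; split_ifs <;> rfl
      · simp [up2_apply]
      · simp [up2_apply]
    · congr 2
      funext j; simp only [up2_apply]
      split_ifs with h1 h2
      · congr 1; exact Fin.ext h1
      · congr 1; exact Fin.ext h2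
      · rfl
  braid i h := by
    have h' : i + 1 + 1 < N := by omega
    refine LinearMap.ext fun f => ?_
    funext w
    have e1 : i + 1 < N := by omega
    simp only [Module.End.mul_apply, tT_apply _ _ h', tT_apply _ _ e1]
    have := hr.braid (fun a b c => f (up2 (up2 w i e1 a b) (i+1) h' b c))
      (w ⟨i, by omega⟩) (w ⟨i + 1, by omega⟩) (w ⟨i + 2, by omega⟩)
    convert this using 2
    · funext a b
      congr 1
      · funext b' c
        congr 1
        · funext a' bq
          congr 1; funext j; simp only [up2_apply]; split_ifs <;> first | rfl | omega
        · (simp [up2_apply] <;> omega)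
        · (simp [up2_apply] <;> omega)
      · (simp [up2_apply] <;> omega)
      · (simp [up2_apply] <;> omega)
    · funext b c
      congr 1
      · funext a b'
        congr 1
        · funext bq c'
          congr 1; funext j; simp only [up2_apply]; split_ifs <;> first | rfl | omega
        · (simp [up2_apply] <;> omega)
        · (simp [up2_apply] <;> omega)
      · (simp [up2_apply] <;> omega)
      · (simp [up2_apply] <;> omega)
  comm i j h h' := by
    have e1 : i + 1 < N := by omega
    refine LinearMap.ext fun f => ?_
    funext w
    simp only [Module.End.mul_apply, tT_apply _ _ h', tT_apply _ _ e1]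
    unfold op2
    simp only [Finset.mul_sum]
    have e2 : ∀ a b, up2 w i e1 a b ⟨j, by omega⟩ = w ⟨j, by omega⟩ := by
      intro a b; rw [up2_apply, if_neg (by simp; omega), if_neg (by simp; omega)]
    have e3 : ∀ a b, up2 w i e1 a b ⟨j + 1, h'⟩ = w ⟨j + 1, h'⟩ := by
      intro a b; rw [up2_apply, if_neg (by simp; omega), if_neg (by simp; omega)]
    have e4 : ∀ a b, up2 w j h' a b ⟨i, by omega⟩ = w ⟨i, by omega⟩ := by
      intro a b; rw [up2_apply, if_neg (by simp; omega), if_neg (by simp; omega)]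
    have e5 : ∀ a b, up2 w j h' a b ⟨i + 1, e1⟩ = w ⟨i + 1, e1⟩ := by
      intro a b; rw [up2_apply, if_neg (by simp; omega), if_neg (by simp; omega)]
    have e6 : ∀ a b x y, up2 (up2 w j h' x y) i e1 a b = up2 (up2 w i e1 a b) j h' x y := by
      intro a b x y; funext k; simp only [up2_apply]; split_ifs <;> first | rfl | omega
    simp only [e2, e3, e4, e5, e6]
    calc _ = ∑ p : (Fin d × Fin d), ∑ p' : Fin d × Fin d,
          r (w ⟨i, by omega⟩) (w ⟨i + 1, e1⟩) p.1 p.2 *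
          (r (w ⟨j, by omega⟩) (w ⟨j + 1, h'⟩) p'.1 p'.2 *
            f (up2 (up2 w i e1 p.1 p.2) j h' p'.1 p'.2)) := by
            simp only [Fintype.sum_prod_type]
      _ = _ := by
        rw [Finset.sum_comm]
        simp only [Fintype.sum_prod_type]
        refine Finset.sum_congr rfl fun _ _ => Finset.sum_congr rfl fun _ _ =>
          Finset.sum_congr rfl fun _ _ => Finset.sum_congr rfl fun _ _ => by ring
  zero i h := by unfold tT; rw [dif_neg (by omega)]

/-- the tensor power as a Hecke module -/
abbrev VM {r : Fin d → Fin d → Fin d → Fin d → K} (hr : IsR q r) (N : ℕ) := HM (tT_isHF hr N)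

/-- partial invariants -/
def Dinv (r : Fin d → Fin d → Fin d → Fin d → K) (q : K) (N : ℕ) (c : ℕ → Prop) :
    Submodule K ((Fin N → Fin d) → K) where
  carrier := {f | ∀ i, i + 1 < N → c i → tT r N i f = q • f}
  add_mem' := by
    intro f g hf hg i hi hc; rw [map_add, hf i hi hc, hg i hi hc, smul_add]
  zero_mem' := by intro i _ _; simp
  smul_mem' := by
    intro a f hf i hi hc; rw [map_smul, hf i hi hc, smul_comm]

theorem mem_Dinv {r : Fin d → Fin d → Fin d → Fin d → K} {q : K} {N : ℕ} {c : ℕ → Prop}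
    {f : (Fin N → Fin d) → K} : f ∈ Dinv r q N c ↔ ∀ i, i + 1 < N → c i → tT r N i f = q • f :=
  Iff.rfl

/-- block submodule -/
def blk {α β : Type} (P : Submodule K (α → K)) (Q : Submodule K (β → K)) :
    Submodule K (α × β → K) where
  carrier := {f | (∀ b, (fun a => f (a, b)) ∈ P) ∧ ∀ a, (fun b => f (a, b)) ∈ Q}
  add_mem' := fun hf hg => ⟨fun b => P.add_mem (hf.1 b) (hg.1 b), fun a => Q.add_mem (hf.2 a) (hg.2 a)⟩
  zero_mem' := ⟨fun _ => P.zero_mem, fun _ => Q.zero_mem⟩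
  smul_mem' := fun c _ hf => ⟨fun b => P.smul_mem c (hf.1 b), fun a => Q.smul_mem c (hf.2 a)⟩

theorem finrank_blk {α β : Type} [Fintype α] [Fintype β] [DecidableEq α]
    (P : Submodule K (α → K)) (Q : Submodule K (β → K)) :
    finrank K (blk P Q) = finrank K P * finrank K Q := by
  let b := Module.finBasis K P
  obtain ⟨g, hg⟩ := LinearMap.exists_extend (p := P) b.equivFun.toLinearMap
  let Φ : (Fin (finrank K P) → Q) →ₗ[K] (α × β → K) :=
    { toFun := fun c x => ∑ i, (b i : α → K) x.1 * (c i : β → K) x.2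
      map_add' := fun c c' => by
        funext x; simp [mul_add, Finset.sum_add_distrib]
      map_smul' := fun t c => by
        funext x; simp only [Pi.smul_apply, SetLike.val_smul, smul_eq_mul, Finset.mul_sum,
          RingHom.id_apply]
        exact Finset.sum_congr rfl fun i _ => by ring }
  have hgb : ∀ p : P, g p = b.equivFun p := fun p => LinearMap.congr_fun hg p
  have hsl : ∀ c y, (fun a => Φ c (a, y)) = ((∑ i, (c i : β → K) y • b i : P) : α → K) := by
    intro c y; funext a
    simp [Φ, Finset.sum_apply, mul_comm]
  have hinj : Function.Injective Φ := by
    rw [← LinearMap.ker_eq_bot, LinearMap.ker_eq_bot']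
    intro c hc
    funext i
    ext y
    have h1 : (fun a => Φ c (a, y)) = 0 := by rw [hc]; rfl
    rw [hsl] at h1
    have h2 := hgb (∑ i, (c i : β → K) y • b i)
    rw [h1, map_zero] at h2
    have h3 := congrFun h2 i
    rw [Basis.equivFun_apply, Basis.repr_sum_self] at h3
    simpa using h3.symm
  have hr : LinearMap.range Φ = blk P Q := by
    apply le_antisymm
    · rintro _ ⟨c, rfl⟩
      refine ⟨fun y => ?_, fun a => ?_⟩
      · rw [hsl]; exact Subtype.mem _
      · have : (fun y => Φ c (a, y)) = ((∑ i, (b i : α → K) a • c i : Q) : β → K) := by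
          funext y; simp [Φ, Finset.sum_apply]
        rw [this]; exact Subtype.mem _
    · intro f hf
      have hQ : ∀ i, (fun y => g (fun a => f (a, y)) i) ∈ Q := by
        intro i
        have : (fun y => g (fun a => f (a, y)) i) =
            ∑ a, g (Pi.single a 1) i • (fun y => f (a, y)) := by
          funext y
          have e : (fun a => f (a, y)) = ∑ a, f (a, y) • (Pi.single a (1 : K) : α → K) := by
            conv_lhs => rw [← Finset.univ_sum_single (fun a => f (a, y))]
            exact Finset.sum_congr rfl fun a _ => by
              rw [← Pi.single_smul]; simp
          conv_lhs => rw [e]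
          rw [map_sum]
          simp [Finset.sum_apply, mul_comm]
        rw [this]
        exact Q.sum_mem fun a _ => Q.smul_mem _ (hf.2 a)
      refine ⟨fun i => ⟨_, hQ i⟩, ?_⟩
      funext ⟨a, y⟩
      have h1 := hgb ⟨_, hf.1 y⟩
      have h2 := b.sum_equivFun ⟨_, hf.1 y⟩
      rw [← h1] at h2
      have h3 := congrFun (congrArg Subtype.val h2) a
      simp only at h3
      rw [← h3]
      simp [Φ, Finset.sum_apply, mul_comm]
  rw [← hr, LinearMap.finrank_range_of_inj hinj, Module.finrank_pi_fintype]
  simp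

theorem Dinv_add (r : Fin d → Fin d → Fin d → Fin d → K) (q : K) (M L : ℕ) (c : ℕ → Prop)
    (hc : ∀ i, i + 1 = M → 0 < L → ¬ c i) :
    finrank K (Dinv r q (M + L) c) =
      finrank K (Dinv r q M c) * finrank K (Dinv r q L (fun i => c (M + i))) := by
  rw [← finrank_blk]
  let e : ((Fin (M + L) → Fin d) → K) ≃ₗ[K] ((Fin M → Fin d) × (Fin L → Fin d) → K) :=
    LinearEquiv.funCongrLeft K K (Fin.appendEquiv M L)
  have he : ∀ f u v, e f (u, v) = f (Fin.append u v) := fun f u v => rfl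
  refine LinearEquiv.finrank_eq (e.submoduleMap _ |>.trans (LinearEquiv.ofEq _ _ ?_))
  have k1 : ∀ i, (h : i + 1 < M) → ∀ f u v, tT r (M + L) i f (Fin.append u v) =
      tT r M i (fun u => f (Fin.append u v)) u := by
    intro i h f u v
    rw [tT_apply _ _ (by omega), tT_apply _ _ h]
    congr 1
    · funext a b
      congr 1
      funext j
      refine Fin.addCases (fun j => ?_) (fun j => ?_) j
      · rw [up2_apply, Fin.append_left, Fin.append_left, up2_apply]; rfl
      · rw [up2_apply, Fin.append_right, if_neg (by simp; omega), if_neg (by simp; omega),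
          Fin.append_right]
    · exact Fin.append_left u v ⟨i, by omega⟩
    · exact Fin.append_left u v ⟨i + 1, by omega⟩
  have k2 : ∀ i, (h : i + 1 < L) → ∀ f u v, tT r (M + L) (M + i) f (Fin.append u v) =
      tT r L i (fun v => f (Fin.append u v)) v := by
    intro i h f u v
    rw [tT_apply _ _ (by omega), tT_apply _ _ h]
    congr 1
    · funext a b
      congr 1
      funext j
      refine Fin.addCases (fun j => ?_) (fun j => ?_) j
      · rw [up2_apply, Fin.append_left, if_neg (by simp; omega), if_neg (by simp; omega),
          Fin.append_left]
      · rw [up2_apply, Fin.append_right, Fin.append_right, up2_apply]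
        simp [add_assoc]
    · exact Fin.append_right u v ⟨i, by omega⟩
    · exact Fin.append_right u v ⟨i + 1, by omega⟩
  ext g
  obtain ⟨f, rfl⟩ := e.surjective g
  rw [Submodule.mem_map_equiv, LinearEquiv.symm_apply_apply]
  constructor
  · intro hf
    refine ⟨fun v i hi hci => ?_, fun u i hi hci => ?_⟩
    · funext u
      have := congrFun (hf i (by omega) hci) (Fin.append u v)
      rw [k1 i hi] at this
      exact this
    · funext v
      have := congrFun (hf (M + i) (by omega) hci) (Fin.append u v)
      rw [k2 i hi] at this
      exact this
  · rintro ⟨h1, h2⟩ i hi hci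
    funext w
    obtain ⟨⟨u, v⟩, rfl⟩ := (Fin.appendEquiv M L).surjective w
    change tT r (M + L) i f (Fin.append u v) = q • f (Fin.append u v)
    by_cases hM : i + 1 < M
    · rw [k1 i hM]
      exact congrFun (h1 v i hM hci) u
    · have : M ≤ i := by
        by_contra hlt
        exact hc i (by omega) (by omega) hci
      obtain ⟨j, rfl⟩ := Nat.exists_eq_add_of_le this
      rw [k2 j (by omega)]
      exact congrFun (h2 u j (by omega) hci) v

/-- dimension of the symmetric part -/
noncomputable def sd (r : Fin d → Fin d → Fin d → Fin d → K) (q : K) (N : ℕ) : ℕ :=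
  finrank K (Dinv r q N (fun _ => True))

theorem Dinv_congr (r : Fin d → Fin d → Fin d → Fin d → K) (q : K) (N : ℕ) (c c' : ℕ → Prop)
    (h : ∀ i, i + 1 < N → (c i ↔ c' i)) : Dinv r q N c = Dinv r q N c' := by
  ext f
  rw [mem_Dinv, mem_Dinv]
  refine forall_congr' fun i => forall_congr' fun hi => ?_
  rw [h i hi]

theorem Dinv_word (r : Fin d → Fin d → Fin d → Fin d → K) (q : K) (n : ℕ) :
    ∀ (N : ℕ) (w : ℕ → ℕ), (∀ i j, i ≤ j → j < N → w i ≤ w j) → (∀ i < N, w i < n) →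
    finrank K (Dinv r q N (fun i => w i = w (i + 1))) =
      ∏ a ∈ range n, sd r q ((range N).filter (fun i => w i = a)).card := by
  induction n with
  | zero =>
    intro N w _ h
    have : N = 0 := by
      by_contra hN; exact absurd (h 0 (by omega)) (by omega)
    subst this
    have e : Dinv r q 0 (fun i => w i = w (i + 1)) = ⊤ := by
      rw [eq_top_iff]; intro f _ i hi; omega
    rw [e]; simp
  | succ n ih =>
    intro N w hm hb
    set M := ((range N).filter (fun i => w i < n)).card with hM
    have hMN : M ≤ N := by
      have := Finset.card_filter_le (range N) (fun i => w i < n)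
      simpa using this
    have hF : (range N).filter (fun i => w i < n) = range M := by
      have hdown : ∃ m, (range N).filter (fun i => w i < n) = range m := by
        by_cases hex : ∃ i < N, n ≤ w i
        · classical
          refine ⟨Nat.find hex, ?_⟩
          obtain ⟨h1, h2⟩ := Nat.find_spec hex
          ext i
          simp only [mem_filter, mem_range, Nat.lt_find_iff]
          constructor
          · rintro ⟨h3, h4⟩ j hj ⟨h5, h6⟩
            have := hm j i hj h3; omega
          · intro h
            have hi : i < Nat.find hex := by rw [Nat.lt_find_iff]; exact h
            refine ⟨by omega, ?_⟩
            have := h i le_rfl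
            by_contra hc; exact this ⟨by omega, by omega⟩
        · refine ⟨N, ?_⟩
          push Not at hex
          exact Finset.filter_true_of_mem (fun i hi => hex i (mem_range.1 hi))
      obtain ⟨m, hm'⟩ := hdown
      rw [hM, hm', card_range]
    have hlt : ∀ i < N, (i < M ↔ w i < n) := by
      intro i hi
      have := congrArg (fun s => i ∈ s) hF
      simp only [mem_filter, mem_range, eq_iff_iff] at this
      rw [← this]; simp [hi]
    obtain ⟨L, hL⟩ := Nat.exists_eq_add_of_le hMN
    rw [prod_range_succ]
    have hkey := Dinv_add r q M L (fun i => w i = w (i + 1)) (by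
      intro i hi hL' h
      have h1 := (hlt i (by omega)).1 (by omega)
      have h2 := (hlt (i + 1) (by omega)).not.1 (by omega)
      omega)
    rw [← hL] at hkey
    rw [hkey, ih M w (fun i j h1 h2 => hm i j h1 (by omega))
      (fun i hi => (hlt i (by omega)).1 hi)]
    congr 1
    · refine prod_congr rfl fun a ha => ?_
      congr 2
      ext i
      simp only [mem_filter, mem_range]
      rw [mem_range] at ha
      constructor
      · rintro ⟨h1, h2⟩; exact ⟨by omega, h2⟩
      · rintro ⟨h1, h2⟩; exact ⟨(hlt i h1).2 (by omega), h2⟩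
    · have hn : ∀ i, M ≤ i → i < N → w i = n := by
        intro i h1 h2
        have := (hlt i h2).not.1 (by omega)
        have := hb i h2
        omega
      have e1 : ((range N).filter (fun i => w i = n)).card = L := by
        have : (range N).filter (fun i => w i = n) = Finset.Ico M N := by
          ext i
          simp only [mem_filter, mem_range, mem_Ico]
          constructor
          · rintro ⟨h1, h2⟩
            have := (hlt i h1).not.2 (by omega)
            omega
          · rintro ⟨h1, h2⟩; exact ⟨h2, hn i h1 h2⟩
        rw [this]; simp; omega
      rw [e1]
      unfold sd
      rw [Dinv_congr r q L _ (fun _ => True)]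
      intro i hi
      simp only [iff_true]
      rw [hn (M + i) (by omega) (by omega), hn (M + i + 1) (by omega) (by omega)]

theorem pair_U_VM {r : Fin d → Fin d → Fin d → Fin d → K} (hr : IsR q r) {n : ℕ} (μ : Fin n → ℤ)
    (h0 : ∀ a, 0 ≤ μ a) (hs : ∑ a, μ a = N) :
    pair K (HA q N) (U q N μ) (VM hr N) = ∏ a, sd r q (μ a).toNat := by
  obtain ⟨w0, hd, rfl⟩ := U_exists (N := N) μ h0 hs
  rw [U_pair w0 hd]
  have e1 : finrank K (inv q N w0 (VM hr N)) =
      finrank K (Dinv r q N (fun i => ltr w0 i = ltr w0 (i + 1))) := by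
    refine LinearEquiv.finrank_eq ((Rep.e _).submoduleMap _ |>.trans (LinearEquiv.ofEq _ _ ?_))
    ext f
    rw [Submodule.mem_map_equiv]
    refine forall_congr' fun i => forall_congr' fun hi => forall_congr' fun hc => ?_
    rw [← (Rep.e (HA.lift (tT_isHF hr N))).injective.eq_iff, HM.gen_smul, map_smul,
      LinearEquiv.apply_symm_apply]
  rw [e1, Dinv_word r q n N (ltr w0) (fun i j h1 h2 => by
      unfold ltr; rw [dif_pos h2, dif_pos (show i < N by omega)]
      exact ltr_mono_of_no_desc w0 hd (show (⟨i, by omega⟩ : Fin N) ≤ ⟨j, h2⟩ from h1))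
   
    (fun i hi => by unfold ltr; rw [dif_pos hi]; exact (w0 ⟨i, hi⟩).2), ← Fin.prod_univ_eq_prod_range
    (fun a => sd r q ((range N).filter (fun i => ltr w0 i = a)).card)]
  refine Finset.prod_congr rfl fun a _ => ?_
  congr 1
  unfold content
  rw [Int.toNat_natCast]
  symm
  refine Finset.card_bij (fun i _ => i.1) ?_ ?_ ?_
  · intro i hi
    simp only [mem_filter, mem_univ, true_and] at hi
    rw [mem_filter, mem_range]
    exact ⟨i.2, by simp [ltr, hi]⟩
  · intro i _ j _ h; exact Fin.ext h
  · intro i hi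
    simp only [mem_filter, mem_range] at hi
    refine ⟨⟨i, hi.1⟩, ?_, rfl⟩
    simp only [mem_filter, mem_univ, true_and]
    apply Fin.ext
    refine Eq.trans ?_ hi.2
    simp [ltr, hi.1]

end tens
end Hk

namespace Hk
open Module Finset TensorProduct

section quad
variable {K : Type*} [Field K] {V : Type*} [AddCommGroup V] [Module K V] {κ : Type} [Fintype κ]
  [DecidableEq κ]

/-- monomial of a list -/
noncomputable def mon (b : Basis κ K V) (l : List κ) : TensorAlgebra K V :=
  (l.map (fun i => TensorAlgebra.ι K (b i))).prod

theorem tb_apply (b : Basis κ K V) (l : FreeMonoid κ) :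
    b.tensorAlgebra l = mon b l.toList := by
  have : b.tensorAlgebra l = (TensorAlgebra.equivFreeAlgebra b).symm
    (FreeAlgebra.basisFreeMonoid K κ l) := rfl
  rw [this]
  have h2 : FreeAlgebra.basisFreeMonoid K κ l =
    (l.toList.map (FreeAlgebra.ι K)).prod := by
    have : FreeAlgebra.basisFreeMonoid K κ l =
      FreeAlgebra.equivMonoidAlgebraFreeMonoid.symm (MonoidAlgebra.single l (1 : K)) := by
      rfl
    rw [this, AlgEquiv.symm_apply_eq]
    induction l using FreeMonoid.inductionOn' with
    | one => simp; rfl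
    | of_mul x xs ih => 
      simp only [FreeMonoid.toList_of_mul, List.map_cons, List.prod_cons, map_mul]
      rw [← ih rfl rfl]
      simp [FreeAlgebra.equivMonoidAlgebraFreeMonoid, MonoidAlgebra.single_mul_single]
  rw [h2, map_list_prod, List.map_map]
  unfold mon
  congr 2
  funext i
  simp

/-- the dual description -/
def Lq (b : Basis κ K V) (W : Submodule K (V ⊗[K] V)) (N : ℕ) :
    Submodule K ((Fin N → κ) → K) where
  carrier := {f | ∀ i (h : i + 1 < N) u, ∀ x ∈ W,
    ∑ p : κ × κ, (b.tensorProduct b).repr x p * f (up2 u i h p.1 p.2) = 0}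
  add_mem' := by
    intro f g hf hg i h u x hx
    simp only [Pi.add_apply, mul_add, Finset.sum_add_distrib, hf i h u x hx, hg i h u x hx, add_zero]
  zero_mem' := by intro i h u x hx; simp
  smul_mem' := by
    intro c f hf i h u x hx
    simp only [Pi.smul_apply, smul_eq_mul, mul_left_comm _ c, ← Finset.mul_sum, hf i h u x hx,
      mul_zero]

theorem quadMul_expand (b : Basis κ K V) (x : V ⊗[K] V) :
    quadMul K V x = ∑ p : κ × κ, (b.tensorProduct b).repr x p •
      (TensorAlgebra.ι K (b p.1) * TensorAlgebra.ι K (b p.2)) := by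
  conv_lhs => rw [← (b.tensorProduct b).sum_repr x]
  rw [map_sum]
  refine Finset.sum_congr rfl fun p _ => ?_
  rw [map_smul, Basis.tensorProduct_apply']
  simp [quadMul]

/-- functional from a function on words -/
noncomputable def Fn (b : Basis κ K V) {N : ℕ} (f : (Fin N → κ) → K) : TensorAlgebra K V →ₗ[K] K :=
  b.tensorAlgebra.constr K (fun l : FreeMonoid κ =>
    if h : l.toList.length = N then f (fun i => l.toList.get (i.cast h.symm)) else 0)

theorem Fn_mon (b : Basis κ K V) {N : ℕ} (f : (Fin N → κ) → K) (l : List κ) :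
    Fn b f (mon b l) =
      if h : l.length = N then f (fun i => l.get (i.cast h.symm)) else 0 := by
  have := tb_apply b (FreeMonoid.ofList l)
  rw [FreeMonoid.toList_ofList] at this
  rw [← this, Fn, Basis.constr_basis]
  rfl

theorem mon_append (b : Basis κ K V) (l l' : List κ) : mon b (l ++ l') = mon b l * mon b l' := by
  simp [mon]

theorem Fn_kill (b : Basis κ K V) (W : Submodule K (V ⊗[K] V)) {N : ℕ} (f : (Fin N → κ) → K)
    (hf : f ∈ Lq b W N) (x : V ⊗[K] V) (hx : x ∈ W) (a y : TensorAlgebra K V) :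
    Fn b f (a * quadMul K V x * y) = 0 := by
  have h1 : ∀ l l' : List κ, Fn b f (mon b l * quadMul K V x * mon b l') = 0 := by
    intro l l'
    rw [quadMul_expand b, Finset.mul_sum, Finset.sum_mul, map_sum]
    have e : ∀ p : κ × κ, Fn b f (mon b l * ((b.tensorProduct b).repr x p •
      (TensorAlgebra.ι K (b p.1) * TensorAlgebra.ι K (b p.2))) * mon b l') =
      (b.tensorProduct b).repr x p * Fn b f (mon b (l ++ ([p.1, p.2] ++ l'))) := by
      intro p
      rw [mon_append, mon_append, mul_smul_comm, smul_mul_assoc, map_smul, smul_eq_mul]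
      simp [mon, mul_assoc]
    simp only [e, Fn_mon]
    by_cases hl : l.length + 2 + l'.length = N
    · rcases isEmpty_or_nonempty κ with hE | ⟨⟨c⟩⟩
      · exact Finset.sum_eq_zero fun p _ => (hE.false p.1).elim
      · have hlen : ∀ a a' : κ, (l ++ ([a, a'] ++ l')).length = N := by
          intro a a'; simp; omega
        have := hf l.length (by omega)
          (fun i => (l ++ ([c, c] ++ l')).get (i.cast (hlen c c).symm)) x hx
        rw [← this]
        refine Finset.sum_congr rfl fun p _ => ?_
        rw [dif_pos (hlen _ _)]
        congr 2
        funext j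
        rw [up2_apply]
        simp only [List.get_eq_getElem, Fin.val_cast]
        rcases lt_trichotomy j.1 l.length with h | h | h
        · rw [if_neg (by omega), if_neg (by omega), List.getElem_append_left h,
            List.getElem_append_left h]
        · rw [if_pos h, List.getElem_append_right (by omega)]
          simp [h]
        · rw [if_neg (by omega)]
          split_ifs with h2
          · simp [List.getElem_append, h2]
          · have h3 : ¬ j.1 < l.length := by omega
            have h4 : ¬ j.1 - l.length < 2 := by omega
            have h5 : ¬ j.1 - l.length < 1 + 1 := by omega
            obtain ⟨t, ht⟩ := Nat.exists_eq_add_of_le (show l.length + 2 ≤ j.1 by omega)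
            have h6 : j.1 - l.length = t + 1 + 1 := by omega
            simp [List.getElem_append, h3, h6]
    · refine Finset.sum_eq_zero fun p _ => ?_
      rw [dif_neg (by simp; omega), mul_zero]
  have h2 : ∀ l : List κ, ∀ y, Fn b f (mon b l * quadMul K V x * y) = 0 := by
    intro l y
    have : Fn b f ∘ₗ LinearMap.mulLeft K (mon b l * quadMul K V x) = 0 := by
      refine b.tensorAlgebra.ext fun l' => ?_
      rw [tb_apply]; exact h1 l _
    exact LinearMap.congr_fun this y
  have : Fn b f ∘ₗ LinearMap.mulRight K (quadMul K V x * y) = 0 := by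
    refine b.tensorAlgebra.ext fun l' => ?_
    rw [tb_apply]
    have := h2 l'.toList y
    rw [mul_assoc] at this; exact this
  have := LinearMap.congr_fun this a
  rw [mul_assoc]; exact this

theorem Fn_factor (b : Basis κ K V) (W : Submodule K (V ⊗[K] V)) {N : ℕ} (f : (Fin N → κ) → K)
    (hf : f ∈ Lq b W N) : ∃ φ : RingQuot (quadRel K V W) →ₗ[K] K,
      ∀ x, φ (RingQuot.mkAlgHom K (quadRel K V W) x) = Fn b f x := by
  let J : Submodule (TensorAlgebra K V) (TensorAlgebra K V) :=
    { carrier := {x | ∀ a, Fn b f (a * x) = 0}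
      add_mem' := fun {x y} hx hy a => by rw [mul_add, map_add, hx, hy, add_zero]
      zero_mem' := fun a => by simp
      smul_mem' := fun c x hx a => by rw [smul_eq_mul, ← mul_assoc]; exact hx _ }
  let ρ : TensorAlgebra K V →ₐ[K] Module.End K (TensorAlgebra K V ⧸ J) :=
    Algebra.lsmul K K _
  have hρ : ∀ ⦃x y⦄, quadRel K V W x y → ρ x = ρ y := by
    rintro x y ⟨rfl, w, hw, rfl⟩
    rw [map_zero]
    refine LinearMap.ext fun z => ?_
    obtain ⟨z, rfl⟩ := Submodule.Quotient.mk_surjective J z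
    change quadMul K V w • (Submodule.Quotient.mk z : _ ⧸ J) = 0
    rw [← Submodule.Quotient.mk_smul, Submodule.Quotient.mk_eq_zero]
    intro a
    rw [smul_eq_mul, ← mul_assoc]
    exact Fn_kill b W f hf w hw a z
  let ρ' := RingQuot.liftAlgHom K ⟨ρ, hρ⟩
  let Fb : (TensorAlgebra K V ⧸ J) →ₗ[K] K :=
    { toFun := Quotient.lift (fun x => Fn b f x) (by
        intro x y h
        have h' := (Submodule.quotientRel_def J).1 h
        have := h' 1
        rw [one_mul, map_sub, sub_eq_zero] at this
        exact this)
      map_add' := by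
        rintro ⟨x⟩ ⟨y⟩; exact map_add (Fn b f) x y
      map_smul' := by
        rintro c ⟨x⟩
        exact map_smul (Fn b f) c x }
  refine ⟨Fb ∘ₗ (LinearMap.applyₗ (R := K) (Submodule.Quotient.mk 1 : _ ⧸ J)) ∘ₗ ρ'.toLinearMap, ?_⟩
  intro x
  have e : ρ' (RingQuot.mkAlgHom K (quadRel K V W) x) = ρ x :=
    RingQuot.liftAlgHom_mkAlgHom_apply K ρ hρ x
  change Fb (ρ' (RingQuot.mkAlgHom K (quadRel K V W) x) (Submodule.Quotient.mk 1)) = _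
  rw [e]
  change Fn b f (x * 1) = _
  rw [mul_one]

theorem quadDim_eq (b : Basis κ K V) (W : Submodule K (V ⊗[K] V)) (N : ℕ) :
    quadDim K V W N = finrank K (Lq b W N) := by
  unfold quadDim
  set m := RingQuot.mkAlgHom K (quadRel K V W) with hm
  set D := Submodule.map m.toLinearMap (LinearMap.range (TensorAlgebra.ι K (M := V)) ^ N) with hD
  have hDs : D = Submodule.span K (Set.range fun w : Fin N → κ => m (mon b (List.ofFn w))) := by
    have h1 : LinearMap.range (TensorAlgebra.ι K (M := V)) =
        Submodule.span K (Set.range fun i => TensorAlgebra.ι K (b i)) := by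
      rw [LinearMap.range_eq_map, ← b.span_eq, Submodule.map_span, ← Set.range_comp]; rfl
    rw [hD, h1, Submodule.span_pow, Submodule.map_span]
    congr 1
    ext y
    constructor
    · rintro ⟨x, hx, rfl⟩
      obtain ⟨f, rfl⟩ := Set.mem_pow.1 hx
      choose g hg using fun i => (f i).2
      refine ⟨g, ?_⟩
      simp only [mon, List.map_ofFn]
      change m _ = m _
      congr 3
      funext i; exact hg i
    · rintro ⟨w, rfl⟩
      refine ⟨mon b (List.ofFn w), Set.mem_pow.2 ⟨fun i => ⟨_, ⟨w i, rfl⟩⟩, ?_⟩, rfl⟩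
      simp only [mon, List.map_ofFn]; rfl
  have hmem : ∀ w : Fin N → κ, m (mon b (List.ofFn w)) ∈ D := by
    intro w; rw [hDs]; exact Submodule.subset_span ⟨w, rfl⟩
  let Ψ : Dual K D →ₗ[K] ((Fin N → κ) → K) :=
    { toFun := fun φ w => φ ⟨_, hmem w⟩
      map_add' := fun _ _ => rfl
      map_smul' := fun _ _ => rfl }
  have hinj : Function.Injective Ψ := by
    rw [← LinearMap.ker_eq_bot, LinearMap.ker_eq_bot']
    intro φ hφ
    refine LinearMap.ext fun ⟨y, hy⟩ => ?_
    have : ∀ y (hy' : y ∈ Submodule.span K (Set.range fun w : Fin N → κ => m (mon b (List.ofFn w)))),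
        φ ⟨y, hDs ▸ hy'⟩ = 0 := by
      intro y hy'
      induction hy' using Submodule.span_induction with
      | mem x hx => obtain ⟨w, rfl⟩ := hx; exact congrFun hφ w
      | zero => exact map_zero φ
      | add x y hx hy h1 h2 =>
        have := map_add φ ⟨x, hDs ▸ hx⟩ ⟨y, hDs ▸ hy⟩
        rw [h1, h2, add_zero] at this; exact this
      | smul c x hx h1 =>
        have := map_smul φ c ⟨x, hDs ▸ hx⟩
        rw [h1, smul_zero] at this; exact this
    exact this y (hDs ▸ hy)
  have hrange : LinearMap.range Ψ = Lq b W N := by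
    apply le_antisymm
    · rintro _ ⟨φ, rfl⟩ i h u x hx
      have key : ∀ p : κ × κ, mon b (List.ofFn (up2 u i h p.1 p.2)) =
          mon b ((List.ofFn u).take i) * (TensorAlgebra.ι K (b p.1) * TensorAlgebra.ι K (b p.2)) *
          mon b ((List.ofFn u).drop (i + 2)) := by
        intro p
        have : List.ofFn (up2 u i h p.1 p.2) =
          (List.ofFn u).take i ++ ([p.1, p.2] ++ (List.ofFn u).drop (i + 2)) := by
          apply List.ext_getElem
          · simp; omega
          · intro j h1 h2
            simp only [List.length_ofFn] at h1
            have hl : ((List.ofFn u).take i).length = i := by simp; omega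
            rw [List.getElem_ofFn, up2_apply]
            simp only
            rcases lt_trichotomy j i with h | h | h
            · rw [if_neg (by omega), if_neg (by omega), List.getElem_append_left (by omega)]
              simp
            · rw [if_pos h, List.getElem_append_right (by omega)]
              simp [h, hl]
            · rw [if_neg (by omega), List.getElem_append_right (by omega)]
              split_ifs with h2
              · simp [h2, hl]
              · rw [List.getElem_append_right (by simp; omega)]
                simp only [hl, List.getElem_drop, List.getElem_ofFn]
                congr 1; apply Fin.ext; simp; omega
        rw [this, mon_append, mon_append]
        simp [mon, mul_assoc]
      have hz : m (mon b ((List.ofFn u).take i) * quadMul K V x *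
          mon b ((List.ofFn u).drop (i + 2))) = 0 := by
        rw [map_mul, map_mul]
        have : m (quadMul K V x) = m 0 := RingQuot.mkAlgHom_rel K ⟨rfl, x, hx, rfl⟩
        rw [this]; simp
      rw [quadMul_expand b, Finset.mul_sum, Finset.sum_mul, map_sum] at hz
      have hz2 : ∑ p : κ × κ, (b.tensorProduct b).repr x p •
          (⟨_, hmem (up2 u i h p.1 p.2)⟩ : D) = 0 := by
        apply Subtype.ext
        rw [AddSubmonoidClass.coe_finset_sum]
        refine Eq.trans ?_ hz
        refine Finset.sum_congr rfl fun p _ => ?_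
        rw [mul_smul_comm, smul_mul_assoc, map_smul, ← key]; rfl
      have := congrArg φ hz2
      rw [map_sum, map_zero] at this
      refine Eq.trans (Finset.sum_congr rfl fun p _ => ?_) this
      rw [map_smul]; rfl
    · intro f hf
      obtain ⟨φ, hφ⟩ := Fn_factor b W f hf
      refine ⟨φ ∘ₗ D.subtype, ?_⟩
      funext w
      change φ (m (mon b (List.ofFn w))) = f w
      rw [hφ, Fn_mon, dif_pos (by simp)]
      congr 1
      funext i; simp
  rw [← hrange, LinearMap.finrank_range_of_inj hinj]
  exact (Subspace.dual_finrank_eq (K := K) (V := D)).symm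

end quad
end Hk

namespace Hk
open Module Finset TensorProduct
universe u v

section conn
variable {K : Type u} [Field K] {V : Type v} [AddCommGroup V] [Module K V] {d : ℕ}

/-- matrix coefficients -/
noncomputable def rc (b : Basis (Fin d) K V) (R : V ⊗[K] V →ₗ[K] V ⊗[K] V) (c e x y : Fin d) : K :=
  (b.tensorProduct b).repr (R (b c ⊗ₜ b e)) (x, y)

/-- functional from coefficients -/
noncomputable def phi2 {W : Type*} [AddCommMonoid W] [Module K W] {ι ι' : Type} [Fintype ι] [Fintype ι']
    (B : Basis (ι × ι') K W) (g : ι → ι' → K) : W →ₗ[K] K :=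
  B.constr K (fun p => g p.1 p.2)

theorem phi2_eq {W : Type*} [AddCommMonoid W] [Module K W] {ι ι' : Type} [Fintype ι] [Fintype ι']
    (B : Basis (ι × ι') K W) (g : ι → ι' → K) (x : W) :
    phi2 B g x = ∑ p : ι × ι', B.repr x p * g p.1 p.2 := by
  unfold phi2; rw [Basis.constr_apply_fintype]; rfl

theorem phi2_R (b : Basis (Fin d) K V) (R : V ⊗[K] V →ₗ[K] V ⊗[K] V) (g : Fin d → Fin d → K)
    (c e : Fin d) : phi2 (b.tensorProduct b) g (R (b c ⊗ₜ b e)) = op2 (rc b R) g c e := by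
  rw [phi2_eq, Fintype.sum_prod_type]; rfl

theorem phi2_basis (b : Basis (Fin d) K V) (g : Fin d → Fin d → K) (c e : Fin d) :
    phi2 (b.tensorProduct b) g (b c ⊗ₜ b e) = g c e := by
  have := (b.tensorProduct b).constr_basis K (fun p => g p.1 p.2) (c, e)
  rw [Basis.tensorProduct_apply] at this
  exact this

theorem phi2_op (b : Basis (Fin d) K V) (R : V ⊗[K] V →ₗ[K] V ⊗[K] V) (g : Fin d → Fin d → K) :
    phi2 (b.tensorProduct b) (op2 (rc b R) g) = phi2 (b.tensorProduct b) g ∘ₗ R := by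
  refine (b.tensorProduct b).ext fun p => ?_
  rw [Basis.tensorProduct_apply', phi2_basis, LinearMap.comp_apply, phi2_R]

/-- functional on the triple tensor product -/
noncomputable def ph3 (b : Basis (Fin d) K V) (g : Fin d → Fin d → Fin d → K) :
    (V ⊗[K] V) ⊗[K] V →ₗ[K] K :=
  ((b.tensorProduct b).tensorProduct b).constr K (fun p => g p.1.1 p.1.2 p.2)

theorem ph3_basis (b : Basis (Fin d) K V) (g : Fin d → Fin d → Fin d → K) (x y z : Fin d) :
    ph3 b g ((b x ⊗ₜ b y) ⊗ₜ b z) = g x y z := by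
  have := ((b.tensorProduct b).tensorProduct b).constr_basis K (fun p => g p.1.1 p.1.2 p.2)
    ((x, y), z)
  rw [Basis.tensorProduct_apply, Basis.tensorProduct_apply] at this
  exact this

theorem ph3_left (b : Basis (Fin d) K V) (g : Fin d → Fin d → Fin d → K) (t : V ⊗[K] V) (z : Fin d) :
    ph3 b g (t ⊗ₜ b z) = phi2 (b.tensorProduct b) (fun x y => g x y z) t := by
  have : ph3 b g ∘ₗ (TensorProduct.mk K _ _).flip (b z) =
      phi2 (b.tensorProduct b) (fun x y => g x y z) := by
    refine (b.tensorProduct b).ext fun p => ?_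
    rw [Basis.tensorProduct_apply', phi2_basis]
    exact ph3_basis b g _ _ _
  exact LinearMap.congr_fun this t

theorem ph3_right (b : Basis (Fin d) K V) (g : Fin d → Fin d → Fin d → K) (t : V ⊗[K] V)
    (x : Fin d) : ph3 b g ((TensorProduct.assoc K V V V).symm (b x ⊗ₜ t)) =
      phi2 (b.tensorProduct b) (fun y z => g x y z) t := by
  have : ph3 b g ∘ₗ (TensorProduct.assoc K V V V).symm.toLinearMap ∘ₗ (TensorProduct.mk K _ _) (b x) =
      phi2 (b.tensorProduct b) (fun y z => g x y z) := by
    refine (b.tensorProduct b).ext fun p => ?_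
    rw [Basis.tensorProduct_apply', phi2_basis]
    simp only [LinearMap.comp_apply, TensorProduct.mk_apply, LinearEquiv.coe_coe,
      TensorProduct.assoc_symm_tmul]
    exact ph3_basis b g _ _ _
  exact LinearMap.congr_fun this t

theorem rc_isR {q : K} (b : Basis (Fin d) K V) (R : V ⊗[K] V →ₗ[K] V ⊗[K] V)
    (hR : IsHecke K V q R) : IsR q (rc b R) where
  quad g a c := by
    have h2 : R ∘ₗ R = (q - 1) • R + q • LinearMap.id := by
      refine LinearMap.ext fun z => ?_
      have := LinearMap.congr_fun hR.2 z
      simp only [LinearMap.comp_apply, LinearMap.add_apply, LinearMap.sub_apply, LinearMap.smul_apply,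
        LinearMap.id_apply, map_sub, map_smul, LinearMap.zero_apply] at this ⊢
      rw [← sub_eq_zero, ← this]; module
    rw [← phi2_R, phi2_op, LinearMap.comp_apply, ← LinearMap.comp_apply R R, h2, ← phi2_R]
    simp [phi2_basis]
  braid g x y z := by
    set R₁ : (V ⊗[K] V) ⊗[K] V →ₗ[K] (V ⊗[K] V) ⊗[K] V := LinearMap.rTensor V R with hR1
    set R₂ : (V ⊗[K] V) ⊗[K] V →ₗ[K] (V ⊗[K] V) ⊗[K] V :=
      (TensorProduct.assoc K V V V).symm.toLinearMap ∘ₗ LinearMap.lTensor V R ∘ₗ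
      (TensorProduct.assoc K V V V).toLinearMap with hR2
    have hYB : R₁ ∘ₗ R₂ ∘ₗ R₁ = R₂ ∘ₗ R₁ ∘ₗ R₂ := hR.1
    have k1 : ∀ g : Fin d → Fin d → Fin d → K,
        ph3 b (fun x y z => op2 (rc b R) (fun x y => g x y z) x y) = ph3 b g ∘ₗ R₁ := by
      intro g
      refine ((b.tensorProduct b).tensorProduct b).ext fun p => ?_
      rw [Basis.tensorProduct_apply', Basis.tensorProduct_apply', ph3_basis, LinearMap.comp_apply,
        hR1, LinearMap.rTensor_tmul, ph3_left, phi2_R]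
    have k2 : ∀ g : Fin d → Fin d → Fin d → K,
        ph3 b (fun x y z => op2 (rc b R) (fun y z => g x y z) y z) = ph3 b g ∘ₗ R₂ := by
      intro g
      refine ((b.tensorProduct b).tensorProduct b).ext fun p => ?_
      rw [Basis.tensorProduct_apply', Basis.tensorProduct_apply', ph3_basis, LinearMap.comp_apply,
        hR2]
      simp only [LinearMap.comp_apply, LinearEquiv.coe_coe, TensorProduct.assoc_tmul,
        LinearMap.lTensor_tmul]
      rw [ph3_right, phi2_R]
    have e1 := k1 (fun x y z => op2 (rc b R) (fun y z => op2 (rc b R) (fun x y => g x y z) x y) y z)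
    rw [k2 (fun x y z => op2 (rc b R) (fun x y => g x y z) x y), k1 g] at e1
    have e2 := k2 (fun x y z => op2 (rc b R) (fun x y => op2 (rc b R) (fun y z => g x y z) y z) x y)
    rw [k1 (fun x y z => op2 (rc b R) (fun y z => g x y z) y z), k2 g] at e2
    simp only [LinearMap.comp_assoc] at e1 e2
    rw [hYB, ← e2] at e1
    have := LinearMap.congr_fun e1 ((b x ⊗ₜ b y) ⊗ₜ b z)
    rwa [ph3_basis, ph3_basis] at this

theorem up2_up2 {κ : Type} {N : ℕ} (u : Fin N → κ) (i : ℕ) (h : i + 1 < N) (a b a' b' : κ) :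
    up2 (up2 u i h a b) i h a' b' = up2 u i h a' b' := by
  funext j; simp only [up2_apply]; split_ifs <;> rfl

theorem up2_self {κ : Type} {N : ℕ} (u : Fin N → κ) (i : ℕ) (h : i + 1 < N) :
    up2 u i h (u ⟨i, by omega⟩) (u ⟨i + 1, h⟩) = u := by
  funext j; simp only [up2_apply]
  split_ifs with h1 h2
  · congr 1; exact Fin.ext h1.symm
  · congr 1; exact Fin.ext h2.symm
  · rfl

theorem up2_left {κ : Type} {N : ℕ} (u : Fin N → κ) (i : ℕ) (h : i + 1 < N) (a b : κ) :
    up2 u i h a b ⟨i, by omega⟩ = a := by simp [up2_apply]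

theorem up2_right {κ : Type} {N : ℕ} (u : Fin N → κ) (i : ℕ) (h : i + 1 < N) (a b : κ) :
    up2 u i h a b ⟨i + 1, h⟩ = b := by simp [up2_apply]

/-- antisymmetric functions -/
theorem mem_Lq_lambda (b : Basis (Fin d) K V) (R : V ⊗[K] V →ₗ[K] V ⊗[K] V) (N : ℕ)
    (f : (Fin N → Fin d) → K) : f ∈ Lq b (LinearMap.range (R + LinearMap.id)) N ↔
      ∀ i, i + 1 < N → tT (rc b R) N i f = - f := by
  constructor
  · intro hf i h
    funext w
    have := hf i h w _ ⟨b (w ⟨i, by omega⟩) ⊗ₜ b (w ⟨i + 1, h⟩), rfl⟩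
    rw [← phi2_eq (b.tensorProduct b) (fun x y => f (up2 w i h x y))] at this
    rw [LinearMap.add_apply, map_add, phi2_R, LinearMap.id_apply, phi2_basis, up2_self] at this
    rw [tT_apply _ _ h, Pi.neg_apply]
    exact eq_neg_of_add_eq_zero_left this
  · intro hf i h u x hx
    obtain ⟨z, rfl⟩ := hx
    rw [← phi2_eq (b.tensorProduct b) (fun x y => f (up2 u i h x y))]
    have : phi2 (b.tensorProduct b) (fun x y => f (up2 u i h x y)) ∘ₗ (R + LinearMap.id) = 0 := by
      refine (b.tensorProduct b).ext fun p => ?_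
      rw [Basis.tensorProduct_apply', LinearMap.comp_apply, LinearMap.add_apply, map_add, phi2_R,
        LinearMap.id_apply, phi2_basis]
      have := congrFun (hf i h) (up2 u i h p.1 p.2)
      rw [tT_apply _ _ h, up2_left, up2_right] at this
      simp only [up2_up2] at this
      rw [this]; simp
    exact LinearMap.congr_fun this z

/-- sign representation -/
def sgnT (K : Type u) [Field K] (N i : ℕ) : Module.End K K := if i + 1 < N then -1 else 0

theorem sgnT_isHF (q : K) (N : ℕ) : IsHF q N (sgnT K N) where
  quad i h := by
    unfold sgnT; rw [if_pos h]
    ext; simp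
  braid i h := by
    unfold sgnT; rw [if_pos (by omega), if_pos (by omega)]
  comm i j h h' := by
    unfold sgnT; rw [if_pos (by omega), if_pos (by omega)]
  zero i h := by unfold sgnT; rw [if_neg (by omega)]

/-- sign module -/
abbrev sgnM (q : K) (N : ℕ) := HM (sgnT_isHF (K := K) q N)

theorem lambda_pair {q : K} (b : Basis (Fin d) K V) (R : V ⊗[K] V →ₗ[K] V ⊗[K] V)
    (hR : IsR q (rc b R)) (N : ℕ) :
    lambdaDim K V R N = pair K (HA q N) (sgnM q N) (VM hR N) := by
  unfold lambdaDim pair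
  rw [quadDim_eq b]
  let Ψ : (sgnM q N →ₗ[HA q N] VM hR N) →ₗ[K] ((Fin N → Fin d) → K) :=
    { toFun := fun φ => Rep.e _ (φ ((Rep.e _).symm 1))
      map_add' := fun _ _ => rfl
      map_smul' := fun _ _ => rfl }
  have hone : ∀ x : sgnM q N, x = (Rep.e _ x : K) • (Rep.e (HA.lift (sgnT_isHF q N))).symm 1 := by
    intro x
    apply (Rep.e (HA.lift (sgnT_isHF q N))).injective
    rw [map_smul]; simp
  have hinj : Function.Injective Ψ := by
    intro φ φ' h
    refine LinearMap.ext fun x => ?_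
    have h' : φ ((Rep.e _).symm 1) = φ' ((Rep.e _).symm 1) := (Rep.e _).injective h
    rw [hone x, LinearMap.map_smul_of_tower, LinearMap.map_smul_of_tower, h']
  have hgen : ∀ i, i + 1 < N → HA.gen q N i • (Rep.e (HA.lift (sgnT_isHF q N))).symm (1 : K) =
      - (Rep.e (HA.lift (sgnT_isHF q N))).symm (1 : K) := by
    intro i hi
    apply (Rep.e (HA.lift (sgnT_isHF q N))).injective
    rw [HM.gen_smul, map_neg, LinearEquiv.apply_symm_apply]
    unfold sgnT; rw [if_pos hi]; simp <;> rfl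
  have hr : LinearMap.range Ψ = Lq b (LinearMap.range (R + LinearMap.id)) N := by
    apply le_antisymm
    · rintro _ ⟨φ, rfl⟩
      rw [mem_Lq_lambda]
      intro i hi
      change tT (rc b R) N i (Rep.e _ (φ ((Rep.e _).symm 1))) = - Rep.e _ (φ ((Rep.e _).symm 1))
      rw [← HM.gen_smul (tT_isHF hR N), ← map_smul, hgen i hi, map_neg, map_neg]
    · intro f hf
      rw [mem_Lq_lambda] at hf
      refine ⟨mkHom ((LinearMap.toSpanSingleton K (VM hR N) ((Rep.e _).symm f)) ∘ₗ
        (Rep.e _).toLinearMap) ?_, ?_⟩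
      · intro i x
        simp only [LinearMap.comp_apply, LinearEquiv.coe_coe, LinearMap.toSpanSingleton_apply]
        rw [HM.gen_smul]
        apply (Rep.e (HA.lift (tT_isHF hR N))).injective
        rw [HM.gen_smul, map_smul, map_smul, map_smul, LinearEquiv.apply_symm_apply]
        by_cases hi : i + 1 < N
        · rw [hf i hi]; unfold sgnT; rw [if_pos hi]; simp <;> rfl
        · rw [(tT_isHF hR N).zero i (by omega), (sgnT_isHF q N).zero i (by omega)]; simp
      · change Rep.e _ ((Rep.e (HA.lift (sgnT_isHF q N))
            ((Rep.e (HA.lift (sgnT_isHF q N))).symm (1 : K)) : K) •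
            (Rep.e (HA.lift (tT_isHF hR N))).symm f) = f
        rw [LinearEquiv.apply_symm_apply, one_smul, LinearEquiv.apply_symm_apply]
  rw [← hr, LinearMap.finrank_range_of_inj hinj]

end conn
end Hk

namespace Hk
open Module Finset TensorProduct
universe u v

section epart
variable {K : Type u} [Field K] {V : Type v} [AddCommGroup V] [Module K V] [FiniteDimensional K V]
  {d : ℕ}

/-- transposed coefficients -/
def rt (r : Fin d → Fin d → Fin d → Fin d → K) (a b x y : Fin d) : K := r x y a b

theorem phi2_basis' {W W' : Type*} [AddCommMonoid W] [Module K W] [AddCommMonoid W'] [Module K W']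
    {ι ι' : Type} [Fintype ι] [Fintype ι'] [DecidableEq ι] [DecidableEq ι']
    (b : Basis ι K W) (b' : Basis ι' K W') (g : ι → ι' → K) (c : ι) (e : ι') :
    phi2 (b.tensorProduct b') g (b c ⊗ₜ b' e) = g c e := by
  have := (b.tensorProduct b').constr_basis K (fun p => g p.1 p.2) (c, e)
  rw [Basis.tensorProduct_apply] at this
  exact this

theorem exists_sub' {D : Type*} [AddCommMonoid D] [Module K D] (z x : D) : ∃ y, z = x + y := by
  refine ⟨z + (-1 : K) • x, ?_⟩
  have : x + (-1 : K) • x = 0 := by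
    nth_rewrite 1 [← one_smul K x]
    rw [← add_smul]; simp
  rw [add_comm z, ← add_assoc, this, zero_add]

theorem dual_coeff (b : Basis (Fin d) K V) (t : Dual K V ⊗[K] Dual K V) (x y : Fin d) :
    (b.dualBasis.tensorProduct b.dualBasis).repr t (x, y) =
      TensorProduct.dualDistribEquiv K V V t (b x ⊗ₜ b y) := by
  have : (b.dualBasis.tensorProduct b.dualBasis).coord (x, y) =
      (LinearMap.applyₗ (b x ⊗ₜ[K] b y)) ∘ₗ (TensorProduct.dualDistribEquiv K V V).toLinearMap := by
    refine (b.dualBasis.tensorProduct b.dualBasis).ext fun p => ?_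
    obtain ⟨p1, p2⟩ := p
    rw [Basis.coord_apply, Basis.repr_self, Basis.tensorProduct_apply]
    have h : (TensorProduct.dualDistribEquiv K V V) (b.dualBasis p1 ⊗ₜ b.dualBasis p2) (b x ⊗ₜ b y)
      = b.dualBasis p1 (b x) * b.dualBasis p2 (b y) := TensorProduct.dualDistrib_apply _ _ _ _
    refine Eq.trans ?_ h.symm
    rw [Basis.dualBasis_apply_self, Basis.dualBasis_apply_self, Finsupp.single_apply]
    by_cases h1 : p1 = x <;> by_cases h2 : p2 = y <;> aesop
  exact LinearMap.congr_fun this t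

theorem dual_basis_coeff (b : Basis (Fin d) K V) (s : V ⊗[K] V) (x y : Fin d) :
    TensorProduct.dualDistribEquiv K V V (b.dualBasis x ⊗ₜ b.dualBasis y) s =
      (b.tensorProduct b).repr s (x, y) := by
  have : TensorProduct.dualDistribEquiv K V V (b.dualBasis x ⊗ₜ b.dualBasis y) =
      (b.tensorProduct b).coord (x, y) := by
    refine (b.tensorProduct b).ext fun p => ?_
    obtain ⟨p1, p2⟩ := p
    rw [Basis.coord_apply, Basis.repr_self, Basis.tensorProduct_apply]
    have h : (TensorProduct.dualDistribEquiv K V V) (b.dualBasis x ⊗ₜ b.dualBasis y) (b p1 ⊗ₜ b p2)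
      = b.dualBasis x (b p1) * b.dualBasis y (b p2) := TensorProduct.dualDistrib_apply _ _ _ _
    refine h.trans ?_
    rw [Basis.dualBasis_apply_self, Basis.dualBasis_apply_self, Finsupp.single_apply]
    by_cases h1 : p1 = x <;> by_cases h2 : p2 = y <;> aesop
  exact LinearMap.congr_fun this s

theorem phi2_dual (b : Basis (Fin d) K V) (S : V ⊗[K] V →ₗ[K] V ⊗[K] V) (g : Fin d → Fin d → K)
    (α β : Fin d) : phi2 (b.dualBasis.tensorProduct b.dualBasis) g
      (dualOp K V S (b.dualBasis α ⊗ₜ b.dualBasis β)) = op2 (rt (rc b S)) g α β := by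
  rw [phi2_eq, Fintype.sum_prod_type]
  unfold op2 rt rc
  refine Finset.sum_congr rfl fun x _ => Finset.sum_congr rfl fun y _ => ?_
  dsimp only
  rw [dual_coeff, ← dual_basis_coeff]
  congr 1
  unfold dualOp
  simp only [LinearMap.comp_apply, LinearEquiv.coe_coe, LinearEquiv.apply_symm_apply]
  rfl

theorem phi2_theta (b : Basis (Fin d) K V)
    (g : Fin d × Fin d → Fin d × Fin d → K) (t : Dual K V ⊗[K] Dual K V) (s : V ⊗[K] V) :
    phi2 ((b.dualBasis.tensorProduct b).tensorProduct (b.dualBasis.tensorProduct b)) g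
      ((TensorProduct.tensorTensorTensorComm K (Dual K V) V (Dual K V) V).symm (t ⊗ₜ s)) =
    phi2 (b.dualBasis.tensorProduct b.dualBasis)
      (fun x y => phi2 (b.tensorProduct b) (fun x' y' => g (x, x') (y, y')) s) t := by
  set Φ := phi2 ((b.dualBasis.tensorProduct b).tensorProduct (b.dualBasis.tensorProduct b)) g with hΦ
  have h1 : ∀ x y, Φ ∘ₗ
      (TensorProduct.tensorTensorTensorComm K (Dual K V) V (Dual K V) V).symm.toLinearMap ∘ₗ
      (TensorProduct.mk K _ _ (b.dualBasis x ⊗ₜ[K] b.dualBasis y)) =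
      phi2 (b.tensorProduct b) (fun x' y' => g (x, x') (y, y')) := by
    intro x y
    refine (b.tensorProduct b).ext fun p => ?_
    obtain ⟨p1, p2⟩ := p
    rw [Basis.tensorProduct_apply, phi2_basis']
    simp only [LinearMap.comp_apply, TensorProduct.mk_apply, LinearEquiv.coe_coe,
      TensorProduct.tensorTensorTensorComm_symm, TensorProduct.tensorTensorTensorComm_tmul]
    rw [hΦ, ← Basis.tensorProduct_apply, ← Basis.tensorProduct_apply, phi2_basis']
  have h2 : Φ ∘ₗ
      (TensorProduct.tensorTensorTensorComm K (Dual K V) V (Dual K V) V).symm.toLinearMap ∘ₗ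
      ((TensorProduct.mk K _ _).flip s) = phi2 (b.dualBasis.tensorProduct b.dualBasis)
      (fun x y => phi2 (b.tensorProduct b) (fun x' y' => g (x, x') (y, y')) s) := by
    refine (b.dualBasis.tensorProduct b.dualBasis).ext fun p => ?_
    obtain ⟨p1, p2⟩ := p
    rw [Basis.tensorProduct_apply, phi2_basis']
    exact LinearMap.congr_fun (h1 p1 p2) s
  exact LinearMap.congr_fun h2 t

theorem phi2_bar (b : Basis (Fin d) K V) (R S : V ⊗[K] V →ₗ[K] V ⊗[K] V)
    (g : Fin d × Fin d → Fin d × Fin d → K) (p p' : Fin d × Fin d) :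
    phi2 ((b.dualBasis.tensorProduct b).tensorProduct (b.dualBasis.tensorProduct b)) g
      (barOp K V R S (b.dualBasis.tensorProduct b p ⊗ₜ b.dualBasis.tensorProduct b p')) =
    op2 (rt (rc b S)) (fun x y => op2 (rc b R) (fun x' y' => g (x, x') (y, y')) p.2 p'.2) p.1 p'.1 := by
  unfold barOp
  rw [Basis.tensorProduct_apply', Basis.tensorProduct_apply']
  simp only [LinearMap.comp_apply, LinearEquiv.coe_coe,
      TensorProduct.tensorTensorTensorComm_tmul, TensorProduct.map_tmul]
  rw [phi2_theta, phi2_dual]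
  simp only [phi2_R]

theorem op2_inv (b : Basis (Fin d) K V) (R S : V ⊗[K] V →ₗ[K] V ⊗[K] V)
    (h : S ∘ₗ R = LinearMap.id) (g : Fin d → Fin d → K) (x y : Fin d) :
    op2 (rt (rc b S)) (op2 (rt (rc b R)) g) x y = g x y := by
  have key : ∀ u v, ∑ x', ∑ y', rc b R u v x' y' * rc b S x' y' x y = if (u, v) = (x, y) then 1 else 0 := by
    intro u v
    have h1 := phi2_R b R (fun x' y' => rc b S x' y' x y) u v
    unfold op2 at h1
    rw [← h1]
    have h2 : phi2 (b.tensorProduct b) (fun x' y' => rc b S x' y' x y) =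
        (b.tensorProduct b).coord (x, y) ∘ₗ S := by
      refine (b.tensorProduct b).ext fun p => ?_
      rw [Basis.tensorProduct_apply', phi2_basis]; rfl
    rw [h2, LinearMap.comp_apply, ← LinearMap.comp_apply S R, h, LinearMap.id_apply,
      ← Basis.tensorProduct_apply, Basis.coord_apply, Basis.repr_self, Finsupp.single_apply]
  have : op2 (rt (rc b S)) (op2 (rt (rc b R)) g) x y =
      ∑ u, ∑ v, (∑ x', ∑ y', rc b R u v x' y' * rc b S x' y' x y) * g u v := by
    unfold op2 rt
    simp only [Finset.mul_sum, Finset.sum_mul]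
    simp only [← Fintype.sum_prod_type' (f := fun a b : Fin d => _)]
    rw [Finset.sum_comm]
    refine Finset.sum_congr rfl fun u _ => Finset.sum_congr rfl fun v _ => ?_
    ring
  rw [this]
  simp only [key]
  rw [← Fintype.sum_prod_type' (f := fun u v => (if (u, v) = (x, y) then (1 : K) else 0) * g u v)]
  simp

theorem bar_iff (b : Basis (Fin d) K V) (R S : V ⊗[K] V →ₗ[K] V ⊗[K] V)
    (h : S ∘ₗ R = LinearMap.id) (h' : R ∘ₗ S = LinearMap.id)
    (g : Fin d → Fin d → Fin d → Fin d → K) :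
    (∀ α β a c, op2 (rt (rc b S)) (fun x y => op2 (rc b R) (g x y) a c) α β = g α β a c) ↔
    (∀ α β a c, op2 (rt (rc b R)) (fun x y => g x y a c) α β = op2 (rc b R) (g α β) a c) := by
  constructor
  · intro H α β a c
    have : (fun x y => g x y a c) =
      op2 (rt (rc b S)) (fun x y => op2 (rc b R) (g x y) a c) := by
      funext x y; exact (H x y a c).symm
    rw [this, op2_inv b S R h']
  · intro H α β a c
    have : (fun x y => op2 (rc b R) (g x y) a c) =
      op2 (rt (rc b R)) (fun x y => g x y a c) := by
      funext x y; exact (H x y a c).symm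
    rw [this, op2_inv b R S h]

/-- pairs of words -/
theorem up2_pair {N : ℕ} (A w : Fin N → Fin d) (i : ℕ) (h : i + 1 < N) (p p' : Fin d × Fin d) :
    up2 (fun j => (A j, w j)) i h p p' = fun j => (up2 A i h p.1 p'.1 j, up2 w i h p.2 p'.2 j) := by
  funext j; simp only [up2_apply]; split_ifs <;> rfl

theorem mem_Lq_bar (b : Basis (Fin d) K V) (R S : V ⊗[K] V →ₗ[K] V ⊗[K] V)
    (h : S ∘ₗ R = LinearMap.id) (h' : R ∘ₗ S = LinearMap.id) (N : ℕ)
    (F : (Fin N → Fin d × Fin d) → K) :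
    F ∈ Lq (V := Dual K V ⊗[K] V) (b.dualBasis.tensorProduct b) (Submodule.span K {y | ∃ x, barOp K V R S x = x + y}) N ↔
    ∀ i (hi : i + 1 < N) (A w : Fin N → Fin d),
      op2 (rt (rc b R)) (fun x y => F fun j => (up2 A i hi x y j, w j)) (A ⟨i, by omega⟩) (A ⟨i + 1, hi⟩)
      = op2 (rc b R) (fun x y => F fun j => (A j, up2 w i hi x y j)) (w ⟨i, by omega⟩) (w ⟨i + 1, hi⟩) := by
  set B := (b.dualBasis.tensorProduct b).tensorProduct (b.dualBasis.tensorProduct b) with hB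
  have step : F ∈ Lq (V := Dual K V ⊗[K] V) (b.dualBasis.tensorProduct b)
      (Submodule.span K {y | ∃ x, barOp K V R S x = x + y}) N ↔ ∀ i (hi : i + 1 < N) (A w : Fin N → Fin d),
      ∀ α β a c, op2 (rt (rc b S)) (fun x y => op2 (rc b R) (fun x' y' =>
        F fun j => (up2 A i hi x y j, up2 w i hi x' y' j)) a c) α β =
        F fun j => (up2 A i hi α β j, up2 w i hi a c j) := by
    constructor
    · intro hF i hi A w α β a c
      set X0 := (b.dualBasis.tensorProduct b (α, a) ⊗ₜ[K] b.dualBasis.tensorProduct b (β, c)) with hX0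
      obtain ⟨Y0, hY0⟩ := exists_sub' (K := K) (barOp K V R S X0) X0
      have := hF i hi (fun j => (A j, w j)) Y0 (Submodule.subset_span ⟨X0, hY0⟩)
      rw [← phi2_eq B (fun x y => F (up2 (fun j => (A j, w j)) i hi x y))] at this
      have h3 := congrArg (phi2 B (fun x y => F (up2 (fun j => (A j, w j)) i hi x y))) hY0
      rw [map_add, this, add_zero, hB, hX0, phi2_bar, phi2_basis'] at h3
      replace this := h3
      simpa only [up2_pair] using this
    · intro H i hi u x hx
      rw [← phi2_eq B (fun x y => F (up2 u i hi x y))]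
      have hz : phi2 B (fun x y => F (up2 u i hi x y)) ∘ₗ barOp K V R S =
          phi2 B (fun x y => F (up2 u i hi x y)) := by
        refine B.ext fun p => ?_
        obtain ⟨p, p'⟩ := p
        rw [hB, Basis.tensorProduct_apply, LinearMap.comp_apply,
          phi2_bar, phi2_basis']
        have := H i hi (fun j => (u j).1) (fun j => (u j).2) p.1 p'.1 p.2 p'.2
        have hu : u = fun j => ((u j).1, (u j).2) := rfl
        rw [hu]
        simpa only [up2_pair] using this
      have hle : Submodule.span K {y | ∃ x, barOp K V R S x = x + y} ≤
          LinearMap.ker (phi2 B (fun x y => F (up2 u i hi x y))) := by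
        rw [Submodule.span_le]
        rintro y ⟨x, hx⟩
        have := LinearMap.congr_fun hz x
        rw [LinearMap.comp_apply, hx, map_add] at this
        exact left_eq_add.1 this.symm
      exact hle hx
  rw [step]
  have step2 : ∀ i (hi : i + 1 < N) (A w : Fin N → Fin d), _ := fun i hi A w =>
    bar_iff b R S h h' (fun x y x' y' => F fun j => (up2 A i hi x y j, up2 w i hi x' y' j))
  simp only [step2]
  constructor
  · intro H i hi A w
    have := H i hi A w (A ⟨i, by omega⟩) (A ⟨i + 1, hi⟩) (w ⟨i, by omega⟩) (w ⟨i + 1, hi⟩)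
    simpa only [up2_self] using this
  · intro H i hi A w α β a c
    have := H i hi (up2 A i hi α β) (up2 w i hi a c)
    simpa only [up2_left, up2_right, up2_up2] using this

/-- basis functions -/
def ew {N : ℕ} (a : Fin N → Fin d) : (Fin N → Fin d) → K := Pi.single a 1

theorem tT_ew {N : ℕ} (r : Fin d → Fin d → Fin d → Fin d → K) (i : ℕ) (hi : i + 1 < N)
    (a : Fin N → Fin d) : tT r N i (ew a) =
      ∑ x, ∑ y, r x y (a ⟨i, by omega⟩) (a ⟨i + 1, hi⟩) • ew (K := K) (up2 a i hi x y) := by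
  funext w
  rw [tT_apply _ _ hi]
  unfold op2 ew
  simp only [Finset.sum_apply, Pi.smul_apply, smul_eq_mul, Pi.single_apply]
  have e1 : ∀ x y, up2 w i hi x y = a ↔ (x = a ⟨i, by omega⟩ ∧ y = a ⟨i + 1, hi⟩ ∧
      ∀ j : Fin N, j.1 ≠ i → j.1 ≠ i + 1 → w j = a j) := by
    intro x y
    constructor
    · intro h; subst h
      refine ⟨(up2_left _ _ _ _ _).symm, (up2_right _ _ _ _ _).symm, fun j h1 h2 => ?_⟩
      rw [up2_apply, if_neg h1, if_neg h2]
    · rintro ⟨rfl, rfl, h⟩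
      funext j; rw [up2_apply]; split_ifs with h1 h2
      · congr 1; exact Fin.ext h1.symm
      · congr 1; exact Fin.ext h2.symm
      · exact h j h1 h2
  have e2 : ∀ x y, w = up2 a i hi x y ↔ (x = w ⟨i, by omega⟩ ∧ y = w ⟨i + 1, hi⟩ ∧
      ∀ j : Fin N, j.1 ≠ i → j.1 ≠ i + 1 → w j = a j) := by
    intro x y
    constructor
    · intro h; subst h
      refine ⟨(up2_left _ _ _ _ _).symm, (up2_right _ _ _ _ _).symm, fun j h1 h2 => ?_⟩
      rw [up2_apply, if_neg h1, if_neg h2]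
    · rintro ⟨rfl, rfl, h⟩
      funext j; rw [up2_apply]; split_ifs with h1 h2
      · congr 1; exact Fin.ext h1
      · congr 1; exact Fin.ext h2
      · exact h j h1 h2
  simp only [e1, e2]
  by_cases hc : ∀ j : Fin N, j.1 ≠ i → j.1 ≠ i + 1 → w j = a j
  · have hc1 := eq_true hc
    simp only [hc1, and_true]
    simp [ite_and]
  · have hc1 := eq_false hc
    simp only [hc1, and_false, if_false, mul_zero]

theorem e_pair {q : K} (b : Basis (Fin d) K V) (R S : V ⊗[K] V →ₗ[K] V ⊗[K] V)
    (h : S ∘ₗ R = LinearMap.id) (h' : R ∘ₗ S = LinearMap.id)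
    (hR : IsR q (rc b R)) (N : ℕ) :
    eDim K V R S N = pair K (HA q N) (VM hR N) (VM hR N) := by
  unfold eDim pair
  rw [quadDim_eq (V := Dual K V ⊗[K] V) (b.dualBasis.tensorProduct b)]
  let E := Rep.e (HA.lift (tT_isHF hR N))
  let Ψ : (VM hR N →ₗ[HA q N] VM hR N) →ₗ[K] ((Fin N → Fin d × Fin d) → K) :=
    { toFun := fun φ z => E (φ (E.symm (ew fun j => (z j).1))) (fun j => (z j).2)
      map_add' := fun _ _ => rfl
      map_smul' := fun _ _ => rfl }
  let Bs : Basis (Fin N → Fin d) K (VM hR N) := (Pi.basisFun K (Fin N → Fin d)).map E.symm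
  have hBs : ∀ a, Bs a = E.symm (ew a) := by
    intro a; simp only [Bs, Basis.map_apply, Pi.basisFun_apply]; rfl
  have hinj : Function.Injective Ψ := by
    intro φ φ' hh
    have : φ.restrictScalars K = φ'.restrictScalars K := by
      refine Bs.ext fun a => E.injective ?_
      funext w
      rw [hBs]
      exact congrFun hh (fun j => (a j, w j))
    exact LinearMap.ext fun x => LinearMap.congr_fun this x
  have hcomm : ∀ φ : VM hR N →ₗ[K] VM hR N, (∀ i x, φ (HA.gen q N i • x) = HA.gen q N i • φ x) ↔
      ∀ i (hi : i + 1 < N) (A w : Fin N → Fin d),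
      op2 (rt (rc b R)) (fun x y => E (φ (E.symm (ew (up2 A i hi x y)))) w)
        (A ⟨i, by omega⟩) (A ⟨i + 1, hi⟩)
      = op2 (rc b R) (fun x y => E (φ (E.symm (ew A))) (up2 w i hi x y))
        (w ⟨i, by omega⟩) (w ⟨i + 1, hi⟩) := by
    intro φ
    have key : ∀ i (hi : i + 1 < N) (A w : Fin N → Fin d),
        E (φ (HA.gen q N i • E.symm (ew A))) w = 
        op2 (rt (rc b R)) (fun x y => E (φ (E.symm (ew (up2 A i hi x y)))) w)
        (A ⟨i, by omega⟩) (A ⟨i + 1, hi⟩) := by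
      intro i hi A w
      have h1 : HA.gen q N i • E.symm (ew A) = E.symm (tT (rc b R) N i (ew A)) := by
        apply E.injective
        rw [LinearEquiv.apply_symm_apply, HM.gen_smul, LinearEquiv.apply_symm_apply]
      rw [h1, tT_ew _ _ hi]
      simp only [map_sum, map_smul, Finset.sum_apply, Pi.smul_apply, smul_eq_mul]
      rfl
    have key2 : ∀ i (hi : i + 1 < N) (A w : Fin N → Fin d),
        E (HA.gen q N i • φ (E.symm (ew A))) w = 
        op2 (rc b R) (fun x y => E (φ (E.symm (ew A))) (up2 w i hi x y))
        (w ⟨i, by omega⟩) (w ⟨i + 1, hi⟩) := by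
      intro i hi A w
      rw [HM.gen_smul, tT_apply _ _ hi]
    constructor
    · intro H i hi A w
      rw [← key, H, key2]
    · intro H i
      by_cases hi : i + 1 < N
      · have : φ ∘ₗ famOf q N (VM hR N) i = famOf q N (VM hR N) i ∘ₗ φ := by
          refine Bs.ext fun a => E.injective ?_
          funext w
          rw [hBs]
          exact (key i hi a w).trans ((H i hi a w).trans (key2 i hi a w).symm)
        exact fun x => LinearMap.congr_fun this x
      · have h0 : ∀ x : VM hR N, HA.gen q N i • x = 0 := by
          intro x
          apply E.injective
          rw [HM.gen_smul, (tT_isHF hR N).zero i (by omega)]; simp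
        intro x; rw [h0, h0, map_zero]
  have hr : LinearMap.range Ψ = Lq (V := Dual K V ⊗[K] V) (b.dualBasis.tensorProduct b)
      (Submodule.span K {y | ∃ x, barOp K V R S x = x + y}) N := by
    apply le_antisymm
    · rintro _ ⟨φ, rfl⟩
      rw [mem_Lq_bar b R S h h']
      exact (hcomm (φ.restrictScalars K)).1 (fun i x => φ.map_smul _ _)
    · intro F hF
      rw [mem_Lq_bar b R S h h'] at hF
      let φ : VM hR N →ₗ[K] VM hR N := Bs.constr K (fun a => E.symm fun w => F fun j => (a j, w j))
      have hφ : ∀ a w, E (φ (E.symm (ew a))) w = F fun j => (a j, w j) := by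
        intro a w
        rw [← hBs]
        simp only [φ, Basis.constr_basis, LinearEquiv.apply_symm_apply]
      refine ⟨mkHom φ ((hcomm φ).2 ?_), ?_⟩
      · simpa only [hφ] using hF
      · funext z
        exact hφ _ _
  rw [← hr, LinearMap.finrank_range_of_inj hinj]

end epart
end Hk

namespace Hk
open Module Finset
universe u

section lam
variable {K : Type u} [Field K] {q : K} {N n d : ℕ}

instance VM_fin {r : Fin d → Fin d → Fin d → Fin d → K} (hr : IsR q r) (N : ℕ) :
    Module.Finite K (VM hr N) := Module.Finite.equiv (Rep.e (HA.lift (tT_isHF hr N))).symm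

instance sgnM_fin (q : K) (N : ℕ) : Module.Finite K (sgnM q N) :=
  Module.Finite.equiv (Rep.e (HA.lift (sgnT_isHF q N))).symm

theorem finrank_sgnM (q : K) (N : ℕ) : finrank K (sgnM q N) = 1 := by
  rw [(Rep.e (HA.lift (sgnT_isHF q N))).finrank_eq]; exact finrank_self K

theorem pair_U_sgn_zero (hq : q ≠ -1) (μ : Fin n → ℤ) (a : Fin n) (ha : 2 ≤ μ a) :
    pair K (HA q N) (U q N μ) (sgnM q N) = 0 := by
  by_cases h : (∀ a, 0 ≤ μ a) ∧ ∑ a, μ a = N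
  swap
  · exact U_zero μ h
  obtain ⟨w0, h0, rfl⟩ := U_exists μ h.1 h.2
  rw [U_pair w0 h0]
  have hm := ltr_mono_of_no_desc w0 h0
  have : 1 < (Finset.univ.filter (fun i => w0 i = a)).card := by
    unfold content at ha; exact_mod_cast ha
  obtain ⟨j, hj, k, hk, hjk⟩ := Finset.one_lt_card.1 this
  have main : ∀ j k : Fin N, w0 j = a → w0 k = a → j < k →
      finrank K (inv q N w0 (sgnM q N)) = 0 := by
    intro j k hj hk hjk
    have hj1 : j.1 + 1 < N := by have := k.2; have : j.1 < k.1 := hjk; omega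
    have e1 : w0 ⟨j.1 + 1, hj1⟩ = a := by
      apply le_antisymm
      · rw [← hk]; exact hm (by rw [Fin.le_def]; exact hjk)
      · rw [← hj]; exact hm (by rw [Fin.le_def]; simp)
    have : inv q N w0 (sgnM q N) = ⊥ := by
      rw [eq_bot_iff]
      intro v hv
      have h1 := hv j.1 hj1 (by
        unfold ltr
        rw [dif_pos j.2, dif_pos hj1, e1]
        exact congrArg Fin.val hj)
      have h2 := congrArg (Rep.e (HA.lift (sgnT_isHF q N))) h1
      rw [HM.gen_smul, map_smul] at h2
      unfold sgnT at h2
      rw [if_pos hj1] at h2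
      have h3 : (q + 1) * (Rep.e (HA.lift (sgnT_isHF q N))) v = 0 := by
        have h4 : - (Rep.e (HA.lift (sgnT_isHF q N))) v = q * (Rep.e (HA.lift (sgnT_isHF q N))) v := h2
        linear_combination -h4
      rcases mul_eq_zero.1 h3 with h5 | h5
      · exact absurd (eq_neg_of_add_eq_zero_left h5) hq
      · exact (LinearEquiv.map_eq_zero_iff _).1 h5
    rw [this]; simp
  simp only [Finset.mem_filter, Finset.mem_univ, true_and] at hj hk
  rcases lt_or_gt_of_ne hjk with h1 | h1
  · exact main j k hj hk h1
  · exact main k j hk hj h1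

theorem Dl_sgn (hq : q ≠ -1) : Dl q N (fun a => rho N a + 1) (sgnM q N) = 1 := by
  unfold Dl
  rw [Finset.sum_eq_single 1]
  · have : sft (fun a => rho N a + 1) 1 = fun _ : Fin N => (1 : ℤ) := by
      funext a; simp [sft]
    rw [pair_U_congr this, pair_U_one, finrank_sgnM]; simp
  · intro σ _ hσ
    have hs : ∑ a, sft (fun a => rho N a + 1) σ a = N := by
      apply sft_sum
      push_cast
      rw [Finset.sum_add_distrib]; simp [add_comm]
    have : ∃ a, 2 ≤ sft (fun a => rho N a + 1) σ a := by
      by_contra hcon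
      push Not at hcon
      have h1 : ∀ a ∈ (univ : Finset (Fin N)), sft (fun a => rho N a + 1) σ a ≤ 1 :=
        fun a _ => by have := hcon a; omega
      have h2 : ∑ a, sft (fun a => rho N a + 1) σ a = ∑ a : Fin N, (1 : ℤ) := by rw [hs]; simp
      rw [Finset.sum_eq_sum_iff_of_le h1] at h2
      apply hσ
      refine Equiv.ext fun a => rho_inj ?_
      have := h2 a (mem_univ _)
      simp only [sft] at this
      push_cast at this
      rw [Equiv.Perm.one_apply]; omega
    obtain ⟨a, ha⟩ := this
    rw [pair_U_sgn_zero hq _ a ha]; simp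
  · simp

theorem Dl_eq_sgn [IsSemisimpleRing (HA q N)] (hq : q ≠ -1) (M : Type u) [AddCommGroup M] [Module K M]
    [Module (HA q N) M] [IsScalarTower K (HA q N) M] [Module.Finite K M] :
    Dl q N (fun a => rho N a + 1) M = pair K (HA q N) (sgnM q N) M := by
  have h1 := Dl_sgn (N := N) hq
  rcases fl_main (q := q) (N := N) (fun a : Fin N => rho N a + 1) (sft_sum _ (by
      push_cast
      rw [Finset.sum_add_distrib]; simp [add_comm])) with h | h
  · rw [h.1] at h1; omega
  · obtain ⟨S, _, _, _, _, _, ε, hε, hSS, hM, -⟩ := h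
    rw [hM] at h1
    have hp : pair K (HA q N) S (sgnM q N) = 1 ∧ ε = 1 := by
      rcases hε with rfl | rfl <;> constructor <;> omega
    rw [hM, hp.2, one_mul]
    have hne : ¬ pair K (HA q N) S (sgnM q N) = 0 := by omega
    rw [pair_eq_zero_iff] at hne
    push Not at hne
    obtain ⟨f, hf⟩ := hne
    obtain ⟨C, _, _, _, _, _, ⟨e⟩⟩ := inj_of_pair_one (K := K) (HA q N) hSS f hf
    have hfr := finrank_sgnM q N
    rw [finrank_congr (K := K) (HA q N) e, finrank_prod] at hfr
    have hS0 : finrank K S ≠ 0 := by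
      intro h0
      have := finrank_zero_iff.1 h0
      have h2 : Subsingleton (S →ₗ[HA q N] S) := ⟨fun f g => by
        ext x; rw [Subsingleton.elim x 0, map_zero, map_zero]⟩
      unfold pair at hSS
      rw [finrank_zero_of_subsingleton] at hSS; omega
    have hC : finrank K C = 0 := by omega
    have := finrank_zero_iff.1 hC
    rw [pair_congr_left (K := K) (HA q N) e, pair_prod_left]
    have : pair K (HA q N) C M = 0 := by
      have h2 : Subsingleton (C →ₗ[HA q N] M) := ⟨fun f g => by
        ext x; rw [Subsingleton.elim x 0, map_zero, map_zero]⟩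
      unfold pair
      exact finrank_zero_of_subsingleton
    rw [this, add_zero]

theorem Dl_VM {r : Fin d → Fin d → Fin d → Fin d → K} (hr : IsR q r) {A : Type*} [CommRing A]
    (y : Fin n → A) (l : Fin n → ℕ) (hl : ∀ σ, ∑ a, sft l σ a = N)
    (B : ℕ) (hB : ∀ a, l a ≤ B) (hy : ∀ k : ℕ, k ≤ B → hh y k = (sd r q k : A)) :
    ((Dl q N l (VM hr N) : ℤ) : A) = (Hm y l).det := by
  unfold Dl
  rw [Hm_det_eq]
  push_cast
  refine Finset.sum_congr rfl fun σ _ => ?_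
  congr 1
  by_cases h : ∀ a, 0 ≤ sft l σ a
  · rw [pair_U_VM hr _ h (hl σ)]
    push_cast
    refine Finset.prod_congr rfl fun a _ => ?_
    rw [← hy _ (by have := hB a; unfold sft; omega), Int.toNat_of_nonneg (h a)]
    rfl
  · rw [U_zero _ (fun hc => h hc.1)]
    push Not at h
    obtain ⟨a, ha⟩ := h
    rw [Finset.prod_eq_zero (mem_univ a) (hh_neg y _ ha)]; simp

theorem sd_zero (r : Fin d → Fin d → Fin d → Fin d → K) (q : K) : sd r q 0 = 1 := by
  unfold sd
  have : Dinv r q 0 (fun _ => True) = ⊤ := by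
    rw [eq_top_iff]; intro f _ i hi; omega
  rw [this, finrank_top]; simp

theorem sd_one (r : Fin d → Fin d → Fin d → Fin d → K) (q : K) : sd r q 1 = d := by
  unfold sd
  have : Dinv r q 1 (fun _ => True) = ⊤ := by
    rw [eq_top_iff]; intro f _ i hi; omega
  rw [this, finrank_top]; simp

theorem hh_one {A : Type*} [CommRing A] (y : Fin n → A) : hh y 1 = ∑ i, y i := by
  have := hh_nat y 1
  rw [Nat.cast_one] at this
  rw [this]
  have : ∀ s : Finset (Fin n), PowerSeries.coeff 0 (∏ i ∈ s, geo (y i)) = 1 ∧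
      PowerSeries.coeff 1 (∏ i ∈ s, geo (y i)) = ∑ i ∈ s, y i := by
    intro s
    induction s using Finset.induction_on with
    | empty => simp [PowerSeries.coeff_one]
    | insert a s ha ih =>
      rw [Finset.prod_insert ha, Finset.sum_insert ha, PowerSeries.coeff_mul, PowerSeries.coeff_mul]
      rw [Finset.Nat.antidiagonal_succ]
      simp [ih.1, ih.2, geo]
      rw [add_comm]
      congr 1
      exact ih.2
  exact (this univ).2

theorem geo_inv {A : Type*} [CommRing A] (y : Fin n → A) :
    (∏ i, geo (y i)) * ((∏ c, (1 - Polynomial.C (y c) * Polynomial.X) : Polynomial A) : PowerSeries A) = 1 := by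
  have : ((∏ c, (1 - Polynomial.C (y c) * Polynomial.X) : Polynomial A) : PowerSeries A) =
    ∏ c, (1 - PowerSeries.C (y c) * PowerSeries.X) := by
    rw [← Polynomial.coeToPowerSeries.ringHom_apply, map_prod]
    simp
  rw [this, ← Finset.prod_mul_distrib]
  exact Finset.prod_eq_one fun i _ => geo_mul _

theorem coeff_prod_top {A : Type*} [CommRing A] (y : Fin n → A) :
    (∏ c, (1 - Polynomial.C (y c) * Polynomial.X) : Polynomial A).coeff n = (-1) ^ n * ∏ c, y c := by
  have := Polynomial.coeff_prod_of_natDegree_le (univ : Finset (Fin n))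
    (fun c => 1 - Polynomial.C (y c) * Polynomial.X) 1 (fun c _ => by compute_degree)
  rw [Finset.card_univ, Fintype.card_fin, mul_one] at this
  rw [this]
  simp [Polynomial.coeff_one, Finset.prod_neg]

/-- Hilbert series -/
noncomputable def Sser (r : Fin d → Fin d → Fin d → Fin d → K) (q : K) : PowerSeries ℂ :=
  PowerSeries.mk fun k => (sd r q k : ℂ)

theorem Sser_const (r : Fin d → Fin d → Fin d → Fin d → K) (q : K) :
    PowerSeries.constantCoeff (Sser r q) = 1 := by
  rw [← PowerSeries.coeff_zero_eq_constantCoeff_apply, Sser, PowerSeries.coeff_mk, sd_zero]; simp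

theorem exists_trunc (r : Fin d → Fin d → Fin d → Fin d → K) (q : K) (N : ℕ) :
    ∃ x : Fin N → ℂ, PowerSeries.trunc (N + 1) (Sser r q)⁻¹ =
      ∏ c, (1 - Polynomial.C (x c) * Polynomial.X) ∧
      ∀ k : ℕ, k ≤ N → hh x k = (sd r q k : ℂ) := by
  obtain ⟨x, hx⟩ := poly_split N (PowerSeries.trunc (N + 1) (Sser r q)⁻¹)
    (by have := PowerSeries.natDegree_trunc_lt (Sser r q)⁻¹ N; omega)
    (by rw [PowerSeries.coeff_trunc, if_pos (by omega)]; simp [Sser_const])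
  refine ⟨x, hx, fun k hk => ?_⟩
  have h1 := geo_inv x
  rw [← hx] at h1
  have h2 : Sser r q * (Sser r q)⁻¹ = 1 := PowerSeries.mul_inv_cancel _ (by rw [Sser_const]; simp)
  obtain ⟨Q, hQ⟩ : ∃ Q, (Sser r q)⁻¹ = (PowerSeries.trunc (N + 1) (Sser r q)⁻¹ : PowerSeries ℂ) +
      PowerSeries.X ^ (N + 1) * Q := by
    have : PowerSeries.X ^ (N + 1) ∣ (Sser r q)⁻¹ -
        (PowerSeries.trunc (N + 1) (Sser r q)⁻¹ : PowerSeries ℂ) := by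
      rw [PowerSeries.X_pow_dvd_iff]
      intro m hm
      rw [map_sub, Polynomial.coeff_coe, PowerSeries.coeff_trunc, if_pos hm, sub_self]
    obtain ⟨Q, hQ⟩ := this
    exact ⟨Q, by rw [← hQ]; ring⟩
  set G := ∏ i, geo (x i) with hG
  set P := (PowerSeries.trunc (N + 1) (Sser r q)⁻¹ : PowerSeries ℂ) with hP
  have h3 : G = Sser r q + PowerSeries.X ^ (N + 1) * (G * Sser r q * Q) := by
    calc G = G * (Sser r q * (Sser r q)⁻¹) := by rw [h2, mul_one]
      _ = (G * P) * Sser r q + PowerSeries.X ^ (N + 1) * (G * Sser r q * Q) := by rw [hQ]; ring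
      _ = _ := by rw [h1, one_mul]
  rw [hh_nat, ← hG, h3, map_add, PowerSeries.coeff_X_pow_mul', if_neg (by omega), add_zero, Sser,
    PowerSeries.coeff_mk]

theorem lam_coeff [IsSemisimpleRing (HA q N)] (hq : q ≠ -1)
    {r : Fin d → Fin d → Fin d → Fin d → K} (hr : IsR q r) :
    (pair K (HA q N) (sgnM q N) (VM hr N) : ℂ) = (-1) ^ N * PowerSeries.coeff N (Sser r q)⁻¹ := by
  obtain ⟨x, hx, hxs⟩ := exists_trunc r q N
  have h1 := Dl_eq_sgn (N := N) hq (VM hr N)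
  have h2 := Dl_VM (N := N) hr x (fun a => rho N a + 1) (sft_sum _ (by
      push_cast
      rw [Finset.sum_add_distrib]; simp [add_comm])) N
      (fun a => by have := a.2; simp only [rho]; omega) hxs
  rw [h1, det_Hm_succ, det_Hm_rho, mul_one] at h2
  have h3 := congrArg (fun p => Polynomial.coeff p N) hx
  simp only [coeff_prod_top, PowerSeries.coeff_trunc] at h3
  rw [if_pos (by omega)] at h3
  rw [h3, ← mul_assoc, ← mul_pow]
  simpa using h2

theorem exists_roots (hss : ∀ N, IsSemisimpleRing (HA q N)) (hq : q ≠ -1)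
    {r : Fin d → Fin d → Fin d → Fin d → K} (hr : IsR q r) (n : ℕ)
    (h1 : pair K (HA q n) (sgnM q n) (VM hr n) = 1)
    (h0 : ∀ k, n < k → pair K (HA q k) (sgnM q k) (VM hr k) = 0) :
    ∃ a : Fin n → ℂ, ∏ i, a i = 1 ∧ ∀ k : ℕ, hh a k = (sd r q k : ℂ) := by
  have key : ∀ N, (pair K (HA q N) (sgnM q N) (VM hr N) : ℂ) =
      (-1) ^ N * PowerSeries.coeff N (Sser r q)⁻¹ := fun N => by
    have := hss N
    exact lam_coeff hq hr
  have hz : ∀ k, n < k → PowerSeries.coeff k (Sser r q)⁻¹ = 0 := by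
    intro k hk
    have := key k
    rw [h0 k hk] at this
    have h2 : ((-1 : ℂ)) ^ k ≠ 0 := pow_ne_zero _ (by norm_num)
    simpa [h2] using this.symm
  obtain ⟨a, ha, -⟩ := exists_trunc r q n
  have hP : (PowerSeries.trunc (n + 1) (Sser r q)⁻¹ : PowerSeries ℂ) = (Sser r q)⁻¹ := by
    ext k
    rw [Polynomial.coeff_coe, PowerSeries.coeff_trunc]
    split_ifs with h
    · rfl
    · rw [hz k (by omega)]
  refine ⟨a, ?_, fun k => ?_⟩
  · have h3 := congrArg (fun p => Polynomial.coeff p n) ha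
    simp only [coeff_prod_top, PowerSeries.coeff_trunc] at h3
    rw [if_pos (by omega)] at h3
    have := key n
    rw [h1, h3, ← mul_assoc, ← mul_pow] at this
    simpa using this.symm
  · have h2 : Sser r q * (Sser r q)⁻¹ = 1 := PowerSeries.mul_inv_cancel _ (by rw [Sser_const]; simp)
    have h3 := geo_inv a
    rw [← ha, hP] at h3
    have : ∏ i, geo (a i) = Sser r q := by
      calc ∏ i, geo (a i) = (∏ i, geo (a i)) * (Sser r q * (Sser r q)⁻¹) := by rw [h2, mul_one]
        _ = ((∏ i, geo (a i)) * (Sser r q)⁻¹) * Sser r q := by ring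
        _ = _ := by rw [h3, one_mul]
    rw [hh_nat, this, Sser, PowerSeries.coeff_mk]

end lam
end Hk

namespace Hk
open Module Finset
universe u

section dimU
variable {K : Type u} [Field K] {q : K} {N n d m s : ℕ}

theorem word_count (c : Fin n → ℕ) (hc : ∑ a, c a = N) :
    (univ.filter (fun w : Fin N → Fin n => ∀ a, (univ.filter (fun i => w i = a)).card = c a)).card
      = Nat.multinomial univ c := by
  classical
  have h1 : (∑ i : Fin n, (MvPolynomial.X i : MvPolynomial (Fin n) ℕ)) ^ N =
      ∑ w : Fin N → Fin n, MvPolynomial.monomial (∑ j, Finsupp.single (w j) 1) 1 := by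
    rw [← Finset.prod_const_one (s := (univ : Finset (Fin N)))] 
    have : (∑ i : Fin n, (MvPolynomial.X i : MvPolynomial (Fin n) ℕ)) ^ N =
      ∏ j : Fin N, ∑ i : Fin n, (MvPolynomial.X i : MvPolynomial (Fin n) ℕ) := by simp
    rw [this, Finset.prod_univ_sum, Fintype.piFinset_univ]
    refine Finset.sum_congr rfl fun w _ => ?_
    rw [MvPolynomial.monomial_sum_index]
    simp [MvPolynomial.X]
  have h2 := Finset.sum_pow_eq_sum_piAntidiag (univ : Finset (Fin n))
    (fun i => (MvPolynomial.X i : MvPolynomial (Fin n) ℕ)) N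
  rw [h1] at h2
  have h3 : ∀ k : Fin n → ℕ, ∏ i : Fin n, (MvPolynomial.X i : MvPolynomial (Fin n) ℕ) ^ k i =
      MvPolynomial.monomial (Finsupp.equivFunOnFinite.symm k) 1 := by
    intro k
    rw [MvPolynomial.monomial_eq, Finsupp.prod_fintype _ _ (by simp)]
    simp
  simp only [h3] at h2
  have h4 := congrArg (MvPolynomial.coeff (Finsupp.equivFunOnFinite.symm c)) h2
  rw [MvPolynomial.coeff_sum, MvPolynomial.coeff_sum] at h4
  have h5 : ∀ k : Fin n → ℕ, ((Nat.multinomial univ k : ℕ) : MvPolynomial (Fin n) ℕ) =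
      MvPolynomial.C (Nat.multinomial univ k) := fun k => by simp
  simp only [h5, MvPolynomial.coeff_C_mul, MvPolynomial.coeff_monomial,
    Finsupp.equivFunOnFinite.symm.injective.eq_iff] at h4
  rw [Finset.sum_eq_single_of_mem c (by simp [hc]) (by
    intro b _ hb; simp [hb])] at h4
  simp only [if_true, mul_one] at h4
  rw [← h4, Finset.card_filter]
  refine Finset.sum_congr rfl fun w _ => ?_
  congr 1
  rw [Finsupp.ext_iff, eq_iff_iff]
  refine forall_congr' fun a => ?_
  rw [Finsupp.finsetSum_apply]
  rw [Finset.card_filter]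
  simp only [Finsupp.single_apply, Finsupp.equivFunOnFinite_symm_apply_apply]

theorem finrank_U (c : Fin n → ℤ) (h0 : ∀ a, 0 ≤ c a) (hs : ∑ a, c a = N) :
    (∏ a, (c a).toNat.factorial) * finrank K (U q N c) = N.factorial := by
  classical
  have h1 : finrank K (U q N c) = Nat.multinomial univ (fun a => (c a).toNat) := by
    rw [(Rep.e (HA.lift (uT_isHF (fun w : Fin N → Fin n => content w = c) (content_hp c) q))).finrank_eq]
    rw [Module.finrank_pi, Fintype.card_subtype, ← word_count]
    · congr 1
      ext w
      simp only [mem_filter, mem_univ, true_and]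
      rw [funext_iff]
      refine forall_congr' fun a => ?_
      unfold content
      have := h0 a
      omega
    · zify; rw [← hs]
      exact Finset.sum_congr rfl fun a _ => Int.toNat_of_nonneg (h0 a)
  rw [h1, Nat.multinomial_spec]
  congr 1
  zify; rw [← hs]
  exact Finset.sum_congr rfl fun a _ => Int.toNat_of_nonneg (h0 a)

theorem finrank_U_sft (l : Fin n → ℕ) (σ : Equiv.Perm (Fin n)) (hs : ∑ a, sft l σ a = N) :
    (∏ a, (l a).factorial) * finrank K (U q N (sft l σ)) =
      N.factorial * ∏ a, (l a).descFactorial (rho n (σ a)) := by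
  by_cases h : ∀ a, 0 ≤ sft l σ a
  · rw [← finrank_U (q := q) _ h hs]
    have : ∀ a, (l a).factorial = (sft l σ a).toNat.factorial * (l a).descFactorial (rho n (σ a)) := by
      intro a
      have := h a
      unfold sft at *
      rw [← Nat.factorial_mul_descFactorial (n := l a) (k := rho n (σ a)) (by omega)]
      congr 2
      omega
    rw [Finset.prod_congr rfl fun a _ => this a, Finset.prod_mul_distrib]
    ring
  · have := U_fun_zero (q := q) (N := N) (sft l σ) (fun h' => h h'.1)
    rw [finrank_zero_of_subsingleton]
    push Not at h
    obtain ⟨a, ha⟩ := h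
    rw [Finset.prod_eq_zero (f := fun a => (l a).descFactorial (rho n (σ a))) (mem_univ a)]
    · simp
    · rw [Nat.descFactorial_eq_zero_iff_lt]
      unfold sft at ha
      omega

theorem det_desc_ne (l : Fin n → ℕ) (hl : Function.Injective l) :
    ∑ σ : Equiv.Perm (Fin n), (Equiv.Perm.sign σ : ℤ) *
      ∏ a, ((l a).descFactorial (rho n (σ a)) : ℤ) ≠ 0 := by
  have h1 := Matrix.det_eval_matrixOfPolynomials_eq_det_vandermonde (fun i => (l i : ℤ))
    (fun i => descPochhammer ℤ i) (fun i => descPochhammer_natDegree ℤ i)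
    (fun i => monic_descPochhammer ℤ i)
  have h2 : (Matrix.vandermonde (fun i => (l i : ℤ))).det ≠ 0 :=
    Matrix.det_vandermonde_ne_zero_iff.2 (fun a b h => hl (by simpa using h))
  rw [h1] at h2
  have h3 := Matrix.det_permute' (Fin.revPerm) (Matrix.of fun i j : Fin n =>
    Polynomial.eval (l i : ℤ) (descPochhammer ℤ j))
  have h4 : ((Matrix.of fun i j : Fin n =>
    Polynomial.eval (l i : ℤ) (descPochhammer ℤ j)).submatrix id Fin.revPerm).det ≠ 0 := by
    rw [h3]
    exact mul_ne_zero (by simp) h2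
  rw [← Matrix.det_transpose, Matrix.det_apply'] at h4
  convert h4 using 4 with σ _ a _
  · rw [Int.cast_id]
  · rw [Matrix.transpose_apply, Matrix.submatrix_apply, Matrix.of_apply,
      descPochhammer_eval_eq_descFactorial, rho_rev]; rfl

theorem sum_finrank_U (l : Fin n → ℕ) (hl : Function.Injective l) (hs : ∀ σ, ∑ a, sft l σ a = N) :
    (N.factorial : ℤ) ≤ (∏ a, (l a).factorial : ℕ) *
    |∑ σ : Equiv.Perm (Fin n), (Equiv.Perm.sign σ : ℤ) * (finrank K (U q N (sft l σ)) : ℤ)| := by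
  have h1 : ((∏ a, (l a).factorial : ℕ) : ℤ) *
    ∑ σ : Equiv.Perm (Fin n), (Equiv.Perm.sign σ : ℤ) * (finrank K (U q N (sft l σ)) : ℤ) =
    N.factorial * ∑ σ : Equiv.Perm (Fin n), (Equiv.Perm.sign σ : ℤ) *
      ∏ a, ((l a).descFactorial (rho n (σ a)) : ℤ) := by
    rw [mul_sum, mul_sum]
    refine Finset.sum_congr rfl fun σ _ => ?_
    have := finrank_U_sft (q := q) l σ (hs σ)
    zify at this
    push_cast
    linear_combination (Equiv.Perm.sign σ : ℤ) * this
  have h2 := Int.one_le_abs (det_desc_ne l hl)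
  have h3 := congrArg abs h1
  rw [abs_mul, abs_mul, Nat.abs_cast, Nat.abs_cast] at h3
  rw [h3]
  nlinarith [Nat.factorial_pos N]

theorem finrank_VM {r : Fin d → Fin d → Fin d → Fin d → K} (hr : IsR q r) (N : ℕ) :
    finrank K (VM hr N) = d ^ N := by
  rw [(Rep.e (HA.lift (tT_isHF hr N))).finrank_eq]
  simp

/-- the weight used -/
def lw (n m s : ℕ) : Fin (n + 1) → ℕ := fun i => (rho (n + 1) i + if i = 0 then s else 0) + m

theorem lw_inj (n m s : ℕ) : Function.Injective (lw n m s) := by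
  intro i j h
  unfold lw rho at h
  have hi := i.2
  have hj := j.2
  by_contra hne
  have hne' : i.1 ≠ j.1 := fun h => hne (Fin.ext h)
  have z : ((0 : Fin (n + 1)) : ℕ) = 0 := rfl
  by_cases h1 : i = 0
  · by_cases h2 : j = 0
    · exact hne (h1.trans h2.symm)
    · rw [if_pos h1, if_neg h2] at h
      rw [Fin.ext_iff, z] at h1
      omega
  · by_cases h2 : j = 0
    · rw [if_neg h1, if_pos h2] at h
      rw [Fin.ext_iff, z] at h2
      omega
    · rw [if_neg h1, if_neg h2] at h
      omega

theorem lw_bound (n m s : ℕ) (i) : lw n m s i ≤ m + s + n := by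
  unfold lw rho; split_ifs <;> omega

theorem lw_sum (n m s : ℕ) : ∑ a, (lw n m s a : ℤ) = ((n + 1) * m + s : ℕ) + ∑ a, (rho (n + 1) a : ℤ) := by
  unfold lw
  push_cast
  rw [sum_add_distrib, sum_add_distrib]
  simp
  ring

theorem dim_bound [IsSemisimpleRing (HA q ((n + 1) * m + s))]
    {r : Fin d → Fin d → Fin d → Fin d → K} (hr : IsR q r)
    (a : Fin (n + 1) → ℂ) (ha : ∏ i, a i = 1) (hh' : ∀ k : ℕ, hh a k = (sd r q k : ℂ)) :
    sd r q s * ((n + 1) * m + s).factorial ≤ d ^ ((n + 1) * m + s) * ∏ i, (lw n m s i).factorial := by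
  set M := (n + 1) * m + s with hM
  have hs := sft_sum (N := M) (lw n m s) (lw_sum n m s)
  have hD : Dl q M (lw n m s) (VM hr M) = sd r q s := by
    have h := Dl_VM hr a (lw n m s) hs _ (lw_bound n m s) (fun k _ => hh' k)
    unfold lw at h
    rw [det_Hm_add, det_Hm_base, ha, one_pow, one_mul, hh'] at h
    exact_mod_cast h
  have hU := sum_finrank_U (q := q) (lw n m s) (lw_inj n m s) hs
  rcases fl_main (q := q) (lw n m s) hs with ⟨h3, -⟩ | ⟨S, _, _, _, _, _, ε, hε, hS, h3, h4⟩
  · rw [h3] at hD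
    have : sd r q s = 0 := by exact_mod_cast hD.symm
    rw [this]; simp
  · rw [h3] at hD
    rw [h4] at hU
    have h5 := mult_bound (K := K) (HA q M) hS _ (VM hr M) (finrank_VM hr M)
    have h6 : |ε| = 1 := by rcases hε with rfl | rfl <;> simp
    rw [abs_mul, h6, one_mul, Nat.abs_cast] at hU
    have h7 : pair K (HA q M) S (VM hr M) = sd r q s := by
      have := congrArg abs hD
      rw [abs_mul, h6, one_mul, Nat.abs_cast, Nat.abs_cast] at this
      exact_mod_cast this
    rw [h7] at h5
    have hU' : M.factorial ≤ (∏ i, (lw n m s i).factorial) * finrank K S := by exact_mod_cast hU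
    calc sd r q s * M.factorial ≤ sd r q s * ((∏ i, (lw n m s i).factorial) * finrank K S) :=
          Nat.mul_le_mul_left _ hU'
      _ = (sd r q s * finrank K S) * ∏ i, (lw n m s i).factorial := by ring
      _ ≤ _ := Nat.mul_le_mul_right _ h5

end dimU
end Hk

namespace Hk
open Module Finset
universe u

section est

theorem fact_le_mul_pow (m c : ℕ) (h : c ≤ m) : m.factorial ≤ c.factorial * m ^ (m - c) := by
  have h1 := Nat.factorial_mul_descFactorial (n := m) (k := m - c) (by omega)
  rw [← h1, show m - (m - c) = c by omega]
  exact Nat.mul_le_mul_left _ (Nat.descFactorial_le_pow _ _)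

theorem fact_cmp (m c : ℕ) : m.factorial * m ^ c ≤ c.factorial * m ^ m := by
  rcases le_total c m with h | h
  · calc m.factorial * m ^ c ≤ (c.factorial * m ^ (m - c)) * m ^ c :=
          Nat.mul_le_mul_right _ (fact_le_mul_pow m c h)
      _ = c.factorial * m ^ m := by rw [mul_assoc, ← pow_add]; congr 2; omega
  · calc m.factorial * m ^ c = (m.factorial * m ^ (c - m)) * m ^ m := by
          rw [mul_assoc, ← pow_add]; congr 2; omega
      _ ≤ _ := Nat.mul_le_mul_right _ (Nat.factorial_mul_pow_sub_le_factorial h)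

theorem multi_bound (p m : ℕ) (hm : 0 < m) :
    p ^ (p * m) * m.factorial ^ p ≤ (p * m).factorial * (p * m + 1) ^ p := by
  have h1 := Finset.sum_pow_eq_sum_piAntidiag (univ : Finset (Fin p)) (fun _ => (1 : ℕ)) (p * m)
  simp only [one_pow, prod_const_one, mul_one, sum_const, card_univ, Fintype.card_fin, smul_eq_mul,
    Nat.cast_id] at h1
  rw [h1, sum_mul]
  have h2 : ∀ k ∈ piAntidiag (univ : Finset (Fin p)) (p * m),
      Nat.multinomial univ k * m.factorial ^ p ≤ (p * m).factorial := by
    intro k hk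
    simp only [mem_piAntidiag, mem_univ, implies_true, and_true] at hk
    have h3 := Nat.multinomial_spec univ k
    rw [hk] at h3
    rw [← h3, mul_comm]
    apply Nat.mul_le_mul_right
    have h4 : ∏ i : Fin p, (m.factorial * m ^ k i) ≤ ∏ i : Fin p, ((k i).factorial * m ^ m) :=
      Finset.prod_le_prod' fun i _ => fact_cmp m (k i)
    rw [prod_mul_distrib, prod_mul_distrib, prod_pow_eq_pow_sum, hk] at h4
    simp only [prod_const, card_univ, Fintype.card_fin, ← pow_mul] at h4
    rw [mul_comm m p] at h4
    exact Nat.le_of_mul_le_mul_right h4 (by positivity)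
  refine (Finset.sum_le_card_nsmul _ _ _ h2).trans ?_
  rw [smul_eq_mul, mul_comm]
  apply Nat.mul_le_mul_left
  calc (piAntidiag (univ : Finset (Fin p)) (p * m)).card
      ≤ (Fintype.piFinset (fun _ : Fin p => range (p * m + 1))).card := by
        apply card_le_card
        intro k hk
        simp only [mem_piAntidiag, mem_univ, implies_true, and_true] at hk
        rw [Fintype.mem_piFinset]
        intro i
        rw [mem_range, ← hk]
        exact Nat.lt_succ_of_le (Finset.single_le_sum (f := k) (fun _ _ => Nat.zero_le _) (mem_univ i))
    _ = _ := by simp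

theorem lw_prod (n m s : ℕ) : ∏ i, (lw n m s i).factorial ≤
    m.factorial ^ (n + 1) * (m + s + n + 1) ^ (s + (n + 1) ^ 2) := by
  have hge : ∀ i, m ≤ lw n m s i := fun i => by unfold lw; omega
  have h1 : ∀ i, (lw n m s i).factorial ≤ m.factorial * (m + s + n + 1) ^ (lw n m s i - m) := by
    intro i
    refine (fact_le_mul_pow _ m (hge i)).trans ?_
    apply Nat.mul_le_mul_left
    apply Nat.pow_le_pow_left
    have := lw_bound n m s i; omega
  refine (Finset.prod_le_prod' fun i _ => h1 i).trans ?_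
  rw [prod_mul_distrib, prod_pow_eq_pow_sum]
  simp only [prod_const, card_univ, Fintype.card_fin]
  apply Nat.mul_le_mul_left
  apply Nat.pow_le_pow_right (by omega)
  have h2 : ∀ i, lw n m s i - m = rho (n + 1) i + if i = 0 then s else 0 := by
    intro i; unfold lw; omega
  rw [Finset.sum_congr rfl fun i _ => h2 i, sum_add_distrib]
  have h3 : ∑ i, rho (n + 1) i ≤ (n + 1) ^ 2 := by
    refine (Finset.sum_le_card_nsmul _ _ (n + 1) (fun i _ => by unfold rho; omega)).trans ?_
    simp [sq]
  simp
  omega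

theorem exp_bd (k s : ℕ) (hk : 0 < k) (hs : s ≤ k) : (k + 1) ^ s ≤ 3 * k ^ s := by
  have h0 : (0:ℝ) < k := by exact_mod_cast hk
  have h1 : (1 / (k:ℝ) + 1) ^ s ≤ 3 := by
    calc (1 / (k:ℝ) + 1) ^ s ≤ (Real.exp (1 / (k:ℝ))) ^ s := by
          gcongr; exact Real.add_one_le_exp _
      _ = Real.exp (s * (1 / (k:ℝ))) := by rw [Real.exp_nat_mul]
      _ ≤ Real.exp 1 := by
          apply Real.exp_le_exp.2
          rw [mul_one_div, div_le_one h0]; exact_mod_cast hs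
      _ ≤ 3 := Real.exp_one_lt_three.le
  have h2 : ((k:ℝ) + 1) = (1 / (k:ℝ) + 1) * k := by field_simp; ring
  have h3 : ((k:ℝ) + 1) ^ s ≤ 3 * k ^ s := by
    rw [h2, mul_pow]; gcongr
  exact_mod_cast h3

theorem poly_bound (n s x : ℕ) (h : ∀ m, x * ((n + 1) * m + s).factorial ≤
      (n + 1) ^ ((n + 1) * m + s) * ∏ i, (lw n m s i).factorial) :
    x ≤ 3 * (s + n + 2) ^ (3 * (n + 1) + 2 * (n + 1) ^ 2) := by
  set p := n + 1 with hp
  set k := s + p with hk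
  have hk0 : 0 < k := by omega
  have h := h (k ^ 2)
  set m := k ^ 2 with hm
  have hm0 : 0 < m := by positivity
  have e1 := Nat.factorial_mul_pow_le_factorial (m := p * m) (n := s)
  have e2 := multi_bound p m hm0
  have e3 : ∏ i, (lw n m s i).factorial ≤ m.factorial ^ p * (k * (k + 1)) ^ (s + p ^ 2) := by
    have := lw_prod n m s
    rwa [show m + s + n + 1 = k * (k + 1) by rw [hm, hk, hp]; ring] at this
  have hF : 0 < (p * m).factorial := Nat.factorial_pos _
  have c1 : x * k ^ s ≤ (k + 1) ^ s * ((p * m + 1) ^ p * (k * (k + 1)) ^ (p ^ 2)) := by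
    have hpos : 0 < (p * m).factorial * p ^ s * k ^ s := by positivity
    apply Nat.le_of_mul_le_mul_left _ hpos
    calc (p * m).factorial * p ^ s * k ^ s * (x * k ^ s)
        = x * ((p * m).factorial * (p * m) ^ s) := by
          generalize (p * m).factorial = F
          rw [hm]; ring
      _ ≤ x * ((p * m).factorial * (p * m + 1) ^ s) := by gcongr; omega
      _ ≤ x * (p * m + s).factorial := by gcongr
      _ ≤ p ^ (p * m + s) * (m.factorial ^ p * (k * (k + 1)) ^ (s + p ^ 2)) := h.trans (by gcongr)
      _ = (p ^ (p * m) * m.factorial ^ p) * (p ^ s * (k * (k + 1)) ^ (s + p ^ 2)) := by ring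
      _ ≤ ((p * m).factorial * (p * m + 1) ^ p) * (p ^ s * (k * (k + 1)) ^ (s + p ^ 2)) := by gcongr
      _ = _ := by
          rw [pow_add (k * (k + 1)), mul_pow k (k + 1) s]
          generalize (k * (k + 1)) ^ p ^ 2 = Z
          generalize (p * m + 1) ^ p = Y
          ring
  have c2 := exp_bd k s hk0 (by omega)
  have c3 : x ≤ 3 * ((p * m + 1) ^ p * (k * (k + 1)) ^ (p ^ 2)) := by
    apply Nat.le_of_mul_le_mul_right _ (show 0 < k ^ s by positivity)
    calc x * k ^ s ≤ (k + 1) ^ s * ((p * m + 1) ^ p * (k * (k + 1)) ^ (p ^ 2)) := c1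
      _ ≤ (3 * k ^ s) * ((p * m + 1) ^ p * (k * (k + 1)) ^ (p ^ 2)) := by gcongr
      _ = _ := by ring
  have c4 : p * m + 1 ≤ (k + 1) ^ 3 := by
    have : p * m ≤ k * m := Nat.mul_le_mul_right _ (by omega)
    rw [hm] at this ⊢
    nlinarith
  have c5 : k * (k + 1) ≤ (k + 1) ^ 2 := by nlinarith
  calc x ≤ 3 * ((p * m + 1) ^ p * (k * (k + 1)) ^ (p ^ 2)) := c3
    _ ≤ 3 * (((k + 1) ^ 3) ^ p * ((k + 1) ^ 2) ^ (p ^ 2)) := by gcongr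
    _ = 3 * (s + n + 2) ^ (3 * p + 2 * p ^ 2) := by
      rw [← pow_mul, ← pow_mul, ← pow_add, show k + 1 = s + n + 2 by omega]

end est
end Hk

namespace Hk
open Module Finset
universe u v

section ana

theorem norm_le_one {n : ℕ} (a : Fin n → ℂ) (E c : ℕ)
    (hb : ∀ s : ℕ, ‖hh a s‖ ≤ 3 * ((s : ℝ) + c) ^ E) (k : Fin n) : ‖a k‖ ≤ 1 := by
  by_contra hlt
  push Not at hlt
  set r := ‖a k‖ with hr
  set C : ℝ := ∑ j : Fin n, ‖(Ek a k).coeff j‖ with hC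
  have hC0 : 0 ≤ C := Finset.sum_nonneg fun _ _ => norm_nonneg _
  have h1 : ∀ l : ℕ, r ^ l ≤ C * (3 * ((l : ℝ) + c) ^ E) := by
    intro l
    rw [hr, ← norm_pow, pow_eq a k l, hC, sum_mul]
    refine (norm_sum_le _ _).trans (Finset.sum_le_sum fun j _ => ?_)
    rw [norm_mul, mul_comm]
    apply mul_le_mul_of_nonneg_left _ (norm_nonneg _)
    rcases lt_or_ge ((l : ℤ) - (j : ℕ)) 0 with h | h
    · rw [hh_neg _ _ h, norm_zero]; positivity
    · have e : ((l : ℤ) - (j : ℕ)) = ((l - j : ℕ) : ℤ) := by omega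
      rw [e]
      refine (hb _).trans ?_
      have : ((l - j : ℕ) : ℝ) ≤ l := by exact_mod_cast Nat.sub_le _ _
      gcongr
  have h2 := (tendsto_pow_const_div_const_pow_of_one_lt E hlt).const_mul (C * 3 * r ^ c)
  rw [mul_zero] at h2
  have h3 := (h2.eventually (gt_mem_nhds (zero_lt_one))).and (Filter.eventually_ge_atTop c)
  obtain ⟨L, hL, hcL⟩ := h3.exists
  have h4 := h1 (L - c)
  have h5 : ((L - c : ℕ) : ℝ) + c = L := by rw [Nat.cast_sub hcL]; ring
  rw [h5] at h4
  have h6 : r ^ L = r ^ (L - c) * r ^ c := by rw [← pow_add]; congr 1; omega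
  have hrp : 0 < r := by linarith
  have h7 : r ^ L ≤ C * 3 * r ^ c * (L : ℝ) ^ E := by
    rw [h6]
    calc r ^ (L - c) * r ^ c ≤ C * (3 * (L : ℝ) ^ E) * r ^ c := by gcongr
      _ = _ := by ring
  have h8 : C * 3 * r ^ c * ((L : ℝ) ^ E / r ^ L) < 1 := hL
  rw [← mul_div_assoc, div_lt_one (by positivity)] at h8
  linarith

theorem eq_one_of_sum {n : ℕ} (a : Fin n → ℂ) (h : ∀ k, ‖a k‖ ≤ 1) (hs : ∑ i, a i = n) :
    ∀ k, a k = 1 := by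
  have h1 : ∀ k, (a k).re ≤ 1 := fun k => (Complex.re_le_norm _).trans (h k)
  have h2 : ∑ i, (a i).re = n := by
    have := congrArg Complex.re hs
    simpa using this
  have h3 : ∑ i, (1 - (a i).re) = 0 := by rw [sum_sub_distrib, h2]; simp
  rw [Finset.sum_eq_zero_iff_of_nonneg (fun i _ => by linarith [h1 i])] at h3
  intro k
  have hre : (a k).re = 1 := by linarith [h3 k (mem_univ k)]
  have him : (a k).im = 0 := by
    have h4 := Complex.sq_norm (a k)
    rw [Complex.normSq_apply, hre] at h4
    have h5 : ‖a k‖ ^ 2 ≤ 1 := by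
      have := h k; have := norm_nonneg (a k); nlinarith
    nlinarith [sq_nonneg (a k).im]
  exact Complex.ext (by simpa using hre) (by simpa using him)

variable {K : Type u} [Field K] {q : K}

theorem sd_eq_card {n : ℕ} (hss : ∀ N, IsSemisimpleRing (HA q N)) (hq : q ≠ -1)
    {r : Fin n → Fin n → Fin n → Fin n → K} (hr : IsR q r)
    (h1 : pair K (HA q n) (sgnM q n) (VM hr n) = 1)
    (h0 : ∀ k, n < k → pair K (HA q k) (sgnM q k) (VM hr k) = 0) (k : ℕ) :
    sd r q k = (Sk n k).card := by
  obtain ⟨a, ha, hk⟩ := exists_roots hss hq hr n h1 h0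
  have key : ∀ i, a i = 1 := by
    rcases n with _ | n
    · exact fun i => i.elim0
    · apply eq_one_of_sum
      · refine norm_le_one a (3 * (n + 1) + 2 * (n + 1) ^ 2) (n + 2) fun s => ?_
        rw [hk]
        have := poly_bound n s (sd r q s) (fun m => by
          have := hss ((n + 1) * m + s)
          exact dim_bound hr a ha hk)
        rw [Complex.norm_natCast]
        have h2 : ((sd r q s : ℕ) : ℝ) ≤ ((3 * (s + n + 2) ^ (3 * (n + 1) + 2 * (n + 1) ^ 2) : ℕ) : ℝ) := by
          exact_mod_cast this
        refine h2.trans (le_of_eq ?_)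
        push_cast
        ring
      · rw [← hh_one]
        have := hk 1
        rw [sd_one] at this
        exact_mod_cast this
  have e : a = fun i => ((1 : ℤ) : ℂ) := by funext i; rw [key]; simp
  have h3 := hk k
  rw [e] at h3
  have h4 := hh_map (Int.castRingHom ℂ) (fun _ : Fin n => (1 : ℤ)) k
  simp only [eq_intCast] at h4
  rw [← h4, ← card_Sk_hh] at h3
  have h5 : ((Sk n k).card : ℂ) = (sd r q k : ℂ) := by exact_mod_cast h3
  exact_mod_cast h5.symm

theorem final_pair {n : ℕ} (hss : ∀ N, IsSemisimpleRing (HA q N)) (hq : q ≠ -1)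
    {r : Fin n → Fin n → Fin n → Fin n → K} (hr : IsR q r)
    (h1 : pair K (HA q n) (sgnM q n) (VM hr n) = 1)
    (h0 : ∀ k, n < k → pair K (HA q k) (sgnM q k) (VM hr k) = 0) (k : ℕ) :
    pair K (HA q k) (VM hr k) (VM hr k) = (n ^ 2 + k - 1).choose k := by
  have := hss k
  obtain ⟨e⟩ := F3 (q := q) (N := k) (VM hr k) (UA q k n) (fun μ hμ hs => by
    rw [pair_U_VM hr μ hμ hs, pair_U_UA μ hs]
    refine Finset.prod_congr rfl fun a _ => ?_
    rw [sd_eq_card hss hq hr h1 h0, Int.toNat_of_nonneg (hμ a)])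
  rw [pair_congr_left (K := K) (HA q k) e, pair_congr_right (K := K) (HA q k) e, pair_UA_UA]

end ana
end Hk

/-- Corollary 3.3 (assertion about `E`): if `R` is an even Hecke operator of rank
equal to `n = dim V`, then `P_E(t) = (1−t)^{−n²}`, i.e. `e_k = C(n²+k−1, k)`. -/
theorem even_hecke_rank_eq_dim_poincare_E
    (K : Type*) [Field K] [CharZero K] (V : Type*) [AddCommGroup V] [Module K V]
    [FiniteDimensional K V] (q : K) (hq : q ≠ 0)
    (R Rinv : V ⊗[K] V →ₗ[K] V ⊗[K] V) (hR : IsHecke K V q R)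
    (hRinv : R ∘ₗ Rinv = LinearMap.id ∧ Rinv ∘ₗ R = LinearMap.id)
    (hqint : ∀ k : ℕ, 1 ≤ k → (∑ i ∈ Finset.range k, q ^ i) ≠ 0)
    (n : ℕ) (hn : n = Module.finrank K V)
    (hr : lambdaDim K V R n = 1) (hr' : ∀ k, n < k → lambdaDim K V R k = 0) :
    ∀ k, eDim K V R Rinv k = (n ^ 2 + k - 1).choose k := by
  intro k
  let b : Module.Basis (Fin n) K V := Module.finBasisOfFinrankEq K V hn.symm
  have hI := Hk.rc_isR b R hR
  have hq1 : q ≠ -1 := by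
    rintro rfl
    have := hqint 2 (by norm_num)
    simp [Finset.sum_range_succ] at this
  rw [Hk.e_pair b R Rinv hRinv.2 hRinv.1 hI]
  refine Hk.final_pair (Hk.HA_semisimple q hq hqint) hq1 hI ?_ ?_ k
  · rw [← Hk.lambda_pair b R hI]; exact hr
  · intro k hk
    rw [← Hk.lambda_pair b R hI]; exact hr' k hk
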